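/- (Yoccoz) Let F_I^∞ be the set of orientation-preserving C^∞ circle diffeomorphisms with irrational rotation number. Then: (i) for a generic set of f ∈ F_I^∞ (for the C^∞ topology), Z^∞(f) = Z_0^∞(f); (ii) moreover, for a dense set of f ∈ F_I^∞, Z^∞(f) = Z_0^∞(f) = {fⁿ : n ∈ Z}. -/

import Mathlib

open Filter Topology

/-- `ρ` is the rotation (translation) number of the lift `F`. -/
def IsRotNumber (F : ℝ → ℝ) (ρ : ℝ) : Prop :=
  ∀ x : ℝ, Tendsto (fun n : ℕ => (F^[n] x - x) / (n : ℝ)) atTop (𝓝 ρ)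

/-- The space of lifts of orientation-preserving `C^∞` circle diffeomorphisms. -/
def SmoothLift : Type :=
  {F : ℝ → ℝ // ContDiff ℝ (⊤ : ℕ∞) F ∧ (∀ x, 0 < deriv F x) ∧ ∀ x, F (x + 1) = F x + 1}

/-- The `C^∞` topology on lifts of smooth circle diffeomorphisms: the topology induced
by the uniform (= compact-open, by periodicity) convergence of all derivatives. -/
noncomputable instance : TopologicalSpace SmoothLift :=
  TopologicalSpace.induced
    (fun F => fun r : ℕ =>
      (⟨iteratedDeriv r F.1, F.2.1.continuous_iteratedDeriv r (by exact_mod_cast le_top)⟩ :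
        C(ℝ, ℝ)))
    inferInstance

/-- `G` is (a lift of) an integer iterate `fⁿ`, `n ∈ ℤ`, of the circle diffeomorphism
with lift `F` : either `G = F^[n] + k` (positive iterates) or `F^[n] ∘ G = id + k`
(negative iterates), for some `n ∈ ℕ`, `k ∈ ℤ`. -/
def IsIterateLift (F G : ℝ → ℝ) : Prop :=
  ∃ (n : ℕ) (k : ℤ), (∀ x, G x = F^[n] x + k) ∨ (∀ x, F^[n] (G x) = x + k)

/-- The `C^∞`-centralizer of the circle diffeomorphism with lift `F`, as a set of lifts:
lifts of smooth circle diffeomorphisms commuting with `f` on the circle. -/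
def CentralizerLifts (F : ℝ → ℝ) : Set SmoothLift :=
  {G : SmoothLift | ∃ k : ℤ, ∀ x, G.1 (F x) = F (G.1 x) + k}

/-- The space `F_I^∞` of (lifts of) orientation-preserving `C^∞` circle diffeomorphisms
with irrational rotation number. -/
def FIrrational : Type :=
  {F : SmoothLift // ∃ ρ : ℝ, Irrational ρ ∧ IsRotNumber F.1 ρ}

noncomputable instance : TopologicalSpace FIrrational :=
  instTopologicalSpaceSubtype

/-! ### Lifts of smooth circle diffeomorphisms form a topological group -/

namespace SmoothLift

instance : FunLike SmoothLift ℝ ℝ where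
  coe f := f.1
  coe_injective _ _ h := Subtype.ext h

@[ext] lemma ext {f g : SmoothLift} (h : ∀ x, f x = g x) : f = g :=
  DFunLike.ext _ _ h

lemma contDiff (f : SmoothLift) : ContDiff ℝ (⊤ : ℕ∞) f := f.2.1

lemma contDiff_nat (f : SmoothLift) (n : ℕ) : ContDiff ℝ n f :=
  f.contDiff.of_le (by exact_mod_cast le_top)

lemma deriv_pos (f : SmoothLift) (x : ℝ) : 0 < deriv f x := f.2.2.1 x

lemma map_add_one (f : SmoothLift) (x : ℝ) : f (x + 1) = f x + 1 := f.2.2.2 x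

lemma differentiable (f : SmoothLift) : Differentiable ℝ f :=
  f.contDiff.differentiable (by simp)

lemma continuous (f : SmoothLift) : Continuous f := f.differentiable.continuous

lemma hasDerivAt (f : SmoothLift) (x : ℝ) : HasDerivAt f (deriv f x) x :=
  f.differentiable.differentiableAt.hasDerivAt

lemma strictMono (f : SmoothLift) : StrictMono f := strictMono_of_deriv_pos f.deriv_pos

lemma monotone (f : SmoothLift) : Monotone f := f.strictMono.monotone

lemma injective (f : SmoothLift) : Function.Injective f := f.strictMono.injective

lemma map_add_nat (f : SmoothLift) (x : ℝ) (n : ℕ) : f (x + n) = f x + n := by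
  induction n with
  | zero => simp
  | succ n ih => push_cast; rw [← add_assoc, f.map_add_one, ih, add_assoc]

lemma map_add_int (f : SmoothLift) (x : ℝ) (n : ℤ) : f (x + n) = f x + n := by
  obtain ⟨m, rfl | rfl⟩ := n.eq_nat_or_neg
  · exact_mod_cast f.map_add_nat x m
  · have := f.map_add_nat (x - m) m
    push_cast
    rw [sub_add_cancel] at this
    rw [this, ← sub_eq_add_neg]
    ring

lemma surjective (f : SmoothLift) : Function.Surjective f := by
  intro y
  have h1 : f (⌊y - f 0⌋ : ℝ) ≤ y := by
    have := f.map_add_int 0 ⌊y - f 0⌋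
    rw [zero_add] at this
    rw [this]
    linarith [Int.floor_le (y - f 0)]
  have h2 : y ≤ f ((⌊y - f 0⌋ : ℝ) + 1) := by
    have := f.map_add_int 0 ⌊y - f 0⌋
    rw [zero_add] at this
    rw [f.map_add_one, this]
    linarith [Int.lt_floor_add_one (y - f 0)]
  obtain ⟨x, -, hx⟩ := intermediate_value_Icc (by linarith) f.continuous.continuousOn ⟨h1, h2⟩
  exact ⟨x, hx⟩

/-- A lift as a homeomorphism of the line. -/
noncomputable def homeo (f : SmoothLift) : ℝ ≃ₜ ℝ :=
  (f.strictMono.orderIsoOfSurjective f f.surjective).toHomeomorph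

/-- The inverse lift. -/
noncomputable def inverse (f : SmoothLift) : SmoothLift :=
  have hc : ContDiff ℝ (⊤ : ℕ∞) f.homeo.symm :=
    f.homeo.contDiff_symm_deriv (fun x => (f.deriv_pos x).ne') f.hasDerivAt f.contDiff
  ⟨f.homeo.symm, hc, fun x => by
    have h2 : HasDerivAt f.homeo.symm (deriv f (f.homeo.symm x))⁻¹ x :=
      HasDerivAt.of_local_left_inverse f.homeo.symm.continuous.continuousAt
        (f.hasDerivAt _) (f.deriv_pos _).ne' (Eventually.of_forall f.homeo.apply_symm_apply)
    rw [h2.deriv]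
    exact inv_pos.2 (f.deriv_pos _), fun x => by
    apply f.injective
    rw [f.map_add_one]
    exact (f.homeo.apply_symm_apply _).trans
      (congrArg (· + 1) (f.homeo.apply_symm_apply x).symm)⟩

/-- Composition of lifts. -/
def comp (f g : SmoothLift) : SmoothLift :=
  ⟨fun x => f (g x), f.contDiff.comp g.contDiff, fun x => by
    have := ((f.hasDerivAt (g x)).comp x (g.hasDerivAt x)).deriv
    exact this.symm ▸ mul_pos (f.deriv_pos _) (g.deriv_pos _), fun x => by
    simp only [g.map_add_one, f.map_add_one]⟩

/-- Translation by `t`. -/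
def tr (t : ℝ) : SmoothLift :=
  ⟨fun x => x + t, by fun_prop, fun x => by simp, fun x => by ring⟩

noncomputable instance : Group SmoothLift where
  mul := comp
  one := tr 0
  inv := inverse
  mul_assoc _ _ _ := rfl
  one_mul f := ext fun x => add_zero (f x)
  mul_one f := ext fun x => congrArg f (add_zero x)
  inv_mul_cancel f := ext fun x => (f.homeo.symm_apply_apply x).trans (add_zero x).symm

@[simp] lemma one_apply (x : ℝ) : (1 : SmoothLift) x = x := add_zero x

@[simp] lemma mul_apply (f g : SmoothLift) (x : ℝ) : (f * g) x = f (g x) := rfl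

@[simp] lemma inv_apply_apply (f : SmoothLift) (x : ℝ) : f⁻¹ (f x) = x := by
  rw [← mul_apply, inv_mul_cancel, one_apply]

@[simp] lemma apply_inv_apply (f : SmoothLift) (x : ℝ) : f (f⁻¹ x) = x := by
  rw [← mul_apply, mul_inv_cancel, one_apply]

@[simp] lemma tr_apply (t x : ℝ) : tr t x = x + t := rfl

lemma coe_one : ((1 : SmoothLift) : ℝ → ℝ) = id := funext one_apply

lemma coe_mul (f g : SmoothLift) : ((f * g : SmoothLift) : ℝ → ℝ) = f ∘ g := rfl

lemma coe_pow (f : SmoothLift) (n : ℕ) : ((f ^ n : SmoothLift) : ℝ → ℝ) = f^[n] := by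
  induction n with
  | zero => rw [pow_zero, coe_one]; rfl
  | succ n ih => rw [pow_succ, coe_mul, ih, Function.iterate_succ]

lemma pow_apply (f : SmoothLift) (n : ℕ) (x : ℝ) : (f ^ n) x = f^[n] x := by rw [coe_pow]

lemma tr_zero : tr 0 = 1 := rfl

lemma tr_add (s t : ℝ) : tr (s + t) = tr s * tr t := by ext x; simp; ring

lemma tr_neg (t : ℝ) : tr (-t) = (tr t)⁻¹ := by
  rw [eq_inv_iff_mul_eq_one, ← tr_add, neg_add_cancel, tr_zero]

lemma commute_tr_int (f : SmoothLift) (n : ℤ) : Commute f (tr n) := by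
  ext x; simp [f.map_add_int]

lemma tr_one_zpow (n : ℤ) : tr 1 ^ n = tr n := by
  induction n with
  | zero => simp [tr_zero]
  | succ n ih => rw [zpow_add_one, ih, ← tr_add]; simp
  | pred n ih => rw [zpow_sub_one, ih, ← tr_neg, ← tr_add]; simp [sub_eq_add_neg]

lemma deriv_mul (f g : SmoothLift) (x : ℝ) :
    deriv (f * g : SmoothLift) x = deriv f (g x) * deriv g x :=
  ((f.hasDerivAt (g x)).comp x (g.hasDerivAt x)).deriv

lemma deriv_one (x : ℝ) : deriv (1 : SmoothLift) x = 1 := by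
  rw [coe_one]; simp

lemma deriv_inv (f : SmoothLift) (x : ℝ) :
    deriv (f⁻¹ : SmoothLift) x = (deriv f (f⁻¹ x))⁻¹ := by
  have h := deriv_mul f f⁻¹ x
  rw [mul_inv_cancel, deriv_one] at h
  exact eq_inv_of_mul_eq_one_right h.symm

/-! #### Topology -/

lemma contDiff_iteratedDeriv {g : ℝ → ℝ} (hg : ContDiff ℝ (⊤ : ℕ∞) g) (k : ℕ) :
    ContDiff ℝ (⊤ : ℕ∞) (iteratedDeriv k g) := by
  induction k with
  | zero => simpa using hg
  | succ k ih =>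
    rw [iteratedDeriv_succ]
    exact (contDiff_infty_iff_deriv.1 ih).2

/-- The `k`-th derivative as a continuous map. -/
noncomputable def jet (f : SmoothLift) (k : ℕ) : C(ℝ, ℝ) :=
  ⟨iteratedDeriv k f, (contDiff_iteratedDeriv f.contDiff k).continuous⟩

@[simp] lemma jet_apply (f : SmoothLift) (k : ℕ) (x : ℝ) : f.jet k x = iteratedDeriv k f x := rfl

lemma isInducing_jet : IsInducing jet := ⟨rfl⟩

lemma continuous_jet (k : ℕ) : Continuous fun f : SmoothLift => f.jet k :=
  (continuous_apply k).comp isInducing_jet.continuous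

lemma continuous_iteratedDeriv (k : ℕ) :
    Continuous fun p : SmoothLift × ℝ => iteratedDeriv k p.1 p.2 :=
  ContinuousEval.continuous_eval.comp ((continuous_jet k).prodMap continuous_id)

lemma continuous_iff {X : Type*} [TopologicalSpace X] {Φ : X → SmoothLift} :
    Continuous Φ ↔ ∀ k, Continuous fun p : X × ℝ => iteratedDeriv k (Φ p.1) p.2 := by
  refine ⟨fun h k => (continuous_iteratedDeriv k).comp (h.prodMap continuous_id), fun h => ?_⟩
  rw [isInducing_jet.continuous_iff]
  exact continuous_pi fun k => ContinuousMap.continuous_of_continuous_uncurry _ (h k)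

lemma tendsto_iff {ι : Type*} {l : Filter ι} {u : ι → SmoothLift} {v : SmoothLift} :
    Tendsto u l (𝓝 v) ↔ ∀ k, TendstoLocallyUniformly
      (fun i => iteratedDeriv k (u i)) (iteratedDeriv k v) l := by
  rw [isInducing_jet.tendsto_nhds_iff, tendsto_pi_nhds]
  exact forall_congr' fun k => ContinuousMap.tendsto_iff_tendstoLocallyUniformly

lemma continuous_eval : Continuous fun p : SmoothLift × ℝ => p.1 p.2 := by
  simpa using continuous_iteratedDeriv 0

lemma continuous_deriv : Continuous fun p : SmoothLift × ℝ => deriv p.1 p.2 := by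
  simpa using continuous_iteratedDeriv 1

instance : T2Space SmoothLift := by
  refine T2Space.of_injective_continuous (f := jet) (fun f g h => ext fun x => ?_)
    isInducing_jet.continuous
  simpa using congrArg (fun u => u 0 x) h

section JointSmooth

variable {X : Type*} [TopologicalSpace X]

/-- A family of smooth functions whose derivatives up to order `k` are jointly continuous. -/
def JointSmooth (k : ℕ) (A : X → ℝ → ℝ) : Prop :=
  (∀ x, ContDiff ℝ (⊤ : ℕ∞) (A x)) ∧
    ∀ i ≤ k, Continuous fun p : X × ℝ => iteratedDeriv i (A p.1) p.2

lemma JointSmooth.zero_iff {A : X → ℝ → ℝ} : JointSmooth 0 A ↔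
    (∀ x, ContDiff ℝ (⊤ : ℕ∞) (A x)) ∧ Continuous fun p : X × ℝ => A p.1 p.2 := by
  simp [JointSmooth]

lemma JointSmooth.succ_iff {k : ℕ} {A : X → ℝ → ℝ} : JointSmooth (k + 1) A ↔
    JointSmooth 0 A ∧ JointSmooth k (fun x => deriv (A x)) := by
  constructor
  · rintro ⟨h1, h2⟩
    refine ⟨⟨h1, fun i hi => h2 i (by omega)⟩, fun x => (contDiff_infty_iff_deriv.1 (h1 x)).2,
      fun i hi => ?_⟩
    simpa only [iteratedDeriv_succ'] using h2 (i + 1) (by omega)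
  · rintro ⟨⟨h1, h2⟩, h3, h4⟩
    refine ⟨h1, fun i hi => ?_⟩
    rcases i with _ | i
    · exact h2 0 le_rfl
    · simpa only [iteratedDeriv_succ'] using h4 i (by omega)

lemma JointSmooth.of_succ {k : ℕ} {A : X → ℝ → ℝ} (h : JointSmooth (k + 1) A) :
    JointSmooth k A := ⟨h.1, fun i hi => h.2 i (by omega)⟩

lemma JointSmooth.add {k : ℕ} {A B : X → ℝ → ℝ} (hA : JointSmooth k A) (hB : JointSmooth k B) :
    JointSmooth k (fun x t => A x t + B x t) := by
  induction k generalizing A B with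
  | zero =>
    rw [JointSmooth.zero_iff] at *
    exact ⟨fun x => (hA.1 x).add (hB.1 x), hA.2.add hB.2⟩
  | succ k ih =>
    have h1 := fun x => (hA.1 x).differentiable (by simp)
    have h2 := fun x => (hB.1 x).differentiable (by simp)
    refine JointSmooth.succ_iff.2 ⟨?_, ?_⟩
    · have h3 := JointSmooth.zero_iff.1 (JointSmooth.succ_iff.1 hA).1
      have h4 := JointSmooth.zero_iff.1 (JointSmooth.succ_iff.1 hB).1
      exact JointSmooth.zero_iff.2 ⟨fun x => (h3.1 x).add (h4.1 x), h3.2.add h4.2⟩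
    · have : (fun x => deriv (fun t => A x t + B x t)) =
          fun x t => deriv (A x) t + deriv (B x) t := by
        ext x t
        exact deriv_fun_add (h1 x t) (h2 x t)
      rw [this]
      exact ih (JointSmooth.succ_iff.1 hA).2 (JointSmooth.succ_iff.1 hB).2

lemma JointSmooth.mul {k : ℕ} {A B : X → ℝ → ℝ} (hA : JointSmooth k A) (hB : JointSmooth k B) :
    JointSmooth k (fun x t => A x t * B x t) := by
  induction k generalizing A B with
  | zero =>
    rw [JointSmooth.zero_iff] at *
    exact ⟨fun x => (hA.1 x).mul (hB.1 x), hA.2.mul hB.2⟩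
  | succ k ih =>
    have h1 := fun x => (hA.1 x).differentiable (by simp)
    have h2 := fun x => (hB.1 x).differentiable (by simp)
    refine JointSmooth.succ_iff.2 ⟨?_, ?_⟩
    · have h3 := JointSmooth.zero_iff.1 (JointSmooth.succ_iff.1 hA).1
      have h4 := JointSmooth.zero_iff.1 (JointSmooth.succ_iff.1 hB).1
      exact JointSmooth.zero_iff.2 ⟨fun x => (h3.1 x).mul (h4.1 x), h3.2.mul h4.2⟩
    · have : (fun x => deriv (fun t => A x t * B x t)) =
          fun x t => deriv (A x) t * B x t + A x t * deriv (B x) t := by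
        ext x t
        exact deriv_fun_mul (h1 x t) (h2 x t)
      rw [this]
      exact (ih (JointSmooth.succ_iff.1 hA).2 hB.of_succ).add
        (ih hA.of_succ (JointSmooth.succ_iff.1 hB).2)

lemma JointSmooth.comp {k : ℕ} {A B : X → ℝ → ℝ} (hA : JointSmooth k A) (hB : JointSmooth k B) :
    JointSmooth k (fun x t => A x (B x t)) := by
  induction k generalizing A B with
  | zero =>
    rw [JointSmooth.zero_iff] at *
    exact ⟨fun x => (hA.1 x).comp (hB.1 x), hA.2.comp (continuous_fst.prodMk hB.2)⟩
  | succ k ih =>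
    have h1 := fun x => (hA.1 x).differentiable (by simp)
    have h2 := fun x => (hB.1 x).differentiable (by simp)
    refine JointSmooth.succ_iff.2 ⟨?_, ?_⟩
    · have h3 := JointSmooth.zero_iff.1 (JointSmooth.succ_iff.1 hA).1
      have h4 := JointSmooth.zero_iff.1 (JointSmooth.succ_iff.1 hB).1
      exact JointSmooth.zero_iff.2 ⟨fun x => (h3.1 x).comp (h4.1 x),
        h3.2.comp (continuous_fst.prodMk h4.2)⟩
    · have : (fun x => deriv (fun t => A x (B x t))) =
          fun x t => deriv (A x) (B x t) * deriv (B x) t := by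
        ext x t
        exact (((h1 x (B x t)).hasDerivAt).comp t (h2 x t).hasDerivAt).deriv
      rw [this]
      exact (ih (JointSmooth.succ_iff.1 hA).2 hB.of_succ).mul (JointSmooth.succ_iff.1 hB).2

lemma JointSmooth.inv {k : ℕ} {A : X → ℝ → ℝ} (hA : JointSmooth k A) (h0 : ∀ x t, A x t ≠ 0) :
    JointSmooth k (fun x t => (A x t)⁻¹) := by
  induction k generalizing A with
  | zero =>
    rw [JointSmooth.zero_iff] at *
    exact ⟨fun x => (hA.1 x).inv (h0 x), hA.2.inv₀ fun p => h0 _ _⟩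
  | succ k ih =>
    have h1 := fun x => (hA.1 x).differentiable (by simp)
    refine JointSmooth.succ_iff.2 ⟨?_, ?_⟩
    · have h3 := JointSmooth.zero_iff.1 (JointSmooth.succ_iff.1 hA).1
      exact JointSmooth.zero_iff.2 ⟨fun x => (h3.1 x).inv (h0 x), h3.2.inv₀ fun p => h0 _ _⟩
    · have : (fun x => deriv (fun t => (A x t)⁻¹)) =
          fun x t => deriv (A x) t * ((-1) * ((A x t)⁻¹ * (A x t)⁻¹)) := by
        ext x t
        rw [deriv_fun_inv'' (h1 x t) (h0 x t)]
        field_simp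
      rw [this]
      have hc : JointSmooth k (fun (_ : X) (_ : ℝ) => (-1 : ℝ)) :=
        ⟨fun _ => contDiff_const, fun i _ => by
          simp only [iteratedDeriv_const]; exact continuous_const⟩
      exact (JointSmooth.succ_iff.1 hA).2.mul
        (hc.mul ((ih hA.of_succ h0).mul (ih hA.of_succ h0)))

lemma continuous_iff_jointSmooth {Φ : X → SmoothLift} :
    Continuous Φ ↔ ∀ k, JointSmooth k (fun x => (Φ x : ℝ → ℝ)) :=
  continuous_iff.trans ⟨fun h _ => ⟨fun x => (Φ x).contDiff, fun i _ => h i⟩,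
    fun h k => (h k).2 k le_rfl⟩

end JointSmooth

lemma continuous_inv_eval : Continuous fun p : SmoothLift × ℝ => p.1⁻¹ p.2 := by
  rw [continuous_iff_continuousAt]
  rintro ⟨f, x⟩
  have hc (a : ℝ) : Continuous fun p : SmoothLift × ℝ => p.1 a :=
    continuous_eval.comp (continuous_fst.prodMk continuous_const)
  refine tendsto_order.2 ⟨fun a ha => ?_, fun a ha => ?_⟩
  · have h1 : f a < x := by simpa using f.strictMono ha
    filter_upwards [(hc a).continuousAt.eventually_lt continuous_snd.continuousAt h1] with p hp
    simpa using (p.1⁻¹).strictMono hp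
  · have h1 : x < f a := by simpa using f.strictMono ha
    filter_upwards [continuous_snd.continuousAt.eventually_lt (hc a).continuousAt h1] with p hp
    simpa using (p.1⁻¹).strictMono hp

instance : IsTopologicalGroup SmoothLift where
  continuous_mul := by
    rw [continuous_iff_jointSmooth]
    intro k
    exact (continuous_iff_jointSmooth.1 continuous_fst k).comp
      (continuous_iff_jointSmooth.1 continuous_snd k)
  continuous_inv := by
    rw [continuous_iff_jointSmooth]
    intro k
    induction k with
    | zero => exact JointSmooth.zero_iff.2 ⟨fun f => f⁻¹.contDiff, continuous_inv_eval⟩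
    | succ k ih =>
      refine JointSmooth.succ_iff.2 ⟨JointSmooth.zero_iff.2
        ⟨fun f => f⁻¹.contDiff, continuous_inv_eval⟩, ?_⟩
      have : (fun f : SmoothLift => deriv (f⁻¹ : SmoothLift)) =
          fun (f : SmoothLift) t => (deriv f (f⁻¹ t))⁻¹ := by
        ext f t; exact deriv_inv f t
      rw [this]
      refine JointSmooth.inv ?_ (fun f t => (f.deriv_pos _).ne')
      exact (JointSmooth.succ_iff.1 (continuous_iff_jointSmooth.1 continuous_id (k + 1))).2.comp ih

lemma continuous_tr : Continuous tr := by
  rw [continuous_iff_jointSmooth]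
  intro k
  rcases k with _ | k
  · exact JointSmooth.zero_iff.2 ⟨fun t => (tr t).contDiff, by simp; fun_prop⟩
  · refine JointSmooth.succ_iff.2
      ⟨JointSmooth.zero_iff.2 ⟨fun t => (tr t).contDiff, by simp; fun_prop⟩, ?_⟩
    have : (fun t : ℝ => deriv (tr t)) = fun _ _ => (1 : ℝ) := by
      ext t x
      exact ((hasDerivAt_id x).add_const t).deriv
    rw [this]
    exact ⟨fun _ => contDiff_const, fun i _ => by
          simp only [iteratedDeriv_const]; exact continuous_const⟩

end SmoothLift

/-! ### Periodic perturbations, iterates and the centralizer -/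

lemma periodic_iteratedDeriv {ψ : ℝ → ℝ} (hψ : Function.Periodic ψ 1) (k : ℕ) :
    Function.Periodic (iteratedDeriv k ψ) 1 := by
  intro x
  have h := congrFun (iteratedDeriv_comp_add_const k ψ 1) x
  have h2 : (fun z => ψ (z + 1)) = ψ := funext hψ
  rw [h2] at h
  exact h.symm

lemma eventually_forall_lt_of_periodic {X : Type*} [TopologicalSpace X] {φ : X → ℝ → ℝ}
    (hc : Continuous fun p : X × ℝ => φ p.1 p.2) (hp : ∀ x, Function.Periodic (φ x) 1)
    {c : ℝ} {x₀ : X} (h : ∀ t, φ x₀ t < c) : ∀ᶠ x in 𝓝 x₀, ∀ t, φ x t < c := by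
  have h1 : ∀ᶠ x in 𝓝 x₀, ∀ t ∈ Set.Icc (0 : ℝ) 1, φ x t < c :=
    isCompact_Icc.eventually_forall_of_forall_eventually fun t _ =>
      hc.continuousAt.eventually_lt continuousAt_const (h t)
  filter_upwards [h1] with x hx t
  have h2 : φ x (Int.fract t) = φ x t := by
    have := (hp x).sub_int_mul_eq ⌊t⌋ (x := t)
    rwa [mul_one] at this
  rw [← h2]
  exact hx _ ⟨Int.fract_nonneg t, (Int.fract_lt_one t).le⟩

lemma exists_forall_abs_le_of_periodic {φ : ℝ → ℝ} (hc : Continuous φ)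
    (hp : Function.Periodic φ 1) : ∃ C, 0 < C ∧ ∀ t, |φ t| ≤ C := by
  obtain ⟨C, hC⟩ := isCompact_Icc.exists_bound_of_continuousOn (s := Set.Icc (0 : ℝ) 1)
    hc.continuousOn
  refine ⟨max C 1, by positivity, fun t => ?_⟩
  have h2 : φ (Int.fract t) = φ t := by
    have := hp.sub_int_mul_eq ⌊t⌋ (x := t)
    rwa [mul_one] at this
  rw [← h2]
  exact (hC _ ⟨Int.fract_nonneg t, (Int.fract_lt_one t).le⟩).trans (le_max_left _ _)

namespace SmoothLift

lemma periodic_sub (f g : SmoothLift) : Function.Periodic (fun x => f x - g x) 1 := by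
  intro x
  simp only [map_add_one]
  ring

lemma periodic_sub_id (f : SmoothLift) : Function.Periodic (fun x => f x - x) 1 := by
  intro x
  simp only [map_add_one]
  ring

lemma periodic_deriv (f : SmoothLift) : Function.Periodic (deriv f) 1 := by
  intro x
  have h : deriv (fun x => f (x + 1)) x = deriv (fun x => f x + 1) x := by
    simp only [map_add_one]
  rwa [deriv_comp_add_const, deriv_add_const] at h

lemma periodic_iteratedDeriv_succ (f : SmoothLift) (k : ℕ) :
    Function.Periodic (iteratedDeriv (k + 1) f) 1 := by
  rw [iteratedDeriv_succ']
  exact periodic_iteratedDeriv f.periodic_deriv k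

lemma periodic_iteratedDeriv_sub (f g : SmoothLift) (k : ℕ) :
    Function.Periodic (fun x => iteratedDeriv k f x - iteratedDeriv k g x) 1 := by
  rcases k with _ | k
  · simpa using periodic_sub f g
  · intro x
    simp only [f.periodic_iteratedDeriv_succ k x, g.periodic_iteratedDeriv_succ k x]

lemma eventually_abs_iteratedDeriv_sub_lt (f : SmoothLift) (k : ℕ) {ε : ℝ} (hε : 0 < ε) :
    ∀ᶠ g : SmoothLift in 𝓝 f, ∀ x, |iteratedDeriv k g x - iteratedDeriv k f x| < ε := by
  refine eventually_forall_lt_of_periodic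
    (φ := fun (g : SmoothLift) x => |iteratedDeriv k g x - iteratedDeriv k f x|) ?_ ?_ ?_
  · refine Continuous.abs ((continuous_iteratedDeriv k).sub ?_)
    exact (continuous_iteratedDeriv k).comp (continuous_const.prodMk continuous_snd)
  · exact fun g => (periodic_iteratedDeriv_sub g f k).comp abs
  · simpa using hε

lemma exists_deriv_lower_bound (f : SmoothLift) : ∃ m, 0 < m ∧ ∀ x, m < deriv f x := by
  have hc : Continuous (deriv f) := by
    simpa using (contDiff_iteratedDeriv f.contDiff 1).continuous
  have hc2 : Continuous fun x => (deriv f x)⁻¹ := hc.inv₀ fun x => (f.deriv_pos x).ne'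
  obtain ⟨C, hC, h⟩ := exists_forall_abs_le_of_periodic hc2 (f.periodic_deriv.comp _)
  refine ⟨(2 * C)⁻¹, by positivity, fun x => ?_⟩
  have := (le_abs_self _).trans (h x)
  have h3 := f.deriv_pos x
  rw [inv_lt_comm₀ (by positivity) h3]
  linarith

lemma exists_deriv_upper_bound (f : SmoothLift) : ∃ M, 0 < M ∧ ∀ x, deriv f x < M := by
  have hc : Continuous (deriv f) := by
    simpa using (contDiff_iteratedDeriv f.contDiff 1).continuous
  obtain ⟨C, hC, h⟩ := exists_forall_abs_le_of_periodic hc f.periodic_deriv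
  exact ⟨C + 1, by positivity, fun x => by linarith [(le_abs_self _).trans (h x)]⟩

/-- The lift `f + ψ` for a periodic perturbation `ψ` with small derivative. -/
def addPeriodic (f : SmoothLift) (ψ : ℝ → ℝ) (h1 : ContDiff ℝ (⊤ : ℕ∞) ψ)
    (h2 : Function.Periodic ψ 1) (h3 : ∀ x, 0 < deriv f x + deriv ψ x) : SmoothLift :=
  ⟨fun x => f x + ψ x, f.contDiff.add h1, fun x => by
    rw [deriv_fun_add f.differentiable.differentiableAt (h1.differentiable (by simp) x)]
    exact h3 x, fun x => by simp only [map_add_one, h2 x]; ring⟩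

lemma exists_perturbation_bound (f : SmoothLift) {V : Set SmoothLift} (hV : V ∈ 𝓝 f) :
    ∃ (r : ℕ) (δ : ℝ), 0 < δ ∧ ∀ ψ : ℝ → ℝ, ContDiff ℝ (⊤ : ℕ∞) ψ → Function.Periodic ψ 1 →
      (∀ k ≤ r, ∀ x, |iteratedDeriv k ψ x| ≤ δ) → ∃ g ∈ V, ∀ x, g x = f x + ψ x := by
  by_contra! hcon
  obtain ⟨m, hm, hfm⟩ := f.exists_deriv_lower_bound
  choose ψ h1 h2 h3 h4 using fun n : ℕ =>
    hcon (n + 1) (min m (1 / ((n : ℝ) + 1))) (lt_min hm (by positivity))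
  have h5 (n : ℕ) (x : ℝ) : 0 < deriv f x + deriv (ψ n) x := by
    have := h3 n 1 (by omega) x
    rw [iteratedDeriv_one] at this
    linarith [hfm x, neg_abs_le (deriv (ψ n) x), min_le_left m (1 / ((n : ℝ) + 1))]
  have h6 : Tendsto (fun n => f.addPeriodic (ψ n) (h1 n) (h2 n) (h5 n)) atTop (𝓝 f) := by
    rw [tendsto_iff]
    intro k
    rw [Metric.tendstoLocallyUniformly_iff]
    intro ε hε x
    refine ⟨Set.univ, univ_mem, ?_⟩
    obtain ⟨N, hN⟩ := exists_nat_one_div_lt hε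
    filter_upwards [eventually_ge_atTop (max N k)] with n hn y _
    have e1 : iteratedDeriv k (f.addPeriodic (ψ n) (h1 n) (h2 n) (h5 n)) y =
        iteratedDeriv k f y + iteratedDeriv k (ψ n) y :=
      iteratedDeriv_fun_add ((f.contDiff_nat k).contDiffAt)
        (((h1 n).of_le (by exact_mod_cast le_top)).contDiffAt)
    rw [e1, Real.dist_eq, show iteratedDeriv k f y - (iteratedDeriv k f y +
      iteratedDeriv k (ψ n) y) = -iteratedDeriv k (ψ n) y by ring, abs_neg]
    refine (h3 n k (by have := le_max_right N k; omega) y).trans_lt ?_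
    refine (min_le_right _ _).trans_lt (lt_of_le_of_lt ?_ hN)
    have : (N : ℝ) ≤ n := by exact_mod_cast (le_max_left N k).trans hn
    gcongr
  obtain ⟨n, hn⟩ := (h6.eventually hV).exists
  obtain ⟨x, hx⟩ := h4 n _ hn
  exact hx rfl

/-! #### The lattice generated by a lift and the unit translation -/

/-- The lift `fⁱ + j`. -/
noncomputable def lat (f : SmoothLift) (i j : ℤ) : SmoothLift := f ^ i * tr j

lemma lat_zero_zero (f : SmoothLift) : f.lat 0 0 = 1 := by simp [lat, tr_zero]

lemma lat_one_zero (f : SmoothLift) : f.lat 1 0 = f := by simp [lat, tr_zero]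

lemma lat_zero_left (f : SmoothLift) (j : ℤ) : f.lat 0 j = tr j := by simp [lat]

lemma lat_add (f : SmoothLift) (i j i' j' : ℤ) :
    f.lat (i + i') (j + j') = f.lat i j * f.lat i' j' := by
  simp only [lat]
  have h := commute_tr_int (f ^ i') j
  push_cast
  rw [tr_add, zpow_add, mul_assoc, mul_assoc, ← mul_assoc (tr j), ← h.eq, mul_assoc]

lemma lat_inv (f : SmoothLift) (i j : ℤ) : (f.lat i j)⁻¹ = f.lat (-i) (-j) := by
  rw [inv_eq_iff_mul_eq_one, ← lat_add, add_neg_cancel, add_neg_cancel, lat_zero_zero]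

lemma lat_zpow (f : SmoothLift) (i j n : ℤ) : (f.lat i j) ^ n = f.lat (n * i) (n * j) := by
  induction n with
  | zero => simp [lat_zero_zero]
  | succ n ih => rw [zpow_add_one, ih, ← lat_add]; congr 1 <;> ring
  | pred n ih => rw [zpow_sub_one, ih, lat_inv, ← lat_add]; congr 1 <;> ring

lemma lat_commute (f : SmoothLift) (i j i' j' : ℤ) : Commute (f.lat i j) (f.lat i' j') := by
  rw [commute_iff_eq, ← lat_add, ← lat_add, add_comm i, add_comm j]

lemma lat_commute_self (f : SmoothLift) (i j : ℤ) : Commute (f.lat i j) f := by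
  have := f.lat_commute i j 1 0
  rwa [lat_one_zero] at this

lemma lat_nat_apply (f : SmoothLift) (n : ℕ) (j : ℤ) (x : ℝ) : f.lat n j x = f^[n] x + j := by
  rw [lat, (commute_tr_int (f ^ (n : ℤ)) j).eq, mul_apply, zpow_natCast, coe_pow, tr_apply]

lemma continuous_lat (i j : ℤ) : Continuous fun f : SmoothLift => f.lat i j :=
  (continuous_zpow i).mul continuous_const

lemma isIterateLift_iff {f g : SmoothLift} : IsIterateLift f g ↔ ∃ i j : ℤ, g = f.lat i j := by
  constructor
  · rintro ⟨n, k, h | h⟩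
    · exact ⟨n, k, ext fun x => by rw [h, lat_nat_apply]⟩
    · refine ⟨-n, k, ext fun x => (f ^ (n : ℤ)).injective ?_⟩
      have := h x
      rw [zpow_natCast, coe_pow, this]
      simp [lat, ← pow_apply]
  · rintro ⟨i, j, rfl⟩
    obtain ⟨n, rfl | rfl⟩ := i.eq_nat_or_neg
    · exact ⟨n, j, Or.inl fun x => by rw [lat_nat_apply]⟩
    · refine ⟨n, j, Or.inr fun x => ?_⟩
      simp [lat, ← pow_apply]

/-- A lift as a monotone degree one map. -/
def toDeg1 (f : SmoothLift) : CircleDeg1Lift where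
  toFun := f
  monotone' := f.monotone
  map_add_one' := f.map_add_one

lemma mem_centralizerLifts_iff {f g : SmoothLift} :
    g ∈ CentralizerLifts f ↔ Commute g f := by
  constructor
  · rintro ⟨k, hk⟩
    have h1 : SemiconjBy g.toDeg1 f.toDeg1
        ((CircleDeg1Lift.translate (Multiplicative.ofAdd (k : ℝ)) : CircleDeg1Liftˣ) *
          f.toDeg1) := by
      ext x
      change g (f x) = (k : ℝ) + f (g x)
      rw [add_comm]
      exact hk x
    have h2 := CircleDeg1Lift.translationNumber_eq_of_semiconjBy h1
    rw [CircleDeg1Lift.translationNumber_mul_of_commute,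
      CircleDeg1Lift.translationNumber_translate] at h2
    · have h3 : (k : ℝ) = 0 := by linarith
      ext x
      have := hk x
      rw [h3, add_zero] at this
      exact this
    · ext x
      change (k : ℝ) + f x = f (k + x)
      rw [add_comm _ x, f.map_add_int, add_comm]
  · intro h
    refine ⟨0, fun x => ?_⟩
    rw [Int.cast_zero, add_zero]
    exact DFunLike.congr_fun h.eq x

end SmoothLift

/-! ### Compactness of families of commuting lifts -/

/-- Functions with a given Lipschitz constant and linear growth. -/
def lipBall (N : ℝ) : Set C(ℝ, ℝ) :=
  {φ | (∀ x, |φ x| ≤ N * (1 + |x|)) ∧ ∀ x y, |φ x - φ y| ≤ N * |x - y|}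

lemma isCompact_lipBall (N : ℝ) (hN : 0 < N) : IsCompact (lipBall N) := by
  apply ArzelaAscoli.isCompact_of_equicontinuous
  · have hS : ContinuousMap.toFun '' lipBall N =
        Set.pi Set.univ (fun x => Set.Icc (-(N * (1 + |x|))) (N * (1 + |x|))) ∩
          {φ : ℝ → ℝ | ∀ x y, |φ x - φ y| ≤ N * |x - y|} := by
      ext φ
      constructor
      · rintro ⟨φ, ⟨h1, h2⟩, rfl⟩
        exact ⟨fun x _ => abs_le.1 (h1 x), h2⟩
      · rintro ⟨h1, h2⟩
        have hL : LipschitzWith N.toNNReal φ := LipschitzWith.of_dist_le_mul fun x y => by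
          rw [Real.coe_toNNReal N hN.le]
          exact h2 x y
        exact ⟨⟨φ, hL.continuous⟩, ⟨fun x => abs_le.2 (h1 x trivial), h2⟩, rfl⟩
    rw [hS]
    refine (isCompact_univ_pi fun x => isCompact_Icc).inter_right ?_
    simp only [Set.ofPred_forall]
    exact isClosed_iInter fun x => isClosed_iInter fun y =>
      isClosed_le (by fun_prop) continuous_const
  · refine (Metric.uniformEquicontinuous_iff.2 fun ε hε => ⟨ε / N, by positivity,
      fun x y hxy i => ?_⟩).equicontinuous
    refine (i.2.2 x y).trans_lt ?_
    rw [Real.dist_eq] at hxy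
    calc N * |x - y| < N * (ε / N) := by gcongr
      _ = ε := by field_simp

namespace SmoothLift

/-- The `C¹`-centralizer of `f` on the line consists of iterates and integer translations. -/
def TrivC1 (f : SmoothLift) : Prop :=
  ∀ g : ℝ → ℝ, ContDiff ℝ 1 g → (∀ x, 0 < deriv g x) → (∀ x, g (x + 1) = g x + 1) →
    (∀ x, g (f x) = f (g x)) → ∃ i j : ℤ, ∀ x, g x = f.lat i j x

/-- Bounds on the derivatives of `g` up to order `r + 1`. -/
def Bounded (r : ℕ) (N : ℝ) (g : SmoothLift) : Prop :=
  (∀ k, 1 ≤ k → k ≤ r + 1 → ∀ x, |iteratedDeriv k g x| ≤ N) ∧ (∀ x, N⁻¹ ≤ deriv g x) ∧ |g 0| ≤ N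

lemma hasDerivAt_iteratedDeriv (g : SmoothLift) (k : ℕ) (x : ℝ) :
    HasDerivAt (iteratedDeriv k g) (iteratedDeriv (k + 1) g x) x := by
  rw [iteratedDeriv_succ]
  exact ((contDiff_iteratedDeriv g.contDiff k).differentiable (by simp) x).hasDerivAt

lemma abs_iteratedDeriv_sub_le (g : SmoothLift) (k : ℕ) {N : ℝ}
    (h : ∀ x, |iteratedDeriv (k + 1) g x| ≤ N) (x y : ℝ) :
    |iteratedDeriv k g x - iteratedDeriv k g y| ≤ N * |x - y| :=
  convex_univ.norm_image_sub_le_of_norm_hasDerivWithin_le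
    (fun z _ => (hasDerivAt_iteratedDeriv g k z).hasDerivWithinAt) (fun z _ => h z)
    (Set.mem_univ y) (Set.mem_univ x)

lemma Bounded.jet_mem {r : ℕ} {N : ℝ} {g : SmoothLift} (hN : 0 < N) (h : Bounded r N g) {k : ℕ}
    (hk : k ≤ r) : g.jet k ∈ lipBall N := by
  have h2 := abs_iteratedDeriv_sub_le g k (h.1 (k + 1) (by omega) (by omega))
  refine ⟨fun x => ?_, h2⟩
  rcases k with _ | k
  · have h3 := h2 x 0
    simp only [iteratedDeriv_zero, sub_zero] at h3
    have h4 := abs_sub_abs_le_abs_sub (g x) (g 0)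
    simp only [jet_apply, iteratedDeriv_zero]
    linarith [h.2.2]
  · refine (h.1 (k + 1) (by omega) (by omega) x).trans ?_
    nlinarith [abs_nonneg x]

lemma tendsto_jet_of_commute {f₀ : SmoothLift} (hf₀ : TrivC1 f₀) {r : ℕ} (hr : 1 ≤ r) {N : ℝ}
    (hN : 0 < N) (𝒰 : Ultrafilter SmoothLift) (h𝒰 : (𝒰 : Filter SmoothLift) ≤ 𝓝 f₀)
    (G : SmoothLift → SmoothLift) (hG : ∀ᶠ f in (𝒰 : Filter SmoothLift),
      Commute (G f) f ∧ Bounded r N (G f)) :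
    ∃ i j : ℤ, ∀ k ≤ r, Tendsto (fun f => (G f).jet k) 𝒰 (𝓝 ((f₀.lat i j).jet k)) := by
  have h1 : ∀ k, ∃ φ : C(ℝ, ℝ), k ≤ r → Tendsto (fun f => (G f).jet k) 𝒰 (𝓝 φ) := by
    intro k
    by_cases hk : k ≤ r
    · obtain ⟨φ, -, hφ⟩ := (isCompact_lipBall N hN).ultrafilter_le_nhds
        (𝒰.map fun f => (G f).jet k) (by
          rw [le_principal_iff]
          exact hG.mono fun f hf => hf.2.jet_mem hN hk)
      exact ⟨φ, fun _ => hφ⟩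
    · exact ⟨0, fun h => absurd h hk⟩
  choose φ hφ using h1
  have hpt (k : ℕ) (hk : k ≤ r) (x : ℝ) :
      Tendsto (fun f => iteratedDeriv k (G f) x) 𝒰 (𝓝 (φ k x)) :=
    ((ContinuousEvalConst.continuous_eval_const x).tendsto (φ k)).comp (hφ k hk)
  have hd (k : ℕ) (hk : k + 1 ≤ r) (x : ℝ) : HasDerivAt (φ k) (φ (k + 1) x) x := by
    refine hasDerivAt_of_tendstoLocallyUniformlyOn isOpen_univ
      (f' := fun f => iteratedDeriv (k + 1) (G f)) (f := fun f => iteratedDeriv k (G f))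
      (l := (𝒰 : Filter SmoothLift)) ?_ ?_ ?_ (Set.mem_univ x)
    · rw [tendstoLocallyUniformlyOn_univ]
      exact ContinuousMap.tendsto_iff_tendstoLocallyUniformly.1 (hφ (k + 1) hk)
    · exact Eventually.of_forall fun f x _ => hasDerivAt_iteratedDeriv (G f) k x
    · exact fun x _ => hpt k (by omega) x
  have hd0 : deriv (φ 0) = φ 1 := funext fun x => (hd 0 hr x).deriv
  obtain ⟨i, j, hij⟩ := hf₀ (φ 0)
    (contDiff_one_iff_deriv.2 ⟨fun x => (hd 0 hr x).differentiableAt, by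
      rw [hd0]; exact (φ 1).continuous⟩)
    (fun x => by
      rw [hd0]
      refine lt_of_lt_of_le (inv_pos.2 hN) (ge_of_tendsto (hpt 1 hr x) ?_)
      filter_upwards [hG] with f hf
      rw [iteratedDeriv_one]
      exact hf.2.2.1 x)
    (fun x => by
      refine tendsto_nhds_unique (hpt 0 (by omega) (x + 1)) ?_
      simp only [iteratedDeriv_zero, map_add_one]
      simpa using (hpt 0 (by omega) x).add_const 1)
    (fun x => by
      have hev : Tendsto (fun f : SmoothLift => f x) 𝒰 (𝓝 (f₀ x)) := by
        have := (continuous_eval.comp (Continuous.prodMk_left x)).tendsto f₀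
        exact this.mono_left h𝒰
      have t1 : Tendsto (fun f : SmoothLift => G f (f x)) 𝒰 (𝓝 (φ 0 (f₀ x))) := by
        have := (ContinuousEval.continuous_eval (F := C(ℝ, ℝ)) (X := ℝ) (Y := ℝ)).tendsto
          (φ 0, f₀ x)
        have := this.comp ((hφ 0 (by omega)).prodMk_nhds hev)
        simpa [Function.comp_def] using this
      have t2 : Tendsto (fun f : SmoothLift => f (G f x)) 𝒰 (𝓝 (f₀ (φ 0 x))) := by
        have h3 : Tendsto (fun f : SmoothLift => f) 𝒰 (𝓝 f₀) := h𝒰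
        have h4 := hpt 0 (by omega) x
        simp only [iteratedDeriv_zero] at h4
        exact (continuous_eval.tendsto (f₀, φ 0 x)).comp (h3.prodMk_nhds h4)
      refine tendsto_nhds_unique t1 (t2.congr' ?_)
      filter_upwards [hG] with f hf
      exact (DFunLike.congr_fun hf.1.eq x).symm)
  refine ⟨i, j, fun k hk => ?_⟩
  have h3 : ∀ k ≤ r, iteratedDeriv k (f₀.lat i j) = φ k := by
    intro k
    induction k with
    | zero => intro _; rw [iteratedDeriv_zero]; exact funext fun x => (hij x).symm
    | succ k ih =>
      intro hk
      rw [iteratedDeriv_succ, ih (by omega)]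
      exact funext fun x => (hd k hk x).deriv
  have h4 : (f₀.lat i j).jet k = φ k := ContinuousMap.ext fun x => congrFun (h3 k hk) x
  rw [h4]
  exact hφ k hk

lemma eventually_abs_sub_lt_of_tendsto_jet {ι : Type*} {l : Filter ι} {G : ι → SmoothLift}
    {v : SmoothLift} {k : ℕ} (h : Tendsto (fun i => (G i).jet k) l (𝓝 (v.jet k))) {ε : ℝ}
    (hε : 0 < ε) : ∀ᶠ i in l, ∀ x, |iteratedDeriv k (G i) x - iteratedDeriv k v x| < ε := by
  rw [ContinuousMap.tendsto_iff_forall_isCompact_tendstoUniformlyOn] at h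
  have h1 := Metric.tendstoUniformlyOn_iff.1 (h (Set.Icc 0 1) isCompact_Icc) ε hε
  filter_upwards [h1] with i hi x
  have h2 := (periodic_iteratedDeriv_sub (G i) v k).sub_int_mul_eq ⌊x⌋ (x := x)
  rw [mul_one] at h2
  rw [← h2]
  have := hi (Int.fract x) ⟨Int.fract_nonneg x, (Int.fract_lt_one x).le⟩
  rw [dist_comm] at this
  exact this

/-- Lifts `f` such that near `f` every commuting lift with bounded derivatives is `ε`-close to
an iterate. -/
def nearIterates (r : ℕ) (N ε : ℝ) : Set SmoothLift :=
  interior {f | ∀ g : SmoothLift, Commute g f → Bounded r N g →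
    ∃ i j : ℤ, ∀ k ≤ r, ∀ x, |iteratedDeriv k g x - iteratedDeriv k (f.lat i j) x| < ε}

lemma TrivC1.mem_nearIterates {f₀ : SmoothLift} (hf₀ : TrivC1 f₀) {r : ℕ} (hr : 1 ≤ r) {N ε : ℝ}
    (hN : 0 < N) (hε : 0 < ε) : f₀ ∈ nearIterates r N ε := by
  rw [nearIterates, mem_interior_iff_mem_nhds]
  by_contra hcon
  change ¬ (∀ᶠ f in 𝓝 f₀, _) at hcon
  rw [not_eventually, frequently_iff_neBot] at hcon
  set 𝒰 := Ultrafilter.of (𝓝 f₀ ⊓ 𝓟 {f | ¬ ∀ g : SmoothLift, Commute g f → Bounded r N g →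
    ∃ i j : ℤ, ∀ k ≤ r, ∀ x, |iteratedDeriv k g x - iteratedDeriv k (f.lat i j) x| < ε})
  have h𝒰 := Ultrafilter.of_le (𝓝 f₀ ⊓ 𝓟 {f | ¬ ∀ g : SmoothLift, Commute g f → Bounded r N g →
    ∃ i j : ℤ, ∀ k ≤ r, ∀ x, |iteratedDeriv k g x - iteratedDeriv k (f.lat i j) x| < ε})
  have h1 : (𝒰 : Filter SmoothLift) ≤ 𝓝 f₀ := h𝒰.trans inf_le_left
  have h2 := le_principal_iff.1 (h𝒰.trans inf_le_right)
  have h3 : ∀ f : SmoothLift, ∃ g : SmoothLift, (¬ ∀ g : SmoothLift, Commute g f → Bounded r N g →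
      ∃ i j : ℤ, ∀ k ≤ r, ∀ x, |iteratedDeriv k g x - iteratedDeriv k (f.lat i j) x| < ε) →
      Commute g f ∧ Bounded r N g ∧ ∀ i j : ℤ, ∃ k ≤ r, ∃ x,
        ε ≤ |iteratedDeriv k g x - iteratedDeriv k (f.lat i j) x| := by
    intro f
    by_cases h : ∀ g : SmoothLift, Commute g f → Bounded r N g →
      ∃ i j : ℤ, ∀ k ≤ r, ∀ x, |iteratedDeriv k g x - iteratedDeriv k (f.lat i j) x| < ε
    · exact ⟨1, fun h' => absurd h h'⟩
    · push Not at h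
      obtain ⟨g, hg⟩ := h
      exact ⟨g, fun _ => hg⟩
  choose G hG using h3
  obtain ⟨i, j, hij⟩ := tendsto_jet_of_commute hf₀ hr hN 𝒰 h1 G
    (eventually_of_mem h2 fun f hf => ⟨(hG f hf).1, (hG f hf).2.1⟩)
  have h4 : ∀ᶠ f in (𝒰 : Filter SmoothLift), ∀ k ∈ Finset.range (r + 1), ∀ x,
      |iteratedDeriv k (G f) x - iteratedDeriv k (f₀.lat i j) x| < ε / 2 := by
    rw [Filter.eventually_all_finset]
    intro k hk
    exact eventually_abs_sub_lt_of_tendsto_jet (hij k (by simp at hk; omega)) (by positivity)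
  have h5 : ∀ᶠ f : SmoothLift in (𝒰 : Filter SmoothLift), ∀ k ∈ Finset.range (r + 1), ∀ x,
      |iteratedDeriv k (f.lat i j) x - iteratedDeriv k (f₀.lat i j) x| < ε / 2 := by
    rw [Filter.eventually_all_finset]
    intro k hk
    exact h1 ((continuous_lat i j).continuousAt.eventually
      (eventually_abs_iteratedDeriv_sub_lt (f₀.lat i j) k (by positivity)))
  obtain ⟨f, hf2, hf4, hf5⟩ := ((eventually_of_mem h2 fun f hf => hf).and (h4.and h5)).exists
  obtain ⟨k, hk, x, hx⟩ := (hG f hf2).2.2 i j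
  have e1 := hf4 k (by simp; omega) x
  have e2 := hf5 k (by simp; omega) x
  rw [abs_sub_comm] at e2
  have := abs_sub_le (iteratedDeriv k (G f) x) (iteratedDeriv k (f₀.lat i j) x)
    (iteratedDeriv k (f.lat i j) x)
  linarith

/-- No nontrivial iterate of `f` is both close to an integer translation and nearly affine. -/
def Rigid (η ε₀ : ℝ) (f : SmoothLift) : Prop :=
  ∀ i j : ℤ, i ≠ 0 → ¬ ((∀ x, |iteratedDeriv 2 (f.lat i j) x| ≤ η) ∧
    ∀ x, |f.lat i j x - x| ≤ ε₀)

lemma exists_deriv_eq_one (g : SmoothLift) : ∃ ξ ∈ Set.Ioo (0 : ℝ) 1, deriv g ξ = 1 := by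
  obtain ⟨ξ, hξ, h⟩ := exists_deriv_eq_slope g zero_lt_one g.continuous.continuousOn
    g.differentiable.differentiableOn
  refine ⟨ξ, hξ, ?_⟩
  have := g.map_add_one 0
  rw [h, ← zero_add (1 : ℝ), this]
  simp

lemma abs_deriv_sub_one_le (g : SmoothLift) {η : ℝ} (hη : ∀ x, |iteratedDeriv 2 g x| ≤ η)
    (x : ℝ) : |deriv g x - 1| ≤ η := by
  obtain ⟨ξ, hξ, h⟩ := g.exists_deriv_eq_one
  have hη0 : 0 ≤ η := (abs_nonneg _).trans (hη 0)
  have h2 := g.periodic_deriv.sub_int_mul_eq ⌊x⌋ (x := x)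
  rw [mul_one] at h2
  have h3 := abs_iteratedDeriv_sub_le g 1 hη (Int.fract x) ξ
  simp only [iteratedDeriv_one, h] at h3
  rw [← h2]
  refine h3.trans ?_
  have h4 := Int.fract_nonneg x
  have h5 := (Int.fract_lt_one x).le
  have : |Int.fract x - ξ| ≤ 1 := abs_le.2 ⟨by linarith [hξ.2], by linarith [hξ.1]⟩
  nlinarith

lemma TrivC1.eventually_close {f₀ : SmoothLift} (hf₀ : TrivC1 f₀) {η ε₀ : ℝ} (hη : η ≤ 1 / 2)
    (hε₀ : ε₀ < 1) (hR : Rigid η ε₀ f₀) {ε : ℝ} (hε : 0 < ε) :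
    ∀ᶠ f in 𝓝 f₀, ∀ g : SmoothLift, Commute g f → (∀ x, |iteratedDeriv 2 g x| ≤ η) →
      (∀ x, |g x - x| ≤ ε₀) → ∀ x, |g x - x| < ε := by
  by_contra hcon
  rw [not_eventually, frequently_iff_neBot] at hcon
  obtain ⟨𝒰, h𝒰⟩ := Ultrafilter.exists_le (𝓝 f₀ ⊓ 𝓟 {f | ¬ ∀ g : SmoothLift, Commute g f →
    (∀ x, |iteratedDeriv 2 g x| ≤ η) → (∀ x, |g x - x| ≤ ε₀) → ∀ x, |g x - x| < ε})
  have h1 : (𝒰 : Filter SmoothLift) ≤ 𝓝 f₀ := h𝒰.trans inf_le_left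
  have h2 := le_principal_iff.1 (h𝒰.trans inf_le_right)
  have h3 : ∀ f : SmoothLift, ∃ g : SmoothLift, (¬ ∀ g : SmoothLift, Commute g f →
      (∀ x, |iteratedDeriv 2 g x| ≤ η) → (∀ x, |g x - x| ≤ ε₀) → ∀ x, |g x - x| < ε) →
      Commute g f ∧ (∀ x, |iteratedDeriv 2 g x| ≤ η) ∧ (∀ x, |g x - x| ≤ ε₀) ∧
        ∃ x, ε ≤ |g x - x| := by
    intro f
    by_cases h : ∀ g : SmoothLift, Commute g f →
      (∀ x, |iteratedDeriv 2 g x| ≤ η) → (∀ x, |g x - x| ≤ ε₀) → ∀ x, |g x - x| < ε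
    · exact ⟨1, fun h' => absurd h h'⟩
    · push Not at h
      obtain ⟨g, hg⟩ := h
      exact ⟨g, fun _ => hg⟩
  choose G hG using h3
  have hb : ∀ᶠ f in (𝒰 : Filter SmoothLift), Commute (G f) f ∧ Bounded 1 2 (G f) := by
    refine eventually_of_mem h2 fun f hf => ⟨(hG f hf).1, fun k hk hk' x => ?_, fun x => ?_, ?_⟩
    · obtain rfl | rfl : k = 1 ∨ k = 2 := by omega
      · have := abs_le.1 (abs_deriv_sub_one_le (G f) (hG f hf).2.1 x)
        rw [iteratedDeriv_one]
        exact abs_le.2 ⟨by linarith, by linarith⟩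
      · linarith [(hG f hf).2.1 x]
    · have := abs_le.1 (abs_deriv_sub_one_le (G f) (hG f hf).2.1 x)
      norm_num at *
      linarith
    · have := (hG f hf).2.2.1 0
      rw [sub_zero] at this
      linarith
  obtain ⟨i, j, hij⟩ := tendsto_jet_of_commute hf₀ le_rfl zero_lt_two 𝒰 h1 G hb
  have hpt (k : ℕ) (hk : k ≤ 1) (x : ℝ) :
      Tendsto (fun f => iteratedDeriv k (G f) x) 𝒰 (𝓝 (iteratedDeriv k (f₀.lat i j) x)) :=
    ((ContinuousEvalConst.continuous_eval_const x).tendsto _).comp (hij k hk)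
  have hlip (x y : ℝ) : |deriv (f₀.lat i j) x - deriv (f₀.lat i j) y| ≤ η * |x - y| := by
    have := ((hpt 1 le_rfl x).sub (hpt 1 le_rfl y)).abs
    rw [iteratedDeriv_one] at this
    refine le_of_tendsto this (eventually_of_mem h2 fun f hf => ?_)
    exact abs_iteratedDeriv_sub_le (G f) 1 (hG f hf).2.1 x y
  have hη0 : 0 ≤ η := by
    have := hlip 0 1
    norm_num at this
    exact (abs_nonneg _).trans this
  have hD2 (x : ℝ) : |iteratedDeriv 2 (f₀.lat i j) x| ≤ η := by
    have h4 := hasDerivAt_iteratedDeriv (f₀.lat i j) 1 x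
    rw [iteratedDeriv_one] at h4
    exact h4.le_of_lip' hη0 (Eventually.of_forall fun y => hlip y x)
  have hcl (x : ℝ) : |f₀.lat i j x - x| ≤ ε₀ := by
    have := ((hpt 0 zero_le_one x).sub_const x).abs
    rw [iteratedDeriv_zero] at this
    refine le_of_tendsto this (eventually_of_mem h2 fun f hf => ?_)
    simpa using (hG f hf).2.2.1 x
  have hi : i = 0 := by
    by_contra hi
    exact hR i j hi ⟨hD2, hcl⟩
  subst hi
  have hj : j = 0 := by
    have := hcl 0
    rw [lat_zero_left] at this
    simp only [tr_apply, zero_add, sub_zero] at this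
    have h5 : |(j : ℝ)| < 1 := by linarith
    exact Int.abs_lt_one_iff.1 (by exact_mod_cast h5)
  subst hj
  rw [lat_zero_zero] at hij
  have h6 := eventually_abs_sub_lt_of_tendsto_jet (hij 0 zero_le_one) hε
  obtain ⟨f, hf2, hf6⟩ := ((eventually_of_mem h2 fun f hf => hf).and h6).exists
  obtain ⟨x, hx⟩ := (hG f hf2).2.2.2
  have := hf6 x
  simp only [iteratedDeriv_zero, one_apply] at this
  linarith

end SmoothLift

/-! ### Genericity -/

namespace SmoothLift

lemma isClosed_image_jet {K : Set SmoothLift} (hK : IsClosed K) {m : ℝ} (hm : 0 < m)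
    (h : ∀ f ∈ K, ∀ x, m ≤ deriv f x) : IsClosed (jet '' K) := by
  refine isClosed_of_closure_subset fun φ hφ => ?_
  have hne : (𝓝[jet '' K] φ).NeBot := mem_closure_iff_nhdsWithin_neBot.1 hφ
  have hl : ∀ᶠ u in 𝓝[jet '' K] φ, ∃ f ∈ K, jet f = u := eventually_mem_nhdsWithin
  have ht (k : ℕ) : Tendsto (fun u : ℕ → C(ℝ, ℝ) => u k) (𝓝[jet '' K] φ) (𝓝 (φ k)) :=
    ((continuous_apply k).tendsto φ).mono_left nhdsWithin_le_nhds
  have hpt (k : ℕ) (x : ℝ) :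
      Tendsto (fun u : ℕ → C(ℝ, ℝ) => u k x) (𝓝[jet '' K] φ) (𝓝 (φ k x)) :=
    ((ContinuousEvalConst.continuous_eval_const x).tendsto (φ k)).comp (ht k)
  have hd (k : ℕ) (x : ℝ) : HasDerivAt (φ k) (φ (k + 1) x) x := by
    refine hasDerivAt_of_tendstoLocallyUniformlyOn isOpen_univ
      (f' := fun (u : ℕ → C(ℝ, ℝ)) => u (k + 1)) (f := fun (u : ℕ → C(ℝ, ℝ)) => u k)
      (l := 𝓝[jet '' K] φ) ?_ ?_ ?_ (Set.mem_univ x)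
    · rw [tendstoLocallyUniformlyOn_univ]
      exact ContinuousMap.tendsto_iff_tendstoLocallyUniformly.1 (ht (k + 1))
    · filter_upwards [hl]
      rintro u ⟨f, -, rfl⟩ x -
      exact hasDerivAt_iteratedDeriv f k x
    · exact fun x _ => hpt k x
  have hit (k : ℕ) : iteratedDeriv k (φ 0) = φ k := by
    induction k with
    | zero => simp
    | succ k ih => rw [iteratedDeriv_succ, ih]; exact funext fun x => (hd k x).deriv
  have hd0 : deriv (φ 0) = φ 1 := funext fun x => (hd 0 x).deriv
  let g : SmoothLift := ⟨φ 0, contDiff_of_differentiable_iteratedDeriv fun k _ x => by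
      rw [hit]; exact (hd k x).differentiableAt, fun x => by
      rw [hd0]
      refine lt_of_lt_of_le hm (ge_of_tendsto (hpt 1 x) ?_)
      filter_upwards [hl]
      rintro u ⟨f, hf, rfl⟩
      rw [jet_apply, iteratedDeriv_one]
      exact h f hf x, fun x => by
      refine tendsto_nhds_unique (hpt 0 (x + 1)) (((hpt 0 x).add_const 1).congr' ?_)
      filter_upwards [hl]
      rintro u ⟨f, hf, rfl⟩
      simp [map_add_one]⟩
  have hg : jet g = φ := funext fun k => ContinuousMap.ext fun x => congrFun (hit k) x
  refine ⟨g, ?_, hg⟩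
  rw [← hK.closure_eq, isInducing_jet.closure_eq_preimage_closure_image, Set.mem_preimage, hg]
  exact hφ

lemma baireSpace_of_isClosed {K : Set SmoothLift} (hK : IsClosed K) {m : ℝ} (hm : 0 < m)
    (h : ∀ f ∈ K, ∀ x, m ≤ deriv f x) : BaireSpace K := by
  have hinj : Function.Injective jet := fun f g h => ext fun x => by
    simpa using congrArg (fun u => u 0 x) h
  have hemb : IsClosedEmbedding fun f : K => jet f := by
    refine ⟨⟨isInducing_jet.comp IsInducing.subtypeVal, hinj.comp Subtype.val_injective⟩, ?_⟩
    have : Set.range (fun f : K => jet f) = jet '' K := by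
      ext u; simp
    rw [this]
    exact isClosed_image_jet hK hm h
  have := hemb.IsCompletelyMetrizableSpace
  infer_instance

/-- The `q`-th iterate of `f`, minus `p`, moves points to the right except for one orbit of fixed
points. -/
structure Parab (f : SmoothLift) (q : ℕ) (p a b : ℤ) (x₀ : ℝ) : Prop where
  q_pos : 0 < q
  bezout : a * p + b * q = 1
  le_apply : ∀ x, x ≤ f.lat q (-p) x
  fix_iff : ∀ x, f.lat q (-p) x = x ↔ ∃ w : ℤ, x = (f.lat a b ^ w) x₀

/-- Parabolic lifts with trivial `C¹`-centralizer and no nearly affine iterates. -/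
def goodParab (η ε₀ : ℝ) : Set SmoothLift :=
  {f | (∃ (q : ℕ) (p a b : ℤ) (x₀ : ℝ), Parab f q p a b x₀) ∧ TrivC1 f ∧ Rigid η ε₀ f}

lemma lat_apply_eq_iff (f : SmoothLift) (q : ℕ) (p : ℤ) (x : ℝ) :
    f.lat q (-p) x = x ↔ (f.toDeg1 ^ q) x = x + p := by
  rw [lat_nat_apply, CircleDeg1Lift.coe_pow]
  change f^[q] x + ((-p : ℤ) : ℝ) = x ↔ f^[q] x = x + p
  push_cast
  constructor <;> intro h <;> linarith

lemma mul_eq_mul_of_periodic {f : SmoothLift} {q q' : ℕ} {p p' : ℤ} (hq : 0 < q) (hq' : 0 < q')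
    {x x' : ℝ} (h : f.lat q (-p) x = x) (h' : f.lat q' (-p') x' = x') : p * q' = p' * q := by
  rw [lat_apply_eq_iff] at h h'
  have e1 := CircleDeg1Lift.translationNumber_of_map_pow_eq_add_int _ h hq
  have e2 := CircleDeg1Lift.translationNumber_of_map_pow_eq_add_int _ h' hq'
  rw [e1] at e2
  field_simp at e2
  exact_mod_cast (by linarith : (p : ℝ) * q' = p' * q)

lemma isRotNumber_translationNumber (f : SmoothLift) :
    IsRotNumber f f.toDeg1.translationNumber := by
  intro x
  have := f.toDeg1.tendsto_translationNumber x
  simp only [CircleDeg1Lift.coe_pow] at this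
  exact this

lemma irrational_of_forall_ne {f : SmoothLift}
    (h : ∀ (q : ℕ) (p : ℤ), 0 < q → ∀ x, f.lat q (-p) x ≠ x) :
    Irrational f.toDeg1.translationNumber := by
  rintro ⟨r, hr⟩
  have h1 : f.toDeg1.translationNumber = (r.num : ℝ) / (r.den : ℕ) := by
    rw [← hr]; exact_mod_cast (Rat.num_div_den r).symm
  obtain ⟨x, hx⟩ := (f.toDeg1.translationNumber_eq_rat_iff f.continuous r.den_pos).1 h1
  exact h r.den r.num r.den_pos x ((f.lat_apply_eq_iff _ _ _).2 hx)

lemma lat_apply_ne_of_irrational {f : SmoothLift} {ρ : ℝ} (hρ : Irrational ρ)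
    (h : IsRotNumber f ρ) (q : ℕ) (p : ℤ) (hq : 0 < q) (x : ℝ) : f.lat q (-p) x ≠ x := by
  intro hx
  rw [lat_apply_eq_iff] at hx
  have e1 := CircleDeg1Lift.translationNumber_of_map_pow_eq_add_int _ hx hq
  have e2 := tendsto_nhds_unique (f.isRotNumber_translationNumber 0) (h 0)
  rw [← e2, e1] at hρ
  exact hρ ⟨(p : ℚ) / q, by push_cast; rfl⟩

lemma isOpen_forall_ne (q : ℕ) (p : ℤ) : IsOpen {f : SmoothLift | ∀ x, f.lat q p x ≠ x} := by
  rw [isOpen_iff_mem_nhds]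
  intro f hf
  have hc : Continuous fun P : SmoothLift × ℝ => -(|P.1.lat q p P.2 - P.2|) := by
    have := continuous_eval.comp ((continuous_lat q p).prodMap (continuous_id (X := ℝ)))
    exact ((this.sub continuous_snd).abs).neg
  have := eventually_forall_lt_of_periodic (φ := fun f x => -(|f.lat q p x - x|)) hc
    (fun f => (f.lat q p).periodic_sub_id.comp fun t => -|t|) (c := 0) (x₀ := f)
    (fun t => by simpa [sub_eq_zero] using hf t)
  filter_upwards [this] with g hg x
  simpa [sub_eq_zero] using hg x

lemma eventually_rigid {f : SmoothLift} {η ε₀ : ℝ} (hη : 0 < η) (hε₀ : 0 < ε₀) (i j : ℤ)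
    (h : (∀ x, |iteratedDeriv 2 (f.lat i j) x| ≤ η / 2) ∧ ∀ x, |f.lat i j x - x| ≤ ε₀ / 2) :
    ∀ᶠ g : SmoothLift in 𝓝 f, (∀ x, |iteratedDeriv 2 (g.lat i j) x| ≤ η) ∧
      ∀ x, |g.lat i j x - x| ≤ ε₀ := by
  have h1 := (continuous_lat i j).continuousAt.eventually
    (eventually_abs_iteratedDeriv_sub_lt (f.lat i j) 2 (half_pos hη))
  have h2 := (continuous_lat i j).continuousAt.eventually
    (eventually_abs_iteratedDeriv_sub_lt (f.lat i j) 0 (half_pos hε₀))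
  filter_upwards [h1, h2] with g hg1 hg2
  refine ⟨fun x => ?_, fun x => ?_⟩
  · have := abs_sub_abs_le_abs_sub (iteratedDeriv 2 (g.lat i j) x) (iteratedDeriv 2 (f.lat i j) x)
    linarith [hg1 x, h.1 x]
  · have e := hg2 x
    simp only [iteratedDeriv_zero] at e
    have := abs_sub_le (g.lat i j x) (f.lat i j x) x
    linarith [h.2 x]

lemma Rigid.half_of_mem_closure {S : Set SmoothLift} {η ε₀ : ℝ} (hη : 0 < η) (hε₀ : 0 < ε₀)
    (hS : ∀ f ∈ S, Rigid η ε₀ f) {f : SmoothLift} (hf : f ∈ closure S) :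
    Rigid (η / 2) (ε₀ / 2) f := by
  intro i j hi h
  obtain ⟨g, hg, hgS⟩ := mem_closure_iff_nhds.1 hf _ (eventually_rigid hη hε₀ i j h)
  exact hS g hgS i j hi hg

/-- Lifts whose bounded commuting lifts are limits of iterates. -/
def generic : Set SmoothLift :=
  ⋂ t : ℕ × ℕ × ℕ, nearIterates (t.1 + 1) (t.2.1 + 1) (1 / ((t.2.2 : ℝ) + 1))

lemma exists_generic_mem {η ε₀ : ℝ} (hη : 0 < η) (hε₀ : 0 < ε₀)
    (step : ∀ f ∈ goodParab η ε₀, ∀ (q : ℕ) (p : ℤ), 0 < q → ∀ V ∈ 𝓝 f,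
      ∃ g ∈ goodParab η ε₀, g ∈ V ∧ ∀ x, g.lat q (-p) x ≠ x)
    {f₀ : SmoothLift} (hf₀ : f₀ ∈ goodParab η ε₀) {V : Set SmoothLift} (hV : V ∈ 𝓝 f₀) :
    ∃ f ∈ V, f ∈ generic ∧ Rigid (η / 2) (ε₀ / 2) f ∧
      ∀ (q : ℕ) (p : ℤ), 0 < q → ∀ x, f.lat q (-p) x ≠ x := by
  obtain ⟨m, hm, hfm⟩ := f₀.exists_deriv_lower_bound
  have hmn : ∀ᶠ f : SmoothLift in 𝓝 f₀, ∀ x, -deriv f x < -m :=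
    eventually_forall_lt_of_periodic (φ := fun (f : SmoothLift) x => -deriv f x)
      continuous_deriv.neg (fun f => f.periodic_deriv.comp Neg.neg) (fun t => by
        linarith [hfm t])
  obtain ⟨C, hC, hCc, hCV⟩ := exists_mem_nhds_isClosed_subset hV
  set V₁ : Set SmoothLift := interior (C ∩ {f : SmoothLift | ∀ x, m < deriv f x}) with hV₁
  have hV₁n : f₀ ∈ V₁ := by
    rw [hV₁, mem_interior_iff_mem_nhds]
    exact inter_mem hC (hmn.mono fun f hf x => by linarith [hf x])
  have hV₁s : V₁ ⊆ C ∩ {f : SmoothLift | ∀ x, m < deriv f x} := interior_subset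
  set K := closure (goodParab η ε₀ ∩ V₁) with hK
  have hKm : ∀ f ∈ K, ∀ x, m ≤ deriv f x := by
    intro f hf x
    have hcl : IsClosed {f : SmoothLift | m ≤ deriv f x} :=
      isClosed_le continuous_const (continuous_deriv.comp (Continuous.prodMk_left x))
    exact closure_minimal (fun g hg => ((hV₁s hg.2).2 x).le) hcl hf
  have hB : BaireSpace K := baireSpace_of_isClosed isClosed_closure hm hKm
  have dense_of (O : Set SmoothLift) (hO : ∀ f ∈ goodParab η ε₀, ∀ W ∈ 𝓝 f,
      ∃ g ∈ goodParab η ε₀, g ∈ W ∧ g ∈ O) : Dense (Subtype.val ⁻¹' O : Set K) := by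
    rw [dense_iff_inter_open]
    rintro _ ⟨W, hW, rfl⟩ ⟨⟨f, hfK⟩, hfW⟩
    obtain ⟨f', hf'W, hf'⟩ := mem_closure_iff.1 hfK W hW hfW
    obtain ⟨g, hg, hgW, hgO⟩ := hO f' hf'.1 (W ∩ V₁)
      ((hW.inter isOpen_interior).mem_nhds ⟨hf'W, hf'.2⟩)
    exact ⟨⟨g, subset_closure ⟨hg, hgW.2⟩⟩, hgW.1, hgO⟩
  let O : (ℕ × ℕ × ℕ) ⊕ (ℕ × ℤ) → Set SmoothLift := Sum.elim
    (fun t => nearIterates (t.1 + 1) (t.2.1 + 1) (1 / ((t.2.2 : ℝ) + 1)))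
    (fun t => {f | ∀ x, f.lat (t.1 + 1 : ℕ) (-t.2) x ≠ x})
  have hO : ∀ s, IsOpen (O s) := by
    rintro (t | t)
    · exact isOpen_interior
    · exact isOpen_forall_ne (t.1 + 1) (-t.2)
  have hd : Dense (⋂ s, (Subtype.val ⁻¹' O s : Set K)) := by
    refine dense_iInter_of_isOpen (fun s => (hO s).preimage continuous_subtype_val) ?_
    rintro (t | t)
    · exact dense_of _ fun f hf W hW => ⟨f, hf, mem_of_mem_nhds hW,
        hf.2.1.mem_nearIterates (by omega) (by positivity) (by positivity)⟩
    · exact dense_of _ fun f hf W hW => step f hf (t.1 + 1) t.2 (by omega) W hW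
  have : Nonempty K := ⟨⟨f₀, subset_closure ⟨hf₀, hV₁n⟩⟩⟩
  obtain ⟨f, hf⟩ := hd.nonempty
  have hf' := fun s => Set.mem_iInter.1 hf s
  refine ⟨f, ?_, Set.mem_iInter.2 fun t => hf' (Sum.inl t), ?_, ?_⟩
  · exact hCV (closure_minimal (fun g hg => (hV₁s hg.2).1) hCc f.2)
  · exact Rigid.half_of_mem_closure hη hε₀ (fun g hg => hg.1.2.2) f.2
  · intro q p hq x
    have := hf' (Sum.inr (q - 1, p))
    have e : q - 1 + 1 = q := by omega
    simp only [O, Set.mem_preimage, Sum.elim_inr, e] at this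
    exact this x

lemma exists_bounded (g : SmoothLift) (r : ℕ) : ∃ N : ℕ, Bounded r (N + 1) g := by
  have h1 : ∀ k : ℕ, ∃ C, 0 < C ∧ ∀ x, |iteratedDeriv (k + 1) g x| ≤ C := fun k =>
    exists_forall_abs_le_of_periodic (contDiff_iteratedDeriv g.contDiff _).continuous
      (g.periodic_iteratedDeriv_succ k)
  choose C hC hCb using h1
  obtain ⟨m, hm, hgm⟩ := g.exists_deriv_lower_bound
  obtain ⟨N, hN⟩ := exists_nat_gt (∑ k ∈ Finset.range (r + 1), C k + m⁻¹ + |g 0|)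
  have hs : 0 ≤ ∑ k ∈ Finset.range (r + 1), C k := Finset.sum_nonneg fun k _ => (hC k).le
  have hm' := inv_pos.2 hm
  have hg0 := abs_nonneg (g 0)
  refine ⟨N, fun k hk hk' x => ?_, fun x => ?_, by linarith⟩
  · have h2 := hCb (k - 1) x
    rw [Nat.sub_add_cancel hk] at h2
    have h3 := Finset.single_le_sum (f := C) (fun k _ => (hC k).le)
      (Finset.mem_range.2 (by omega : k - 1 < r + 1))
    linarith
  · refine le_trans ?_ (hgm x).le
    rw [inv_le_comm₀ (by positivity) hm]
    linarith

lemma exists_close_mem (g : SmoothLift) {V : Set SmoothLift} (hV : V ∈ 𝓝 g) :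
    ∃ (r : ℕ) (δ : ℝ), 0 < δ ∧ ∀ h : SmoothLift,
      (∀ k ≤ r, ∀ x, |iteratedDeriv k h x - iteratedDeriv k g x| ≤ δ) → h ∈ V := by
  obtain ⟨r, δ, hδ, H⟩ := g.exists_perturbation_bound hV
  refine ⟨r, δ, hδ, fun h hh => ?_⟩
  obtain ⟨h', hh', e⟩ := H (fun x => h x - g x) (h.contDiff.sub g.contDiff) (h.periodic_sub g)
    fun k hk x => by
      rw [iteratedDeriv_fun_sub (h.contDiff_nat k).contDiffAt (g.contDiff_nat k).contDiffAt]
      exact hh k hk x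
  have : h' = h := ext fun x => by rw [e]; ring
  rwa [← this]

lemma centralizerLifts_eq_closure {f : SmoothLift} (hf : f ∈ generic) :
    CentralizerLifts f = closure {g : SmoothLift | IsIterateLift f g} := by
  refine Set.Subset.antisymm (fun g hg => ?_) (closure_minimal ?_ ?_)
  · rw [mem_centralizerLifts_iff] at hg
    rw [mem_closure_iff_nhds]
    intro V hV
    obtain ⟨r, δ, hδ, H⟩ := g.exists_close_mem hV
    obtain ⟨N, hN⟩ := g.exists_bounded (r + 1)
    obtain ⟨n, hn⟩ := exists_nat_one_div_lt hδ
    obtain ⟨i, j, hij⟩ := interior_subset (Set.mem_iInter.1 hf (r, N, n)) g hg hN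
    refine ⟨f.lat i j, H _ fun k hk x => ?_, isIterateLift_iff.2 ⟨i, j, rfl⟩⟩
    rw [abs_sub_comm]
    exact ((hij k (by simp; omega) x).trans hn).le
  · intro g hg
    obtain ⟨i, j, rfl⟩ := isIterateLift_iff.1 hg
    exact mem_centralizerLifts_iff.2 (f.lat_commute_self i j)
  · have : CentralizerLifts f = {g : SmoothLift | g * f = f * g} :=
      Set.ext fun g => mem_centralizerLifts_iff
    rw [this]
    exact isClosed_eq (by fun_prop) (by fun_prop)

/-- The group of integer translates of iterates. -/
noncomputable def latGroup (f : SmoothLift) : Subgroup SmoothLift where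
  carrier := {g | ∃ i j : ℤ, g = f.lat i j}
  mul_mem' := by
    rintro _ _ ⟨i, j, rfl⟩ ⟨i', j', rfl⟩
    exact ⟨i + i', j + j', (f.lat_add _ _ _ _).symm⟩
  one_mem' := ⟨0, 0, f.lat_zero_zero.symm⟩
  inv_mem' := by
    rintro _ ⟨i, j, rfl⟩
    exact ⟨-i, -j, f.lat_inv i j⟩

lemma Rigid.isClosed_iterates {f : SmoothLift} {η ε₀ : ℝ} (hη : 0 < η) (hε₀ : 0 < ε₀)
    (hR : Rigid η ε₀ f) : IsClosed {g : SmoothLift | IsIterateLift f g} := by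
  have h0 : {g : SmoothLift | IsIterateLift f g} = (latGroup f : Set SmoothLift) :=
    Set.ext fun g => isIterateLift_iff
  rw [h0]
  have h1 : ∀ᶠ g : SmoothLift in 𝓝 1, g ∈ latGroup f → g = 1 := by
    filter_upwards [eventually_abs_iteratedDeriv_sub_lt 1 2 hη,
      eventually_abs_iteratedDeriv_sub_lt 1 0 (lt_min hε₀ one_pos)] with g hg2 hg0
    rintro ⟨i, j, rfl⟩
    have hD2 : iteratedDeriv 2 (1 : SmoothLift) = fun _ => 0 := by
      rw [iteratedDeriv_succ, iteratedDeriv_one, show deriv (1 : SmoothLift) = fun _ => 1 from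
        funext deriv_one]
      simp
    simp only [hD2, sub_zero] at hg2
    simp only [iteratedDeriv_zero, one_apply] at hg0
    have hi : i = 0 := by
      by_contra hi
      exact hR i j hi ⟨fun x => (hg2 x).le, fun x => (hg0 x).le.trans (min_le_left _ _)⟩
    subst hi
    have hj : j = 0 := by
      have := (hg0 0).trans_le (min_le_right _ _)
      rw [lat_zero_left] at this
      simp only [tr_apply, zero_add, sub_zero] at this
      exact Int.abs_lt_one_iff.1 (by exact_mod_cast this)
    rw [hj, lat_zero_zero]
  have : DiscreteTopology (latGroup f) := by
    refine discreteTopology_of_isOpen_singleton_one ?_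
    rw [isOpen_singleton_iff_nhds_eq_pure, ← nhdsWithin_univ, nhdsWithin_univ]
    refine le_antisymm ?_ (pure_le_nhds _)
    rw [le_pure_iff, nhds_subtype_eq_comap]
    refine mem_comap.2 ⟨_, h1, ?_⟩
    rintro ⟨g, hg⟩ hg'
    exact Subtype.ext (hg' hg)
  exact Subgroup.isClosed_of_discrete

theorem centralizers_of_perturbations
    (init : ∀ f : SmoothLift, (∀ (q : ℕ) (p : ℤ), 0 < q → ∀ x, f.lat q (-p) x ≠ x) →
      ∀ V ∈ 𝓝 f, ∃ η ε₀ : ℝ, 0 < η ∧ η ≤ 1 / 2 ∧ 0 < ε₀ ∧ ε₀ < 1 ∧ (goodParab η ε₀ ∩ V).Nonempty)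
    (step : ∀ η ε₀ : ℝ, 0 < η → η ≤ 1 / 2 → 0 < ε₀ → ε₀ < 1 → ∀ f ∈ goodParab η ε₀,
      ∀ (q : ℕ) (p : ℤ), 0 < q → ∀ V ∈ 𝓝 f,
      ∃ g ∈ goodParab η ε₀, g ∈ V ∧ ∀ x, g.lat q (-p) x ≠ x) :
    (∃ R : Set FIrrational, IsGδ R ∧ Dense R ∧
      ∀ F ∈ R, CentralizerLifts F.1.1 =
        closure {G : SmoothLift | IsIterateLift F.1.1 G.1}) ∧
    (∃ D : Set FIrrational, Dense D ∧
      ∀ F ∈ D, CentralizerLifts F.1.1 = {G : SmoothLift | IsIterateLift F.1.1 G.1} ∧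
        closure {G : SmoothLift | IsIterateLift F.1.1 G.1} =
          {G : SmoothLift | IsIterateLift F.1.1 G.1}) := by
  let val : FIrrational → SmoothLift := fun F => F.1
  have hval : IsInducing val := ⟨rfl⟩
  set R : Set FIrrational := val ⁻¹' generic with hR
  set D : Set FIrrational := R ∩ {F | ∃ η ε₀ : ℝ, 0 < η ∧ 0 < ε₀ ∧ Rigid η ε₀ F.1} with hD
  have hDd : Dense D := by
    rw [dense_iff_inter_open]
    intro U hU hne
    obtain ⟨V, hV, rfl⟩ := hval.isOpen_iff.1 hU
    obtain ⟨F, hF⟩ := hne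
    obtain ⟨ρ, hρ, hρF⟩ := F.2
    obtain ⟨η, ε₀, hη, hη2, hε, hε1, f₀, hf₀, hf₀V⟩ := init F.1
      (lat_apply_ne_of_irrational hρ hρF) V (hV.mem_nhds hF)
    obtain ⟨f, hfV, hfg, hfR, hfn⟩ := exists_generic_mem hη hε (step η ε₀ hη hη2 hε hε1) hf₀
      (hV.mem_nhds hf₀V)
    exact ⟨⟨f, _, irrational_of_forall_ne hfn, f.isRotNumber_translationNumber⟩, hfV, hfg,
      η / 2, ε₀ / 2, half_pos hη, half_pos hε, hfR⟩
  refine ⟨⟨R, ?_, hDd.mono Set.inter_subset_left, fun F hF => centralizerLifts_eq_closure hF⟩,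
    D, hDd, fun F hF => ?_⟩
  · rw [hR, generic, Set.preimage_iInter]
    exact IsGδ.iInter_of_isOpen fun t => isOpen_interior.preimage hval.continuous
  · obtain ⟨hF1, η, ε₀, hη, hε, hrig⟩ := hF
    have h1 := (hrig.isClosed_iterates hη hε).closure_eq
    exact ⟨(centralizerLifts_eq_closure hF1).trans h1, h1⟩

end SmoothLift

/-! ### Fatou coordinates -/

namespace SmoothLift

lemma continuous_deriv_apply (h : SmoothLift) : Continuous (deriv h) := by
  simpa using (contDiff_iteratedDeriv h.contDiff 1).continuous

lemma exists_abs_log_deriv_sub_le (h : SmoothLift) :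
    ∃ L, 0 < L ∧ ∀ x y, |Real.log (deriv h x) - Real.log (deriv h y)| ≤ L * |x - y| := by
  have hd1 : ContDiff ℝ (⊤ : ℕ∞) (deriv h) := (contDiff_infty_iff_deriv.1 h.contDiff).2
  have hl : ContDiff ℝ (⊤ : ℕ∞) fun x => Real.log (deriv h x) :=
    hd1.log fun x => (h.deriv_pos x).ne'
  have hp : Function.Periodic (fun x => Real.log (deriv h x)) 1 := h.periodic_deriv.comp Real.log
  have hp1 := periodic_iteratedDeriv hp 1
  have hc1 := (contDiff_iteratedDeriv hl 1).continuous
  obtain ⟨L, hL, hb⟩ := exists_forall_abs_le_of_periodic hc1 hp1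
  refine ⟨L, hL, fun x y => ?_⟩
  rw [iteratedDeriv_one] at hb
  exact convex_univ.norm_image_sub_le_of_norm_deriv_le
    (fun z _ => hl.differentiable (by simp) z) (fun z _ => hb z) (Set.mem_univ y) (Set.mem_univ x)

lemma log_deriv_pow (h : SmoothLift) (n : ℕ) (x : ℝ) : Real.log (deriv (h ^ n : SmoothLift) x) =
    ∑ i ∈ Finset.range n, Real.log (deriv h ((h ^ i) x)) := by
  induction n with
  | zero => simp [deriv_one]
  | succ n ih =>
    rw [pow_succ', deriv_mul, Real.log_mul (h.deriv_pos _).ne' ((h ^ n).deriv_pos _).ne', ih,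
      Finset.sum_range_succ, add_comm]

/-- Every point of the interval `(α, β)` is attracted under `h` to the end point `ω`, which is a
fixed point with multiplier one. The sign `σ` is the direction of motion. -/
structure Attracting (h : SmoothLift) (α β ω σ : ℝ) : Prop where
  lt : α < β
  left : h α = α
  right : h β = β
  sign : |σ| = 1
  moves : ∀ x ∈ Set.Ioo α β, 0 < σ * (h x - x)
  tendsto : ∀ x ∈ Set.Ioo α β, Tendsto (fun n : ℕ => (h ^ n) x) atTop (𝓝 ω)
  deriv_eq : deriv h ω = 1
  sum_le : ∀ lo ∈ Set.Ioo α β, ∀ hi ∈ Set.Ioo α β, ∃ B, ∀ n : ℕ,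
    ∑ i ∈ Finset.range n, ((h ^ i) hi - (h ^ i) lo) ≤ B

lemma sum_shift_sub_le {u : ℕ → ℝ} {α β : ℝ} (hu : ∀ i, u i ∈ Set.Icc α β) (k n : ℕ) :
    ∑ i ∈ Finset.range n, (u (i + k) - u i) ≤ k * (β - α) := by
  induction k with
  | zero => simp
  | succ k ih =>
    have h1 := Finset.sum_range_sub (fun i => u (i + k)) n
    have h2 : ∑ i ∈ Finset.range n, (u (i + (k + 1)) - u i) =
        ∑ i ∈ Finset.range n, (u (i + 1 + k) - u (i + k)) +
          ∑ i ∈ Finset.range n, (u (i + k) - u i) := by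
      rw [← Finset.sum_add_distrib]
      refine Finset.sum_congr rfl fun i _ => ?_
      rw [show i + (k + 1) = i + 1 + k by ring]
      ring
    rw [h2, h1]
    push_cast
    linarith [(hu (n + k)).2, (hu (0 + k)).1]

lemma pow_mem_Ioo {h : SmoothLift} {α β : ℝ} (hα : h α = α) (hβ : h β = β) (n : ℕ) {x : ℝ}
    (hx : x ∈ Set.Ioo α β) : (h ^ n) x ∈ Set.Ioo α β := by
  induction n with
  | zero => simpa using hx
  | succ n ih =>
    rw [pow_succ', mul_apply]
    exact ⟨by simpa [hα] using h.strictMono ih.1, by simpa [hβ] using h.strictMono ih.2⟩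

lemma attracting_right {h : SmoothLift} {α β : ℝ} (hαβ : α < β) (hα : h α = α) (hβ : h β = β)
    (hm : ∀ x ∈ Set.Ioo α β, x < h x) (hd : deriv h β = 1) : Attracting h α β β 1 := by
  have ht : ∀ x ∈ Set.Ioo α β, Tendsto (fun n : ℕ => (h ^ n) x) atTop (𝓝 β) := by
    intro x hx
    have hmono : Monotone fun n : ℕ => (h ^ n) x := monotone_nat_of_le_succ fun n => by
      rw [pow_succ', mul_apply]
      exact (hm _ (pow_mem_Ioo hα hβ n hx)).le
    have hbdd : BddAbove (Set.range fun n : ℕ => (h ^ n) x) :=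
      ⟨β, by rintro _ ⟨n, rfl⟩; exact (pow_mem_Ioo hα hβ n hx).2.le⟩
    have hlim := tendsto_atTop_ciSup hmono hbdd
    set l := ⨆ n : ℕ, (h ^ n) x with hl
    have hfix : h l = l := by
      refine tendsto_nhds_unique ((h.continuous.tendsto l).comp hlim)
        ((hlim.comp (tendsto_add_atTop_nat 1)).congr fun n => ?_)
      simp [pow_succ']
    have hl1 : x ≤ l := by simpa using le_ciSup hbdd 0
    have hl2 : l ≤ β := ciSup_le fun n => (pow_mem_Ioo hα hβ n hx).2.le
    rcases hl2.eq_or_lt with e | e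
    · rwa [e] at hlim
    · exact absurd hfix (hm l ⟨hx.1.trans_le hl1, e⟩).ne'
  refine ⟨hαβ, hα, hβ, abs_one, fun x hx => by linarith [hm x hx], ht, hd,
    fun lo hlo hi hhi => ?_⟩
  obtain ⟨k, hk⟩ := ((ht lo hlo).eventually (lt_mem_nhds hhi.2)).exists
  refine ⟨k * (β - α), fun n => le_trans (Finset.sum_le_sum fun i _ => ?_)
    (sum_shift_sub_le (u := fun i => (h ^ i) lo) (fun i =>
      Set.Ioo_subset_Icc_self (pow_mem_Ioo hα hβ i hlo)) k n)⟩
  have := (h ^ i).monotone hk.le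
  rw [pow_add, mul_apply]
  linarith

lemma attracting_left {h : SmoothLift} {α β : ℝ} (hαβ : α < β) (hα : h α = α) (hβ : h β = β)
    (hm : ∀ x ∈ Set.Ioo α β, h x < x) (hd : deriv h α = 1) : Attracting h α β α (-1) := by
  have ht : ∀ x ∈ Set.Ioo α β, Tendsto (fun n : ℕ => (h ^ n) x) atTop (𝓝 α) := by
    intro x hx
    have hanti : Antitone fun n : ℕ => (h ^ n) x := antitone_nat_of_succ_le fun n => by
      rw [pow_succ', mul_apply]
      exact (hm _ (pow_mem_Ioo hα hβ n hx)).le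
    have hbdd : BddBelow (Set.range fun n : ℕ => (h ^ n) x) :=
      ⟨α, by rintro _ ⟨n, rfl⟩; exact (pow_mem_Ioo hα hβ n hx).1.le⟩
    have hlim := tendsto_atTop_ciInf hanti hbdd
    set l := ⨅ n : ℕ, (h ^ n) x with hl
    have hfix : h l = l := by
      refine tendsto_nhds_unique ((h.continuous.tendsto l).comp hlim)
        ((hlim.comp (tendsto_add_atTop_nat 1)).congr fun n => ?_)
      simp [pow_succ']
    have hl1 : l ≤ x := by simpa using ciInf_le hbdd 0
    have hl2 : α ≤ l := le_ciInf fun n => (pow_mem_Ioo hα hβ n hx).1.le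
    rcases hl2.eq_or_lt with e | e
    · rwa [← e] at hlim
    · exact absurd hfix (hm l ⟨e, hl1.trans_lt hx.2⟩).ne
  refine ⟨hαβ, hα, hβ, by simp, fun x hx => by linarith [hm x hx], ht, hd,
    fun lo hlo hi hhi => ?_⟩
  obtain ⟨k, hk⟩ := ((ht hi hhi).eventually (gt_mem_nhds hlo.1)).exists
  refine ⟨k * (-α - -β), fun n => le_trans (Finset.sum_le_sum fun i _ => ?_)
    (sum_shift_sub_le (u := fun i => -(h ^ i) hi) (fun i => ?_) k n)⟩
  · have := (h ^ i).monotone hk.le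
    rw [pow_add, mul_apply]
    linarith
  · have := pow_mem_Ioo hα hβ i hhi
    exact ⟨by linarith [this.2], by linarith [this.1]⟩

/-- The Fatou coordinate of `h` normalized at `xs`, as an ultrafilter limit. -/
noncomputable def fatou (h : SmoothLift) (xs x : ℝ) : ℝ :=
  limUnder (hyperfilter ℕ : Filter ℕ)
    fun n => ((h ^ n) x - (h ^ n) xs) / |(h ^ (n + 1)) xs - (h ^ n) xs|

lemma fatou_congr {h h' : SmoothLift} {xs x : ℝ} (h1 : ∀ n : ℕ, (h ^ n) xs = (h' ^ n) xs)
    (h2 : ∀ n : ℕ, (h ^ n) x = (h' ^ n) x) : fatou h xs x = fatou h' xs x := by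
  simp only [fatou, h1, h2]

namespace Attracting

variable {h : SmoothLift} {α β ω σ : ℝ}

lemma pow_mem (H : Attracting h α β ω σ) (n : ℕ) {x : ℝ} (hx : x ∈ Set.Ioo α β) :
    (h ^ n) x ∈ Set.Ioo α β := pow_mem_Ioo H.left H.right n hx

lemma apply_mem (H : Attracting h α β ω σ) {x : ℝ} (hx : x ∈ Set.Ioo α β) :
    h x ∈ Set.Ioo α β := by simpa using H.pow_mem 1 hx

lemma sigma_sq (H : Attracting h α β ω σ) : σ * σ = 1 := by
  rw [← abs_mul_abs_self, H.sign, one_mul]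

lemma abs_sub (H : Attracting h α β ω σ) {x : ℝ} (hx : x ∈ Set.Ioo α β) :
    |h x - x| = σ * (h x - x) := by
  rw [← abs_of_pos (H.moves x hx), abs_mul, H.sign, one_mul]

lemma distortion (H : Attracting h α β ω σ) {lo hi : ℝ} (hlo : lo ∈ Set.Ioo α β)
    (hhi : hi ∈ Set.Ioo α β) : ∃ D, 0 < D ∧ ∀ (n : ℕ), ∀ ξ ∈ Set.Icc lo hi, ∀ ζ ∈ Set.Icc lo hi,
      deriv (h ^ n : SmoothLift) ξ ≤ D * deriv (h ^ n : SmoothLift) ζ := by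
  obtain ⟨L, hL, hLb⟩ := h.exists_abs_log_deriv_sub_le
  obtain ⟨B, hB⟩ := H.sum_le lo hlo hi hhi
  refine ⟨Real.exp (L * B), Real.exp_pos _, fun n ξ hξ ζ hζ => ?_⟩
  have p1 := (h ^ n).deriv_pos ξ
  have p2 := (h ^ n).deriv_pos ζ
  rw [← Real.log_le_log_iff p1 (by positivity), Real.log_mul (Real.exp_pos _).ne' p2.ne',
    Real.log_exp, log_deriv_pow, log_deriv_pow, ← sub_le_iff_le_add, ← Finset.sum_sub_distrib]
  calc ∑ i ∈ Finset.range n, (Real.log (deriv h ((h ^ i) ξ)) - Real.log (deriv h ((h ^ i) ζ)))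
      ≤ ∑ i ∈ Finset.range n, L * ((h ^ i) hi - (h ^ i) lo) := by
        refine Finset.sum_le_sum fun i _ => (le_abs_self _).trans ((hLb _ _).trans ?_)
        have m := (h ^ i).monotone
        refine mul_le_mul_of_nonneg_left (abs_le.2 ⟨?_, ?_⟩) hL.le
        · linarith [m hξ.1, m hζ.2]
        · linarith [m hξ.2, m hζ.1]
    _ ≤ L * B := by
        rw [← Finset.mul_sum]
        exact mul_le_mul_of_nonneg_left (hB n) hL.le

lemma exists_mul_sub (g : SmoothLift) {x y : ℝ} (hxy : y ≤ x) :
    ∃ ξ ∈ Set.Icc y x, g x - g y = deriv g ξ * (x - y) := by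
  rcases hxy.eq_or_lt with rfl | hlt
  · exact ⟨y, ⟨le_rfl, le_rfl⟩, by simp⟩
  · obtain ⟨ξ, hξ, e⟩ := exists_deriv_eq_slope g hlt g.continuous.continuousOn
      g.differentiable.differentiableOn
    refine ⟨ξ, Set.Ioo_subset_Icc_self hξ, ?_⟩
    rw [e, div_mul_cancel₀ _ (sub_pos.2 hlt).ne']

lemma exists_mul_abs_sub (g : SmoothLift) {x y lo hi : ℝ} (hx : x ∈ Set.Icc lo hi)
    (hy : y ∈ Set.Icc lo hi) : ∃ ξ ∈ Set.Icc lo hi, |g x - g y| = deriv g ξ * |x - y| := by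
  rcases le_total y x with hxy | hxy
  · obtain ⟨ξ, hξ, e⟩ := exists_mul_sub g hxy
    exact ⟨ξ, ⟨hy.1.trans hξ.1, hξ.2.trans hx.2⟩, by rw [e, abs_mul, abs_of_pos (g.deriv_pos ξ)]⟩
  · obtain ⟨ξ, hξ, e⟩ := exists_mul_sub g hxy
    refine ⟨ξ, ⟨hx.1.trans hξ.1, hξ.2.trans hy.2⟩, ?_⟩
    rw [abs_sub_comm, e, abs_mul, abs_of_pos (g.deriv_pos ξ), abs_sub_comm]

lemma denom_pos (H : Attracting h α β ω σ) {xs : ℝ} (hxs : xs ∈ Set.Ioo α β) (n : ℕ) :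
    0 < |(h ^ (n + 1)) xs - (h ^ n) xs| := by
  rw [pow_succ', mul_apply, H.abs_sub (H.pow_mem n hxs)]
  exact H.moves _ (H.pow_mem n hxs)

lemma exists_quotient_bounds (H : Attracting h α β ω σ) {xs lo hi : ℝ} (hlo : lo ∈ Set.Ioo α β)
    (hhi : hi ∈ Set.Ioo α β) (h1 : xs ∈ Set.Icc lo hi) (h2 : h xs ∈ Set.Icc lo hi) :
    ∃ c C, 0 < c ∧ 0 < C ∧ ∀ (n : ℕ), ∀ y ∈ Set.Icc lo hi, ∀ x ∈ Set.Icc lo hi, y ≤ x →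
      c * (x - y) ≤ ((h ^ n) x - (h ^ n) y) / |(h ^ (n + 1)) xs - (h ^ n) xs| ∧
      ((h ^ n) x - (h ^ n) y) / |(h ^ (n + 1)) xs - (h ^ n) xs| ≤ C * (x - y) := by
  obtain ⟨D, hD, hDb⟩ := H.distortion hlo hhi
  have hxs : xs ∈ Set.Ioo α β := ⟨hlo.1.trans_le h1.1, h1.2.trans_lt hhi.2⟩
  have hΔ : 0 < |h xs - xs| := by simpa using H.denom_pos hxs 0
  refine ⟨(D * |h xs - xs|)⁻¹, D * |h xs - xs|⁻¹, by positivity, by positivity,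
    fun n y hy x hx hyx => ?_⟩
  obtain ⟨ξ, hξ, e1⟩ := exists_mul_sub (h ^ n) hyx
  obtain ⟨ζ, hζ, e2⟩ := exists_mul_abs_sub (h ^ n) h2 h1
  have hξ' : ξ ∈ Set.Icc lo hi := ⟨hy.1.trans hξ.1, hξ.2.trans hx.2⟩
  have e3 : |(h ^ (n + 1)) xs - (h ^ n) xs| = deriv (h ^ n : SmoothLift) ζ * |h xs - xs| := by
    rw [pow_succ, mul_apply, e2]
  have p1 := (h ^ n).deriv_pos ξ
  have p2 := (h ^ n).deriv_pos ζ
  have d1 := hDb n ξ hξ' ζ hζ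
  have d2 := hDb n ζ hζ ξ hξ'
  rw [e1, e3]
  have hxy : 0 ≤ x - y := by linarith
  constructor
  · rw [le_div_iff₀ (by positivity)]
    have : (D * |h xs - xs|)⁻¹ * (x - y) * (deriv (h ^ n : SmoothLift) ζ * |h xs - xs|) =
        (x - y) * (deriv (h ^ n : SmoothLift) ζ / D) := by field_simp
    rw [this, mul_comm]
    refine mul_le_mul_of_nonneg_right ?_ hxy
    rw [div_le_iff₀ hD]
    linarith
  · rw [div_le_iff₀ (by positivity)]
    have : D * |h xs - xs|⁻¹ * (x - y) * (deriv (h ^ n : SmoothLift) ζ * |h xs - xs|) =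
        (D * deriv (h ^ n : SmoothLift) ζ) * (x - y) := by field_simp
    rw [this]
    exact mul_le_mul_of_nonneg_right d1 hxy

lemma exists_Icc (H : Attracting h α β ω σ) {xs x y : ℝ} (hxs : xs ∈ Set.Ioo α β)
    (hx : x ∈ Set.Ioo α β) (hy : y ∈ Set.Ioo α β) : ∃ lo ∈ Set.Ioo α β, ∃ hi ∈ Set.Ioo α β,
      xs ∈ Set.Icc lo hi ∧ h xs ∈ Set.Icc lo hi ∧ x ∈ Set.Icc lo hi ∧ y ∈ Set.Icc lo hi := by
  have h2 := H.apply_mem hxs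
  refine ⟨min (min xs (h xs)) (min x y), ⟨?_, ?_⟩, max (max xs (h xs)) (max x y), ⟨?_, ?_⟩,
    ⟨?_, ?_⟩, ⟨?_, ?_⟩, ⟨?_, ?_⟩, ⟨?_, ?_⟩⟩
  · exact lt_min (lt_min hxs.1 h2.1) (lt_min hx.1 hy.1)
  · exact ((min_le_left _ _).trans (min_le_left _ _)).trans_lt hxs.2
  · exact hxs.1.trans_le ((le_max_left _ _).trans (le_max_left _ _))
  · exact max_lt (max_lt hxs.2 h2.2) (max_lt hx.2 hy.2)
  all_goals simp

lemma tendsto_fatou (H : Attracting h α β ω σ) {xs x : ℝ} (hxs : xs ∈ Set.Ioo α β)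
    (hx : x ∈ Set.Ioo α β) : Tendsto
      (fun n => ((h ^ n) x - (h ^ n) xs) / |(h ^ (n + 1)) xs - (h ^ n) xs|)
      (hyperfilter ℕ : Filter ℕ) (𝓝 (fatou h xs x)) := by
  obtain ⟨lo, hlo, hi, hhi, m1, m2, m3, -⟩ := H.exists_Icc hxs hx hx
  obtain ⟨c, C, hc, hC, hb⟩ := H.exists_quotient_bounds hlo hhi m1 m2
  have hbd : ∀ n, ((h ^ n) x - (h ^ n) xs) / |(h ^ (n + 1)) xs - (h ^ n) xs| ∈
      Set.Icc (-(C * |x - xs|)) (C * |x - xs|) := by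
    intro n
    rcases le_total xs x with hle | hle
    · have := hb n xs m1 x m3 hle
      rw [abs_of_nonneg (sub_nonneg.2 hle)]
      have : 0 ≤ c * (x - xs) := mul_nonneg hc.le (by linarith)
      have : 0 ≤ C * (x - xs) := mul_nonneg hC.le (by linarith)
      constructor <;> linarith
    · have h1 := hb n x m3 xs m1 hle
      rw [abs_of_nonpos (sub_nonpos.2 hle), ← neg_sub ((h ^ n) xs), neg_div]
      have : 0 ≤ c * (xs - x) := mul_nonneg hc.le (by linarith)
      have : 0 ≤ C * (xs - x) := mul_nonneg hC.le (by linarith)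
      constructor <;> linarith
  obtain ⟨l, -, hl⟩ := isCompact_Icc.ultrafilter_le_nhds
    ((hyperfilter ℕ).map fun n => ((h ^ n) x - (h ^ n) xs) / |(h ^ (n + 1)) xs - (h ^ n) xs|)
    (le_principal_iff.2 (show _ ∈ (hyperfilter ℕ).map _ from
      Ultrafilter.mem_map.2 (Filter.univ_mem' hbd)))
  exact tendsto_nhds_limUnder ⟨l, hl⟩

lemma tendsto_fatou_sub (H : Attracting h α β ω σ) {xs x y : ℝ} (hxs : xs ∈ Set.Ioo α β)
    (hx : x ∈ Set.Ioo α β) (hy : y ∈ Set.Ioo α β) : Tendsto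
      (fun n => ((h ^ n) x - (h ^ n) y) / |(h ^ (n + 1)) xs - (h ^ n) xs|)
      (hyperfilter ℕ : Filter ℕ) (𝓝 (fatou h xs x - fatou h xs y)) := by
  refine ((H.tendsto_fatou hxs hx).sub (H.tendsto_fatou hxs hy)).congr fun n => ?_
  rw [← sub_div]
  congr 1
  ring

lemma exists_fatou_bounds (H : Attracting h α β ω σ) {xs lo hi : ℝ} (hlo : lo ∈ Set.Ioo α β)
    (hhi : hi ∈ Set.Ioo α β) (h1 : xs ∈ Set.Icc lo hi) (h2 : h xs ∈ Set.Icc lo hi) :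
    ∃ c C, 0 < c ∧ 0 < C ∧ ∀ y ∈ Set.Icc lo hi, ∀ x ∈ Set.Icc lo hi, y ≤ x →
      c * (x - y) ≤ fatou h xs x - fatou h xs y ∧
      fatou h xs x - fatou h xs y ≤ C * (x - y) := by
  obtain ⟨c, C, hc, hC, hb⟩ := H.exists_quotient_bounds hlo hhi h1 h2
  have hI : ∀ z ∈ Set.Icc lo hi, z ∈ Set.Ioo α β := fun z hz =>
    ⟨hlo.1.trans_le hz.1, hz.2.trans_lt hhi.2⟩
  refine ⟨c, C, hc, hC, fun y hy x hx hyx => ⟨?_, ?_⟩⟩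
  · exact ge_of_tendsto (H.tendsto_fatou_sub (hI xs h1) (hI x hx) (hI y hy))
      (Eventually.of_forall fun n => (hb n y hy x hx hyx).1)
  · exact le_of_tendsto (H.tendsto_fatou_sub (hI xs h1) (hI x hx) (hI y hy))
      (Eventually.of_forall fun n => (hb n y hy x hx hyx).2)

lemma strictMonoOn_fatou (H : Attracting h α β ω σ) {xs : ℝ} (hxs : xs ∈ Set.Ioo α β) :
    StrictMonoOn (fatou h xs) (Set.Ioo α β) := by
  intro y hy x hx hyx
  obtain ⟨lo, hlo, hi, hhi, m1, m2, m3, m4⟩ := H.exists_Icc hxs hx hy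
  obtain ⟨c, C, hc, hC, hb⟩ := H.exists_fatou_bounds hlo hhi m1 m2
  have := (hb y m4 x m3 hyx.le).1
  have : 0 < c * (x - y) := mul_pos hc (by linarith)
  linarith

lemma continuousOn_fatou (H : Attracting h α β ω σ) {xs : ℝ} (hxs : xs ∈ Set.Ioo α β) :
    ContinuousOn (fatou h xs) (Set.Ioo α β) := by
  intro x hx
  obtain ⟨lo', h1, h2⟩ := exists_between hx.1
  obtain ⟨hi', h3, h4⟩ := exists_between hx.2
  obtain ⟨lo, hlo, hi, hhi, m1, m2, m3, m4⟩ := H.exists_Icc hxs (x := lo') (y := hi')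
    ⟨h1, h2.trans hx.2⟩ ⟨hx.1.trans h3, h4⟩
  obtain ⟨c, C, hc, hC, hb⟩ := H.exists_fatou_bounds hlo hhi m1 m2
  have hL : LipschitzOnWith C.toNNReal (fatou h xs) (Set.Icc lo hi) := by
    refine LipschitzOnWith.of_dist_le_mul fun u hu v hv => ?_
    rw [Real.coe_toNNReal C hC.le, Real.dist_eq, Real.dist_eq]
    rcases le_total v u with hle | hle
    · have := hb v hv u hu hle
      have : 0 ≤ c * (u - v) := mul_nonneg hc.le (by linarith)
      rw [abs_of_nonneg (by linarith), abs_of_nonneg (by linarith)]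
      linarith
    · have := hb u hu v hv hle
      have : 0 ≤ c * (v - u) := mul_nonneg hc.le (by linarith)
      rw [abs_of_nonpos (by linarith), abs_of_nonpos (by linarith)]
      linarith
  exact (hL.continuousOn.continuousAt (Icc_mem_nhds (m3.1.trans_lt h2)
    (h3.trans_le m4.2))).continuousWithinAt

lemma fatou_map_sub (H : Attracting h α β ω σ) {xs : ℝ} (hxs : xs ∈ Set.Ioo α β) {g : ℝ → ℝ}
    {γ : ℝ} (hg : HasStrictDerivAt g γ ω) (hcomm : ∀ x, g (h x) = h (g x))
    (hmap : ∀ x ∈ Set.Ioo α β, g x ∈ Set.Ioo α β) {x y : ℝ} (hx : x ∈ Set.Ioo α β)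
    (hy : y ∈ Set.Ioo α β) :
    fatou h xs (g x) - fatou h xs (g y) = γ * (fatou h xs x - fatou h xs y) := by
  have hcn (n : ℕ) (z : ℝ) : (h ^ n) (g z) = g ((h ^ n) z) := by
    induction n with
    | zero => simp
    | succ n ih => rw [pow_succ', mul_apply, mul_apply, ih, hcomm]
  rcases eq_or_ne x y with rfl | hne
  · simp
  have t1 := H.tendsto_fatou_sub hxs (hmap x hx) (hmap y hy)
  have t2 := H.tendsto_fatou_sub hxs hx hy
  have hle : (hyperfilter ℕ : Filter ℕ) ≤ atTop := Nat.hyperfilter_le_atTop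
  have t3 : Tendsto (fun n : ℕ => (g ((h ^ n) x) - g ((h ^ n) y)) / ((h ^ n) x - (h ^ n) y))
      (hyperfilter ℕ : Filter ℕ) (𝓝 γ) := by
    have := hg.isLittleO.comp_tendsto
      (((H.tendsto x hx).prodMk_nhds (H.tendsto y hy)).mono_left hle)
    have h0 := this.tendsto_div_nhds_zero
    have h1 := h0.add_const γ
    rw [zero_add] at h1
    refine h1.congr fun n => ?_
    have hn : (h ^ n) x - (h ^ n) y ≠ 0 := sub_ne_zero.2 fun e => hne ((h ^ n).injective e)
    simp only [Function.comp_apply, ContinuousLinearMap.toSpanSingleton_apply, smul_eq_mul]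
    field_simp
    ring
  refine tendsto_nhds_unique t1 ((t3.mul t2).congr fun n => ?_)
  have hn : (h ^ n) x - (h ^ n) y ≠ 0 := sub_ne_zero.2 fun e => hne ((h ^ n).injective e)
  rw [hcn, hcn]
  field_simp

lemma fatou_self (H : Attracting h α β ω σ) {xs : ℝ} (hxs : xs ∈ Set.Ioo α β) :
    fatou h xs xs = 0 := by
  refine tendsto_nhds_unique (H.tendsto_fatou hxs hxs) ?_
  simp

lemma fatou_apply_self (H : Attracting h α β ω σ) {xs : ℝ} (hxs : xs ∈ Set.Ioo α β) :
    fatou h xs (h xs) = σ := by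
  refine tendsto_nhds_unique (H.tendsto_fatou hxs (H.apply_mem hxs))
    (tendsto_const_nhds.congr fun n => ?_)
  have h1 := H.abs_sub (H.pow_mem n hxs)
  have h2 := H.moves _ (H.pow_mem n hxs)
  have h3 : (h ^ n) (h xs) = h ((h ^ n) xs) := by
    rw [← mul_apply, ← mul_apply, ← pow_succ, pow_succ']
  rw [pow_succ', mul_apply, h1, h3, eq_div_iff h2.ne', ← mul_assoc, H.sigma_sq, one_mul]

lemma fatou_apply (H : Attracting h α β ω σ) {xs : ℝ} (hxs : xs ∈ Set.Ioo α β) {x : ℝ}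
    (hx : x ∈ Set.Ioo α β) : fatou h xs (h x) = fatou h xs x + σ := by
  have hs : HasStrictDerivAt h 1 ω := by
    have := (h.contDiff_nat 1).contDiffAt.hasStrictDerivAt (x := ω) (by simp)
    rwa [H.deriv_eq] at this
  have := H.fatou_map_sub hxs hs (fun _ => rfl) (fun z hz => H.apply_mem hz) hx hxs
  rw [H.fatou_self hxs, H.fatou_apply_self hxs] at this
  linarith

lemma inv_apply_mem (H : Attracting h α β ω σ) {x : ℝ} (hx : x ∈ Set.Ioo α β) :
    h⁻¹ x ∈ Set.Ioo α β := by
  constructor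
  · rw [← h.strictMono.lt_iff_lt, H.left, apply_inv_apply]; exact hx.1
  · rw [← h.strictMono.lt_iff_lt, H.right, apply_inv_apply]; exact hx.2

lemma zpow_mem (H : Attracting h α β ω σ) (n : ℤ) {x : ℝ} (hx : x ∈ Set.Ioo α β) :
    (h ^ n) x ∈ Set.Ioo α β := by
  induction n with
  | zero => simpa using hx
  | succ n ih => rw [add_comm, zpow_add, zpow_one, mul_apply]; exact H.apply_mem ih
  | pred n ih =>
    rw [sub_eq_neg_add, zpow_add, zpow_neg_one, mul_apply]
    exact H.inv_apply_mem ih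

lemma fatou_zpow (H : Attracting h α β ω σ) {xs : ℝ} (hxs : xs ∈ Set.Ioo α β) {x : ℝ}
    (hx : x ∈ Set.Ioo α β) (n : ℤ) : fatou h xs ((h ^ n) x) = fatou h xs x + n * σ := by
  induction n with
  | zero => simp
  | succ n ih =>
    rw [add_comm, zpow_add, zpow_one, mul_apply, H.fatou_apply hxs (H.zpow_mem n hx), ih]
    push_cast
    ring
  | pred n ih =>
    have := H.fatou_apply hxs (H.inv_apply_mem (H.zpow_mem (-n) hx))
    rw [apply_inv_apply, ih] at this
    rw [sub_eq_neg_add, zpow_add, zpow_neg_one, mul_apply]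
    push_cast at *
    linarith

lemma surjOn_fatou (H : Attracting h α β ω σ) {xs : ℝ} (hxs : xs ∈ Set.Ioo α β) :
    Set.SurjOn (fatou h xs) (Set.Ioo α β) Set.univ := by
  intro y _
  have hpt (m : ℤ) : ∃ z ∈ Set.Ioo α β, fatou h xs z = m := by
    rcases eq_or_eq_neg_of_abs_eq H.sign with e | e
    · refine ⟨(h ^ m) xs, H.zpow_mem m hxs, ?_⟩
      rw [H.fatou_zpow hxs hxs, H.fatou_self hxs, e]; ring
    · refine ⟨(h ^ (-m)) xs, H.zpow_mem (-m) hxs, ?_⟩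
      rw [H.fatou_zpow hxs hxs, H.fatou_self hxs, e]; push_cast; ring
  obtain ⟨u, hu, eu⟩ := hpt ⌊y⌋
  obtain ⟨v, hv, ev⟩ := hpt (⌊y⌋ + 1)
  refine (Set.ordConnected_Ioo.isPreconnected).intermediate_value hu hv
    (H.continuousOn_fatou hxs) ⟨?_, ?_⟩
  · rw [eu]; exact Int.floor_le y
  · rw [ev]; push_cast; exact (Int.lt_floor_add_one y).le

/-- A map commuting with `h` acts as a translation in the Fatou coordinate. -/
lemma exists_fatou_map_eq (H : Attracting h α β ω σ) {xs : ℝ} (hxs : xs ∈ Set.Ioo α β) {g : ℝ → ℝ}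
    (hg : ContDiff ℝ 1 g) (hcomm : ∀ x, g (h x) = h (g x))
    (hmap : ∀ x ∈ Set.Ioo α β, g x ∈ Set.Ioo α β) :
    ∃ τ, ∀ x ∈ Set.Ioo α β, fatou h xs (g x) = fatou h xs x + τ := by
  have hs := hg.contDiffAt.hasStrictDerivAt (x := ω) (by simp)
  have hσ : σ ≠ 0 := fun e => by have := H.sigma_sq; simp [e] at this
  have e1 := H.fatou_map_sub hxs hs hcomm hmap (H.apply_mem hxs) hxs
  rw [hcomm, H.fatou_apply hxs (hmap xs hxs), H.fatou_apply hxs hxs] at e1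
  have hγ : deriv g ω = 1 := by
    have : σ = deriv g ω * σ := by linarith
    exact mul_right_cancel₀ hσ (by linarith)
  refine ⟨fatou h xs (g xs) - fatou h xs xs, fun x hx => ?_⟩
  have := H.fatou_map_sub hxs hs hcomm hmap hx hxs
  rw [hγ] at this
  linarith

lemma exists_deriv_pow_lt (H : Attracting h α β ω σ) {lo hi : ℝ} (hlo : lo ∈ Set.Ioo α β)
    (hhi : hi ∈ Set.Ioo α β) {θ : ℝ} (hθ : 0 < θ) :
    ∃ l : ℕ, ∀ x ∈ Set.Icc lo hi, deriv (h ^ l : SmoothLift) x < θ := by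
  obtain ⟨lo', hlo', hi', hhi', m1, m2, m3, m4⟩ := H.exists_Icc hlo hlo hhi
  obtain ⟨D, hD, hDb⟩ := H.distortion hlo' hhi'
  have hΔ : 0 < |h lo - lo| := by simpa using H.denom_pos hlo 0
  have t : Tendsto (fun n : ℕ => |(h ^ (n + 1)) lo - (h ^ n) lo|) atTop (𝓝 0) := by
    have h1 := H.tendsto lo hlo
    simpa using ((h1.comp (tendsto_add_atTop_nat 1)).sub h1).abs
  obtain ⟨l, hl⟩ := (t.eventually (gt_mem_nhds (by positivity : 0 < θ / D * |h lo - lo|))).exists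
  refine ⟨l, fun x hx => ?_⟩
  obtain ⟨ζ, hζ, e2⟩ := exists_mul_abs_sub (h ^ l) m2 m1
  rw [pow_succ, mul_apply, e2] at hl
  have h3 := lt_of_mul_lt_mul_right hl hΔ.le
  refine (hDb l x ⟨m3.1.trans hx.1, hx.2.trans m4.2⟩ ζ hζ).trans_lt ?_
  rw [lt_div_iff₀ hD] at h3
  linarith

end Attracting

end SmoothLift

/-! ### Parabolic lifts -/

namespace SmoothLift

lemma zpow_apply_eq_self {h : SmoothLift} {x : ℝ} (hx : h x = x) (n : ℤ) : (h ^ n) x = x := by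
  have hi : h⁻¹ x = x := by rw [← h.injective.eq_iff, apply_inv_apply, hx]
  induction n with
  | zero => simp
  | succ n ih => rw [zpow_add_one, mul_apply, hx, ih]
  | pred n ih => rw [zpow_sub_one, mul_apply, hi, ih]

lemma apply_comm_zpow {g : ℝ → ℝ} {h : SmoothLift} (hc : ∀ x, g (h x) = h (g x)) (n : ℤ) (x : ℝ) :
    g ((h ^ n) x) = (h ^ n) (g x) := by
  have hi : ∀ x, g (h⁻¹ x) = h⁻¹ (g x) := fun x => by
    rw [← h.injective.eq_iff, apply_inv_apply, ← hc, apply_inv_apply]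
  induction n generalizing x with
  | zero => simp
  | succ n ih => rw [zpow_add_one, mul_apply, mul_apply, ih, hc]
  | pred n ih => rw [zpow_sub_one, mul_apply, mul_apply, ih, hi]

lemma apply_comm_lat {g : ℝ → ℝ} {f : SmoothLift} (hc : ∀ x, g (f x) = f (g x))
    (h1 : ∀ x, g (x + 1) = g x + 1) (i j : ℤ) (x : ℝ) : g (f.lat i j x) = f.lat i j (g x) := by
  have ht : ∀ x, g (tr 1 x) = tr 1 (g x) := fun x => by simpa using h1 x
  have := apply_comm_zpow ht j x
  rw [tr_one_zpow] at this
  rw [lat, mul_apply, mul_apply, apply_comm_zpow hc, this]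

lemma lat_eq_zpow_mul_zpow (f : SmoothLift) {q p a b : ℤ} (hb : a * p + b * q = 1) (i j : ℤ) :
    f.lat i j = f.lat q (-p) ^ (b * i - a * j) * f.lat a b ^ (i * p + j * q) := by
  rw [lat_zpow, lat_zpow, ← lat_add]
  congr 1
  · linear_combination (-i) * hb
  · linear_combination (-j) * hb

lemma lat_apply_of_fixed {f : SmoothLift} {q p a b : ℤ} (hb : a * p + b * q = 1) {x : ℝ}
    (hx : f.lat q (-p) x = x) (i j : ℤ) : f.lat i j x = (f.lat a b ^ (i * p + j * q)) x := by
  rw [f.lat_eq_zpow_mul_zpow hb i j, (((f.lat_commute _ _ _ _).zpow_left _).zpow_right _).eq,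
    mul_apply, zpow_apply_eq_self hx]

lemma zpow_apply_fixed {f : SmoothLift} {q p a b : ℤ} {x : ℝ}
    (hx : f.lat q (-p) x = x) (w : ℤ) : f.lat q (-p) ((f.lat a b ^ w) x) = (f.lat a b ^ w) x := by
  rw [← mul_apply, ((f.lat_commute _ _ _ _).zpow_right _).eq, mul_apply, hx]

lemma zpow_mul_apply_fixed {f : SmoothLift} {q p a b : ℤ} (hb : a * p + b * q = 1) {x : ℝ}
    (hx : f.lat q (-p) x = x) (k : ℤ) : (f.lat a b ^ (q * k)) x = x + k := by
  have := lat_apply_of_fixed hb hx 0 k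
  rw [lat_zero_left, tr_apply] at this
  rw [this]
  congr 2
  ring

lemma pow_apply_le {h : SmoothLift} {x : ℝ} (hx : h x ≤ x) (n : ℕ) : (h ^ n) x ≤ x := by
  induction n with
  | zero => simp
  | succ n ih => rw [pow_succ, mul_apply]; exact ((h ^ n).monotone hx).trans ih

lemma lt_apply_of_fixed {f : SmoothLift} {q : ℕ} {p a b : ℤ} (hb : a * p + b * q = 1)
    {x : ℝ} (hx : f.lat q (-p) x = x) : x < f.lat a b x := by
  by_contra! hcon
  have h1 := pow_apply_le hcon q
  have h2 := zpow_mul_apply_fixed hb hx 1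
  rw [mul_one, zpow_natCast] at h2
  rw [h2] at h1
  norm_num at h1

lemma strictMono_zpow_apply {f : SmoothLift} {q : ℕ} {p a b : ℤ} (hb : a * p + b * q = 1)
    {x : ℝ} (hx : f.lat q (-p) x = x) : StrictMono fun w : ℤ => (f.lat a b ^ w) x := by
  refine strictMono_int_of_lt_succ fun w => ?_
  rw [zpow_add_one, mul_apply]
  exact (f.lat a b ^ w).strictMono (lt_apply_of_fixed hb hx)

lemma exists_zpow_mem_Ico {f : SmoothLift} {q : ℕ} {p a b : ℤ}
    (hb : a * p + b * q = 1) {x₀ : ℝ} (hx : f.lat q (-p) x₀ = x₀) (x : ℝ) :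
    ∃ w : ℤ, x ∈ Set.Ico ((f.lat a b ^ w) x₀) ((f.lat a b ^ (w + 1)) x₀) := by
  have hm := strictMono_zpow_apply hb hx
  obtain ⟨k, hk⟩ := exists_int_gt (x - x₀)
  obtain ⟨l, hl⟩ := exists_int_lt (x - x₀)
  obtain ⟨w, hw1, hw2⟩ := Int.exists_greatest_of_bdd
    (P := fun w : ℤ => (f.lat a b ^ w) x₀ ≤ x) ⟨q * k, fun w hw => by
      refine (hm.lt_iff_lt.1 (hw.trans_lt (?_ : x < (f.lat a b ^ (q * k : ℤ)) x₀))).le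
      rw [zpow_mul_apply_fixed hb hx]; linarith⟩ ⟨q * l, by
      rw [zpow_mul_apply_fixed hb hx]; linarith⟩
  refine ⟨w, hw1, ?_⟩
  by_contra! h
  have := hw2 _ h
  omega

lemma deriv_eq_of_le {f g : SmoothLift} (hle : ∀ x, f x ≤ g x) {x : ℝ} (hx : g x = f x) :
    deriv g x = deriv f x := by
  have hm : IsLocalMin (fun y => g y - f y) x := Eventually.of_forall fun y => by
    change g x - f x ≤ g y - f y
    rw [hx, sub_self]; linarith [hle y]
  have := hm.hasDerivAt_eq_zero ((g.hasDerivAt x).sub (f.hasDerivAt x))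
  linarith

lemma deriv_eq_one_of_le {h : SmoothLift} (hle : ∀ x, x ≤ h x) {x : ℝ} (hx : h x = x) :
    deriv h x = 1 := by
  have := deriv_eq_of_le (f := 1) (g := h) (by simpa using hle) (by simpa using hx)
  rw [this, deriv_one]

lemma pow_le_pow {f g : SmoothLift} (hle : ∀ x, f x ≤ g x) (n : ℕ) (x : ℝ) :
    (f ^ n) x ≤ (g ^ n) x := by
  induction n with
  | zero => simp
  | succ n ih =>
    rw [pow_succ', pow_succ', mul_apply, mul_apply]
    exact (f.monotone ih).trans (hle _)

lemma lat_apply_nat (f : SmoothLift) (n : ℕ) (j : ℤ) (x : ℝ) : f.lat n j x = (f ^ n) x + j := by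
  rw [lat_nat_apply, pow_apply]

lemma lat_le_lat {f g : SmoothLift} (hle : ∀ x, f x ≤ g x) (n : ℕ) (j : ℤ) (x : ℝ) :
    f.lat n j x ≤ g.lat n j x := by
  rw [lat_apply_nat, lat_apply_nat]
  linarith [pow_le_pow hle n x]

lemma lat_lt_lat {f g : SmoothLift} (hle : ∀ x, f x ≤ g x) {n : ℕ} (hn : 0 < n) (j : ℤ) {x : ℝ}
    (hx : f x < g x) : f.lat n j x < g.lat n j x := by
  obtain ⟨m, rfl⟩ := Nat.exists_eq_succ_of_ne_zero hn.ne'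
  rw [lat_apply_nat, lat_apply_nat, pow_succ, pow_succ, mul_apply, mul_apply]
  have := (f ^ m).strictMono hx
  linarith [pow_le_pow hle m (g x)]

lemma lat_apply_eq_of_eq {f g : SmoothLift} {x : ℝ}
    (h : ∀ i j : ℤ, g (f.lat i j x) = f (f.lat i j x)) (i j : ℤ) : g.lat i j x = f.lat i j x := by
  have hs (i : ℤ) : f.lat (i + 1) j x = f (f.lat i j x) := by
    have := f.lat_add 1 0 i j
    rw [lat_one_zero, zero_add, add_comm] at this
    rw [this, mul_apply]
  have hs' (i : ℤ) : g.lat (i + 1) j x = g (g.lat i j x) := by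
    have := g.lat_add 1 0 i j
    rw [lat_one_zero, zero_add, add_comm] at this
    rw [this, mul_apply]
  induction i with
  | zero => rw [lat_zero_left, lat_zero_left]
  | succ i ih => rw [hs, hs', ih, h]
  | pred i ih =>
    have e1 := hs (-i - 1)
    have e2 := hs' (-i - 1)
    rw [sub_add_cancel] at e1 e2
    rw [← g.injective.eq_iff, ← e2, ih, h, e1]

lemma parab_of_le {f g : SmoothLift} {q : ℕ} {p a b : ℤ} {x₀ : ℝ} (hq : 0 < q)
    (hb : a * p + b * q = 1) (hF : ∀ x, x ≤ f.lat q (-p) x) (hx : f.lat q (-p) x₀ = x₀)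
    (hle : ∀ x, f x ≤ g x)
    (heq : ∀ w : ℤ, g ((f.lat a b ^ w) x₀) = f ((f.lat a b ^ w) x₀))
    (hfix : ∀ x, f.lat q (-p) x = x → g x = f x → ∃ w : ℤ, x = (f.lat a b ^ w) x₀) :
    Parab g q p a b x₀ ∧ ∀ i j : ℤ, g.lat i j x₀ = f.lat i j x₀ := by
  have hlat : ∀ i j : ℤ, g.lat i j x₀ = f.lat i j x₀ := by
    refine lat_apply_eq_of_eq fun i j => ?_
    rw [lat_apply_of_fixed hb hx]
    exact heq _
  refine ⟨⟨hq, hb, fun x => (hF x).trans (lat_le_lat hle q _ x), fun x => ⟨fun h => ?_, ?_⟩⟩, hlat⟩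
  · have h1 : f.lat q (-p) x = x :=
      le_antisymm ((lat_le_lat hle q _ x).trans h.le) (hF x)
    have h2 : g x = f x := by
      refine (hle x).eq_or_lt.resolve_right (fun hlt => ?_) |>.symm
      have := lat_lt_lat hle hq (-p) hlt
      rw [h1, h] at this
      exact lt_irrefl _ this
    obtain ⟨w, hw⟩ := hfix x h1 h2
    refine ⟨w, ?_⟩
    rw [lat_zpow, hlat, ← lat_zpow]
    exact hw
  · rintro ⟨w, rfl⟩
    exact zpow_apply_fixed ((hlat _ _).trans hx) w

namespace Parab

variable {f : SmoothLift} {q : ℕ} {p a b : ℤ} {x₀ : ℝ}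

lemma fix_base (H : Parab f q p a b x₀) : f.lat q (-p) x₀ = x₀ :=
  (H.fix_iff x₀).2 ⟨0, by simp⟩

lemma fix_zpow (H : Parab f q p a b x₀) (w : ℤ) :
    f.lat q (-p) ((f.lat a b ^ w) x₀) = (f.lat a b ^ w) x₀ := (H.fix_iff _).2 ⟨w, rfl⟩

lemma fix_right (H : Parab f q p a b x₀) : f.lat q (-p) (f.lat a b x₀) = f.lat a b x₀ := by
  simpa using H.fix_zpow 1

lemma strictMono (H : Parab f q p a b x₀) : StrictMono fun w : ℤ => (f.lat a b ^ w) x₀ :=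
  strictMono_zpow_apply H.bezout H.fix_base

lemma base_lt (H : Parab f q p a b x₀) : x₀ < f.lat a b x₀ :=
  lt_apply_of_fixed H.bezout H.fix_base

lemma not_mem_cell (H : Parab f q p a b x₀) (v w : ℤ) :
    (f.lat a b ^ v) x₀ ∉ Set.Ioo ((f.lat a b ^ w) x₀) ((f.lat a b ^ (w + 1)) x₀) := by
  rintro ⟨h1, h2⟩
  have := H.strictMono.lt_iff_lt.1 h1
  have := H.strictMono.lt_iff_lt.1 h2
  omega

lemma lt_apply (H : Parab f q p a b x₀) {x : ℝ} (hx : x ∈ Set.Ioo x₀ (f.lat a b x₀)) :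
    x < f.lat q (-p) x := by
  refine (H.le_apply x).lt_of_ne fun h => ?_
  obtain ⟨w, hw⟩ := (H.fix_iff x).1 h.symm
  have := H.not_mem_cell w 0
  simp only [zpow_zero, one_apply, zero_add, zpow_one, ← hw] at this
  exact this hx

lemma attracting (H : Parab f q p a b x₀) :
    Attracting (f.lat q (-p)) x₀ (f.lat a b x₀) (f.lat a b x₀) 1 :=
  attracting_right H.base_lt H.fix_base H.fix_right (fun _ hx => H.lt_apply hx)
    (deriv_eq_one_of_le H.le_apply H.fix_right)

lemma inv_fix {h : SmoothLift} {x : ℝ} (hx : h x = x) : h⁻¹ x = x := by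
  simpa using zpow_apply_eq_self hx (-1)

lemma attracting_inv (H : Parab f q p a b x₀) :
    Attracting (f.lat q (-p))⁻¹ x₀ (f.lat a b x₀) x₀ (-1) := by
  refine attracting_left H.base_lt (inv_fix H.fix_base) (inv_fix H.fix_right) (fun x hx => ?_) ?_
  · rw [← (f.lat q (-p)).strictMono.lt_iff_lt, apply_inv_apply]
    exact H.lt_apply hx
  · rw [deriv_inv, inv_fix H.fix_base, deriv_eq_one_of_le H.le_apply H.fix_base, inv_one]

end Parab

end SmoothLift

/-! ### Trivial centralizers -/

namespace SmoothLift

/-- A common translation in two monotone charts generates, unless it is integral, a rational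
common translation in `[1/3, 2/3]`. -/
lemma exists_rat_shift {α β : ℝ} {P Q : ℝ → ℝ} (hP : StrictMonoOn P (Set.Ioo α β))
    (hQ : StrictMonoOn Q (Set.Ioo α β)) (hPs : Set.SurjOn P (Set.Ioo α β) Set.univ)
    (hQs : Set.SurjOn Q (Set.Ioo α β) Set.univ) {h g : ℝ → ℝ}
    (hm : ∀ x ∈ Set.Ioo α β, h x ∈ Set.Ioo α β) (hP1 : ∀ x ∈ Set.Ioo α β, P (h x) = P x + 1)
    (hQ1 : ∀ x ∈ Set.Ioo α β, Q (h x) = Q x + 1)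
    (gm : ∀ x ∈ Set.Ioo α β, g x ∈ Set.Ioo α β) {τ : ℝ}
    (hPg : ∀ x ∈ Set.Ioo α β, P (g x) = P x + τ) (hQg : ∀ x ∈ Set.Ioo α β, Q (g x) = Q x + τ)
    (hτ : ∀ n : ℤ, τ ≠ n) :
    ∃ r : ℚ, 1 / 3 ≤ (r : ℝ) ∧ (r : ℝ) ≤ 2 / 3 ∧ ∀ x ∈ Set.Ioo α β, ∀ y ∈ Set.Ioo α β,
      P y = P x + r → Q y = Q x + r := by
  choose R hRm hR using fun t => hPs (Set.mem_univ t)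
  have hRP : ∀ x ∈ Set.Ioo α β, R (P x) = x := fun x hx => hP.injOn (hRm _) hx (hR _)
  have hRmono : StrictMono R := fun s t hst => by
    rw [← hP.lt_iff_lt (hRm s) (hRm t), hR, hR]; exact hst
  have hMmono : StrictMono (Q ∘ R) := fun s t hst => hQ (hRm s) (hRm t) (hRmono hst)
  have hMs : Function.Surjective (Q ∘ R) := fun t => by
    obtain ⟨x, hx, hxt⟩ := hQs (Set.mem_univ t)
    exact ⟨P x, by rw [Function.comp_apply, hRP x hx, hxt]⟩
  have hMc : Continuous (Q ∘ R) := hMmono.monotone.continuous_of_surjective hMs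
  let Θ : AddSubgroup ℝ :=
    { carrier := {t | ∀ y, (Q ∘ R) (y + t) = (Q ∘ R) y + t}
      zero_mem' := fun y => by simp
      add_mem' := fun {s t} hs ht y => by rw [← add_assoc, ht, hs, add_assoc]
      neg_mem' := fun {t} ht y => by
        have := ht (y + -t)
        rw [neg_add_cancel_right] at this
        linarith }
  have hmem {h : ℝ → ℝ} {t : ℝ} (hm : ∀ x ∈ Set.Ioo α β, h x ∈ Set.Ioo α β)
      (h1 : ∀ x ∈ Set.Ioo α β, P (h x) = P x + t) (h2 : ∀ x ∈ Set.Ioo α β, Q (h x) = Q x + t) :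
      t ∈ Θ := fun y => by
    have e : R (y + t) = h (R y) := by
      rw [← hRP (h (R y)) (hm _ (hRm _)), h1 _ (hRm _), hR]
    rw [Function.comp_apply, e, h2 _ (hRm _), Function.comp_apply]
  have h1 : (1 : ℝ) ∈ Θ := hmem hm hP1 hQ1
  have hτΘ : τ ∈ Θ := hmem gm hPg hQg
  suffices hs : ∃ r : ℚ, 1 / 3 ≤ (r : ℝ) ∧ (r : ℝ) ≤ 2 / 3 ∧ (r : ℝ) ∈ Θ by
    obtain ⟨r, hr1, hr2, hr⟩ := hs
    refine ⟨r, hr1, hr2, fun x hx y hy hxy => ?_⟩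
    have := hr (P x)
    rwa [← hxy, Function.comp_apply, Function.comp_apply, hRP x hx, hRP y hy] at this
  rcases AddSubgroup.dense_or_cyclic Θ with hd | ⟨d, hd⟩
  · have hcl : IsClosed (Θ : Set ℝ) := by
      have : (Θ : Set ℝ) = ⋂ y, {t | (Q ∘ R) (y + t) = (Q ∘ R) y + t} := by
        ext t; simp only [Set.mem_iInter]; rfl
      rw [this]
      exact isClosed_iInter fun y => isClosed_eq
        (hMc.comp (continuous_const.add continuous_id)) (continuous_const.add continuous_id)
    have htop : (Θ : Set ℝ) = Set.univ := by rw [← hcl.closure_eq, hd.closure_eq]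
    refine ⟨1 / 2, by norm_num, by norm_num, ?_⟩
    rw [← SetLike.mem_coe, htop]
    trivial
  · rw [← AddSubgroup.zmultiples_eq_closure] at hd
    rw [hd] at h1 hτΘ
    obtain ⟨n, hn⟩ := AddSubgroup.mem_zmultiples_iff.1 h1
    obtain ⟨m, hm⟩ := AddSubgroup.mem_zmultiples_iff.1 hτΘ
    simp only [zsmul_eq_mul] at hn hm
    have hn0 : n ≠ 0 := by rintro rfl; simp at hn
    have hn1 : n.natAbs ≠ 1 := by
      intro h
      obtain rfl | rfl : n = 1 ∨ n = -1 := by omega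
      · exact hτ m (by rw [← hm]; simp at hn; simp [hn])
      · refine hτ (-m) (by rw [← hm]; push_cast at hn ⊢; linear_combination (-m) * hn)
    have hd' : ((n.natAbs : ℝ))⁻¹ ∈ Θ := by
      rw [hd, AddSubgroup.mem_zmultiples_iff]
      have hn0' : (n : ℝ) ≠ 0 := by exact_mod_cast hn0
      refine ⟨n.sign, ?_⟩
      have e1 : d = (n : ℝ)⁻¹ := eq_inv_of_mul_eq_one_right hn
      have e2 : ((n.natAbs : ℕ) : ℝ) = n * n.sign := by
        rw [Nat.cast_natAbs]
        exact_mod_cast (by rw [mul_comm, Int.sign_mul_self_eq_abs] : |n| = n * n.sign)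
      have e3 : (n.sign : ℝ) * n.sign = 1 := by
        rcases lt_or_gt_of_ne hn0 with h | h
        · simp [Int.sign_eq_neg_one_of_neg h]
        · simp [Int.sign_eq_one_of_pos h]
      have e4 : (n.sign : ℝ) ≠ 0 := left_ne_zero_of_mul_eq_one e3
      rw [zsmul_eq_mul, e1, e2]
      field_simp
      linear_combination e3
    have hN : 2 ≤ n.natAbs := by omega
    generalize n.natAbs = N at hd' hN
    have hN0 : (0 : ℝ) < N := by exact_mod_cast (by omega : 0 < N)
    refine ⟨(((N + 2) / 3 : ℕ) : ℚ) / N, ?_, ?_, ?_⟩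
    · push_cast
      rw [div_le_div_iff₀ (by norm_num) hN0, one_mul]
      exact_mod_cast (by omega : N ≤ (N + 2) / 3 * 3)
    · push_cast
      rw [div_le_div_iff₀ hN0 (by norm_num)]
      exact_mod_cast (by omega : (N + 2) / 3 * 3 ≤ 2 * N)
    · have := Θ.nsmul_mem hd' ((N + 2) / 3)
      push_cast
      rwa [nsmul_eq_mul, ← div_eq_mul_inv] at this

lemma eq_of_forall_abs_mul_sub_le {s t : ℝ} (h : ∀ n : ℕ, |n * s - n * t| ≤ 1) : s = t := by
  by_contra hne
  have h0 : 0 < |s - t| := abs_pos.2 (sub_ne_zero.2 hne)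
  obtain ⟨n, hn⟩ := exists_nat_gt (1 / |s - t|)
  have := h n
  rw [← mul_sub, abs_mul, Nat.abs_cast] at this
  rw [div_lt_iff₀ h0] at hn
  linarith

namespace Parab

variable {f : SmoothLift} {q : ℕ} {p a b : ℤ} {x₀ : ℝ}

lemma fatou_inv_zpow (H : Parab f q p a b x₀) {c x : ℝ}
    (hc : c ∈ Set.Ioo x₀ (f.lat a b x₀)) (hx : x ∈ Set.Ioo x₀ (f.lat a b x₀)) (n : ℤ) :
    fatou (f.lat q (-p))⁻¹ c ((f.lat q (-p) ^ n) x) = fatou (f.lat q (-p))⁻¹ c x + n := by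
  have := H.attracting_inv.fatou_zpow hc hx (-n)
  rw [inv_zpow', neg_neg] at this
  rw [this]
  push_cast
  ring

lemma fatou_zpow (H : Parab f q p a b x₀) {c x : ℝ}
    (hc : c ∈ Set.Ioo x₀ (f.lat a b x₀)) (hx : x ∈ Set.Ioo x₀ (f.lat a b x₀)) (n : ℤ) :
    fatou (f.lat q (-p)) c ((f.lat q (-p) ^ n) x) = fatou (f.lat q (-p)) c x + n := by
  rw [H.attracting.fatou_zpow hc hx, mul_one]

lemma exists_rat_of_not_trivC1 (H : Parab f q p a b x₀) (hf : ¬ TrivC1 f) {c c' : ℝ}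
    (hc : c ∈ Set.Ioo x₀ (f.lat a b x₀)) (hc' : c' ∈ Set.Ioo x₀ (f.lat a b x₀)) :
    ∃ r : ℚ, 1 / 3 ≤ (r : ℝ) ∧ (r : ℝ) ≤ 2 / 3 ∧ ∀ x ∈ Set.Ioo x₀ (f.lat a b x₀),
      ∀ y ∈ Set.Ioo x₀ (f.lat a b x₀),
      fatou (f.lat q (-p))⁻¹ c y = fatou (f.lat q (-p))⁻¹ c x + r →
      fatou (f.lat q (-p)) c' y = fatou (f.lat q (-p)) c' x + r := by
  simp only [TrivC1, not_forall, not_exists] at hf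
  obtain ⟨g, hg, hgpos, hg1, hgf, hgne⟩ := hf
  have hcomm := apply_comm_lat hgf hg1
  obtain ⟨w, hw⟩ := (H.fix_iff (g x₀)).1 (by rw [← hcomm, H.fix_base])
  set e := f.lat q (-p) with he
  set s := f.lat a b with hs
  let g₁ : ℝ → ℝ := fun x => (s ^ (-w)) (g x)
  have hg₁c : ContDiff ℝ 1 g₁ := ((s ^ (-w)).contDiff_nat 1).comp hg
  have hes : ∀ (w : ℤ) (x : ℝ), e ((s ^ w) x) = (s ^ w) (e x) := fun w x => by
    rw [← mul_apply, ((f.lat_commute _ _ _ _).zpow_right _).eq, mul_apply]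
  have hg₁e : ∀ x, g₁ (e x) = e (g₁ x) := fun x => by
    change (s ^ (-w)) (g (e x)) = e ((s ^ (-w)) (g x))
    rw [hcomm, hes]
  have hg₁s : ∀ x, g₁ (s x) = s (g₁ x) := fun x => by
    change (s ^ (-w)) (g (s x)) = s ((s ^ (-w)) (g x))
    rw [hcomm, ← mul_apply, ← mul_apply, ((Commute.refl s).zpow_left _).eq]
  have hg₁0 : g₁ x₀ = x₀ := by
    change (s ^ (-w)) (g x₀) = x₀
    rw [hw, ← mul_apply, ← zpow_add, neg_add_cancel, zpow_zero, one_apply]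
  have hg₁m : StrictMono g₁ := (s ^ (-w)).strictMono.comp (strictMono_of_deriv_pos hgpos)
  have gm : ∀ x ∈ Set.Ioo x₀ (s x₀), g₁ x ∈ Set.Ioo x₀ (s x₀) := fun x hx => by
    have h1 := hg₁m hx.1
    have h2 := hg₁m hx.2
    rw [hg₁s, hg₁0] at h2
    rw [hg₁0] at h1
    exact ⟨h1, h2⟩
  obtain ⟨τ, hτ⟩ := H.attracting_inv.exists_fatou_map_eq hc hg₁c (fun x => by
    rw [← e.injective.eq_iff, apply_inv_apply, ← hg₁e, apply_inv_apply]) gm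
  obtain ⟨τ', hτ'⟩ := H.attracting.exists_fatou_map_eq hc' hg₁c hg₁e gm
  have hPm := H.attracting_inv.strictMonoOn_fatou hc
  have hQm := H.attracting.strictMonoOn_fatou hc'
  have hit (n : ℕ) : g₁^[n] c ∈ Set.Ioo x₀ (s x₀) ∧
      fatou e⁻¹ c (g₁^[n] c) = fatou e⁻¹ c c + n * τ ∧
      fatou e c' (g₁^[n] c) = fatou e c' c + n * τ' := by
    induction n with
    | zero => simpa using hc
    | succ n ih =>
      obtain ⟨i1, i2, i3⟩ := ih
      rw [Function.iterate_succ_apply']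
      refine ⟨gm _ i1, ?_, ?_⟩
      · rw [hτ _ i1, i2]; push_cast; ring
      · rw [hτ' _ i1, i3]; push_cast; ring
  have hττ : τ = τ' := by
    refine eq_of_forall_abs_mul_sub_le fun n => ?_
    obtain ⟨i1, i2, i3⟩ := hit n
    have l1 : (e ^ ⌊n * τ⌋) c ≤ g₁^[n] c := by
      rw [← hPm.le_iff_le (H.attracting.zpow_mem _ hc) i1, i2, H.fatou_inv_zpow hc hc]
      linarith [Int.floor_le (n * τ)]
    have l2 : g₁^[n] c ≤ (e ^ (⌊n * τ⌋ + 1)) c := by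
      rw [← hPm.le_iff_le i1 (H.attracting.zpow_mem _ hc), i2, H.fatou_inv_zpow hc hc]
      push_cast
      linarith [Int.lt_floor_add_one (n * τ)]
    rw [← hQm.le_iff_le (H.attracting.zpow_mem _ hc) i1, i3, H.fatou_zpow hc' hc] at l1
    rw [← hQm.le_iff_le i1 (H.attracting.zpow_mem _ hc), i3, H.fatou_zpow hc' hc] at l2
    push_cast at l2
    rw [abs_le]
    constructor <;> linarith [Int.floor_le (n * τ), Int.lt_floor_add_one (n * τ)]
  subst hττ
  refine exists_rat_shift hPm hQm (H.attracting_inv.surjOn_fatou hc)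
    (H.attracting.surjOn_fatou hc') (h := e) (fun x hx => H.attracting.apply_mem hx)
    (fun x hx => by simpa using H.fatou_inv_zpow hc hx 1)
    (fun x hx => by simpa using H.fatou_zpow hc' hx 1) gm hτ hτ' fun m hm => ?_
  have hcell : ∀ x ∈ Set.Ico x₀ (s x₀), g₁ x = (e ^ m) x := fun x hx => by
    rcases hx.1.eq_or_lt with rfl | hlt
    · rw [hg₁0, zpow_apply_eq_self H.fix_base]
    · have hx' : x ∈ Set.Ioo x₀ (s x₀) := ⟨hlt, hx.2⟩
      refine hPm.injOn (gm x hx') (H.attracting.zpow_mem _ hx') ?_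
      rw [hτ x hx', H.fatou_inv_zpow hc hx', hm]
  have hall : ∀ x, g₁ x = (e ^ m) x := fun x => by
    obtain ⟨v, hv1, hv2⟩ := exists_zpow_mem_Ico H.bezout H.fix_base x
    have hmem : (s ^ (-v)) x ∈ Set.Ico x₀ (s x₀) := by
      constructor
      · rw [← (s ^ v).strictMono.le_iff_le, ← mul_apply, ← zpow_add, add_neg_cancel, zpow_zero,
          one_apply]
        exact hv1
      · rw [← (s ^ v).strictMono.lt_iff_lt, ← mul_apply, ← mul_apply, ← zpow_add, add_neg_cancel,
          zpow_zero, one_apply, ← zpow_add_one]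
        exact hv2
    have hx : x = (s ^ v) ((s ^ (-v)) x) := by
      rw [← mul_apply, ← zpow_add, add_neg_cancel, zpow_zero, one_apply]
    rw [hx, apply_comm_zpow hg₁s, hcell _ hmem]
    generalize (s ^ (-v)) x = y
    rw [← mul_apply, ← mul_apply, (((f.lat_commute _ _ _ _).zpow_left _).zpow_right _).eq]
  obtain ⟨x, hx⟩ := hgne (w * a + m * q) (w * b + m * (-p))
  refine hx ?_
  have : g x = (s ^ w) (g₁ x) := by
    change g x = (s ^ w) ((s ^ (-w)) (g x))
    rw [← mul_apply, ← zpow_add, add_neg_cancel, zpow_zero, one_apply]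
  rw [this, hall, ← mul_apply, he, hs, lat_zpow, lat_zpow, ← lat_add]

end Parab

end SmoothLift

/-! ### Perturbations supported in a fundamental domain -/

lemma exists_scale {ψ : ℝ → ℝ} (h1 : ContDiff ℝ (⊤ : ℕ∞) ψ) (h2 : Function.Periodic ψ 1) (r : ℕ)
    {δ : ℝ} (hδ : 0 < δ) : ∃ τ₀, 0 < τ₀ ∧ ∀ τ, |τ| ≤ τ₀ → ∀ k ≤ r, ∀ x,
      |iteratedDeriv k (fun x => τ * ψ x) x| ≤ δ := by
  have hb (k : ℕ) : ∃ C, 0 < C ∧ ∀ x, |iteratedDeriv k ψ x| ≤ C :=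
    exists_forall_abs_le_of_periodic
      (h1.continuous_iteratedDeriv k (by exact_mod_cast le_top)) (periodic_iteratedDeriv h2 k)
  choose C hCpos hC using hb
  have hS : 0 ≤ ∑ k ∈ Finset.range (r + 1), C k := Finset.sum_nonneg fun k _ => (hCpos k).le
  refine ⟨δ / (∑ k ∈ Finset.range (r + 1), C k + 1), by positivity, fun τ hτ k hk x => ?_⟩
  rw [iteratedDeriv_const_mul_field, abs_mul]
  have hk' : C k ≤ ∑ k ∈ Finset.range (r + 1), C k :=
    Finset.single_le_sum (fun k _ => (hCpos k).le) (Finset.mem_range.2 (Nat.lt_succ_of_le hk))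
  rw [le_div_iff₀ (by positivity)] at hτ
  calc |τ| * |iteratedDeriv k ψ x| ≤ |τ| * (∑ k ∈ Finset.range (r + 1), C k + 1) := by
        gcongr
        linarith [hC k x]
    _ ≤ δ := hτ

namespace SmoothLift

lemma exists_smul_perturbation (f : SmoothLift) {V : Set SmoothLift} (hV : V ∈ 𝓝 f) {ψ : ℝ → ℝ}
    (h1 : ContDiff ℝ (⊤ : ℕ∞) ψ) (h2 : Function.Periodic ψ 1) :
    ∃ τ₀, 0 < τ₀ ∧ ∀ τ, |τ| ≤ τ₀ → ∃ g ∈ V, ∀ x, g x = f x + τ * ψ x := by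
  obtain ⟨r, δ, hδ, h⟩ := f.exists_perturbation_bound hV
  obtain ⟨τ₀, hτ₀, hτ⟩ := exists_scale h1 h2 r hδ
  exact ⟨τ₀, hτ₀, fun τ ht => h _ (contDiff_const.mul h1) (fun x => by simp only [h2 x])
    (hτ τ ht)⟩

/-- A smooth periodic bump function supported near the integers. -/
noncomputable def bump (ε u : ℝ) : ℝ :=
  expNegInvGlue (Real.cos (2 * Real.pi * u) - Real.cos (2 * Real.pi * ε))

lemma contDiff_bump (ε : ℝ) : ContDiff ℝ (⊤ : ℕ∞) (bump ε) :=
  expNegInvGlue.contDiff.comp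
    ((Real.contDiff_cos.comp (contDiff_const.mul contDiff_id)).sub contDiff_const)

lemma periodic_bump (ε : ℝ) : Function.Periodic (bump ε) 1 := fun u => by
  rw [bump, mul_add, mul_one, Real.cos_add_two_pi, bump]

lemma bump_nonneg (ε u : ℝ) : 0 ≤ bump ε u := expNegInvGlue.nonneg _

lemma bump_zero_pos {ε : ℝ} (h0 : 0 < ε) (h1 : ε ≤ 1 / 2) : 0 < bump ε 0 := by
  refine expNegInvGlue.pos_of_pos ?_
  have := Real.cos_lt_cos_of_nonneg_of_le_pi (x := 0) (y := 2 * Real.pi * ε) le_rfl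
    (by nlinarith [Real.pi_pos]) (by have := Real.pi_pos; positivity)
  rw [mul_zero]
  linarith

lemma exists_abs_sub_lt_of_bump_ne {ε u : ℝ} (h0 : 0 < ε) (h1 : ε ≤ 1 / 2)
    (h : bump ε u ≠ 0) : ∃ k : ℤ, |u - k| < ε := by
  refine ⟨round u, ?_⟩
  by_contra! hcon
  refine h (expNegInvGlue.zero_of_nonpos ?_)
  have hr := abs_sub_round u
  have hpi := Real.pi_pos
  have e : Real.cos (2 * Real.pi * u) = Real.cos (2 * Real.pi * |u - round u|) := by
    rw [← Real.cos_abs (2 * Real.pi * |u - round u|), abs_mul, abs_abs, ← abs_mul, Real.cos_abs,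
      mul_sub, mul_comm (2 * Real.pi) (round u : ℝ), Real.cos_sub_int_mul_two_pi]
  rw [e, sub_nonpos]
  exact Real.cos_le_cos_of_nonneg_of_le_pi (by positivity) (by nlinarith) (by gcongr)

lemma pow_apply_eq_of_eqOn {h h' : SmoothLift} {A : Set ℝ} (hA : ∀ x ∈ A, h x ∈ A)
    (heq : ∀ x ∈ A, h' x = h x) (n : ℕ) {x : ℝ} (hx : x ∈ A) : (h' ^ n) x = (h ^ n) x := by
  induction n generalizing x with
  | zero => simp
  | succ n ih => rw [pow_succ, pow_succ, mul_apply, mul_apply, heq x hx, ih (hA x hx)]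

namespace Parab

variable {f : SmoothLift} {q : ℕ} {p a b : ℤ} {x₀ : ℝ}

lemma eq_of_mem_cells (H : Parab f q p a b x₀) {v w : ℤ} {x : ℝ}
    (h1 : x ∈ Set.Ioo ((f.lat a b ^ v) x₀) ((f.lat a b ^ (v + 1)) x₀))
    (h2 : x ∈ Set.Ioo ((f.lat a b ^ w) x₀) ((f.lat a b ^ (w + 1)) x₀)) : v = w := by
  have := H.strictMono.lt_iff_lt.1 (h1.1.trans h2.2)
  have := H.strictMono.lt_iff_lt.1 (h2.1.trans h1.2)
  omega

lemma mem_cell_of_sub (H : Parab f q p a b x₀) {x : ℝ} {k : ℤ}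
    (h : x - k ∈ Set.Ioo x₀ (f.lat a b x₀)) :
    x ∈ Set.Ioo ((f.lat a b ^ (q * k : ℤ)) x₀) ((f.lat a b ^ (q * k + 1 : ℤ)) x₀) := by
  have e2 : (f.lat a b ^ (q * k + 1 : ℤ)) x₀ = f.lat a b x₀ + k := by
    have := zpow_mul_apply_fixed H.bezout H.fix_base k
    rw [add_comm, zpow_add, zpow_one, mul_apply, this, map_add_int]
  rw [e2, zpow_mul_apply_fixed H.bezout H.fix_base]
  constructor <;> linarith [h.1, h.2]

variable {g : SmoothLift} {lo hi : ℝ}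

lemma parab_of_support (H : Parab f q p a b x₀) (hle : ∀ x, f x ≤ g x)
    (hlh : Set.Ioo lo hi ⊆ Set.Ioo x₀ (f.lat a b x₀))
    (hsupp : ∀ x, g x ≠ f x → ∃ k : ℤ, x - k ∈ Set.Ioo lo hi) :
    Parab g q p a b x₀ ∧ ∀ i j : ℤ, g.lat i j x₀ = f.lat i j x₀ := by
  refine parab_of_le H.q_pos H.bezout H.le_apply H.fix_base hle (fun w => ?_)
    fun x hx _ => (H.fix_iff x).1 hx
  by_contra hne
  obtain ⟨k, hk⟩ := hsupp _ hne
  exact H.not_mem_cell w (q * k) (H.mem_cell_of_sub (hlh hk))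

lemma lat_apply_of_support (H : Parab f q p a b x₀) (hle : ∀ x, f x ≤ g x)
    (hlh : Set.Ioo lo hi ⊆ Set.Ioo x₀ (f.lat a b x₀))
    (hsupp : ∀ x, g x ≠ f x → ∃ k : ℤ, x - k ∈ Set.Ioo lo hi) {x : ℝ}
    (hx : x ∈ Set.Ioo x₀ (f.lat a b x₀)) :
    g.lat q (-p) x = (f ^ (q - 1)) (g x) + (-p : ℤ) := by
  obtain ⟨Hg, hlat⟩ := H.parab_of_support hle hlh hsupp
  have hzs (w : ℤ) : (f.lat a b ^ w) x₀ = (g.lat a b ^ w) x₀ := by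
    rw [lat_zpow, lat_zpow, hlat]
  have hpow (i : ℕ) (hi : i < q) : (g ^ (i + 1)) x = (f ^ i) (g x) := by
    induction i with
    | zero => simp
    | succ i ih =>
      rw [pow_succ', mul_apply, pow_succ' f, mul_apply, ← ih (by omega)]
      by_contra hne
      obtain ⟨k, hk⟩ := hsupp _ hne
      have m1 := H.mem_cell_of_sub (hlh hk)
      have m0 : (g ^ (i + 1)) x₀ = (g.lat a b ^ ((i + 1 : ℕ) * p)) x₀ := by
        have := lat_apply_of_fixed Hg.bezout Hg.fix_base (i + 1 : ℕ) 0
        rwa [lat_apply_nat, Int.cast_zero, add_zero, zero_mul, add_zero] at this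
      have m0' : (g ^ (i + 1)) (g.lat a b x₀) = (g.lat a b ^ ((i + 1 : ℕ) * p + 1)) x₀ := by
        rw [← mul_apply, ← ((g.lat_commute_self a b).pow_right (i + 1)).eq, mul_apply, m0,
          add_comm _ (1 : ℤ), zpow_add, zpow_one, mul_apply]
      have m2 : (g ^ (i + 1)) x ∈ Set.Ioo ((f.lat a b ^ ((i + 1 : ℕ) * p)) x₀)
          ((f.lat a b ^ ((i + 1 : ℕ) * p + 1)) x₀) := by
        rw [hzs, hzs, ← m0, ← m0', hlat]
        exact ⟨(g ^ (i + 1)).strictMono hx.1, (g ^ (i + 1)).strictMono hx.2⟩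
      have hpq := H.eq_of_mem_cells m1 m2
      have hdvd : (q : ℤ) ∣ (i + 1 : ℕ) :=
        ⟨a * k + b * (i + 1 : ℕ), by
          linear_combination (-a) * hpq - ((i + 1 : ℕ) : ℤ) * H.bezout⟩
      have := Nat.le_of_dvd (by omega) (Int.natCast_dvd_natCast.1 hdvd)
      omega
  have := H.q_pos
  rw [lat_apply_nat, ← hpow (q - 1) (by omega), Nat.sub_add_cancel this]

lemma lat_apply_eq_of_support (H : Parab f q p a b x₀) (hle : ∀ x, f x ≤ g x)
    (hlh : Set.Ioo lo hi ⊆ Set.Ioo x₀ (f.lat a b x₀))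
    (hsupp : ∀ x, g x ≠ f x → ∃ k : ℤ, x - k ∈ Set.Ioo lo hi) {x : ℝ}
    (hx : x ∈ Set.Ioo x₀ (f.lat a b x₀)) (hx' : x ∉ Set.Ioo lo hi) :
    g.lat q (-p) x = f.lat q (-p) x := by
  have hgx : g x = f x := by
    by_contra hne
    obtain ⟨k, hk⟩ := hsupp x hne
    have h0 : x ∈ Set.Ioo ((f.lat a b ^ (0 : ℤ)) x₀) ((f.lat a b ^ (0 + 1 : ℤ)) x₀) := by
      simpa using hx
    have := H.eq_of_mem_cells (H.mem_cell_of_sub (hlh hk)) h0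
    have hk0 : k = 0 := by
      rcases mul_eq_zero.1 this with h | h
      · have := H.q_pos; omega
      · exact h
    rw [hk0, Int.cast_zero, sub_zero] at hk
    exact hx' hk
  rw [H.lat_apply_of_support hle hlh hsupp hx, hgx, lat_apply_nat, ← mul_apply, ← pow_succ,
    Nat.sub_add_cancel H.q_pos]

end Parab

end SmoothLift

/-! ### Making the centralizer trivial -/

namespace SmoothLift

namespace Parab

variable {f : SmoothLift} {q : ℕ} {p a b : ℤ} {x₀ : ℝ}

lemma exists_fatou_eq_of_not_trivC1 {g : SmoothLift} {c lo hi b₀ : ℝ} (H : Parab f q p a b x₀)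
    (hle : ∀ x, f x ≤ g x) (hlo : lo ∈ Set.Ioo x₀ (f.lat a b x₀))
    (hhi : hi ∈ Set.Ioo x₀ (f.lat a b x₀)) (hb₀ : b₀ ∈ Set.Ioo x₀ (f.lat a b x₀))
    (hsupp : ∀ x, g x ≠ f x → ∃ k : ℤ, x - k ∈ Set.Ioo lo hi)
    (hc : c ∈ Set.Ioo x₀ (f.lat a b x₀)) (hPlo : 0 ≤ fatou (f.lat q (-p))⁻¹ c lo)
    (hPb : fatou (f.lat q (-p))⁻¹ c b₀ = 1 / 6) (hPhi : fatou (f.lat q (-p))⁻¹ c hi ≤ 1 / 3)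
    (hg : ¬ TrivC1 g) :
    ∃ r : ℚ, ∀ y ∈ Set.Ioo x₀ (f.lat a b x₀), fatou (f.lat q (-p))⁻¹ c y = 1 / 6 + r →
      fatou (f.lat q (-p)) (f.lat q (-p) c) (g.lat q (-p) b₀) =
        fatou (f.lat q (-p)) (f.lat q (-p) c) (f.lat q (-p) y) - r := by
  have hlh : Set.Ioo lo hi ⊆ Set.Ioo x₀ (f.lat a b x₀) := Set.Ioo_subset_Ioo hlo.1.le hhi.2.le
  obtain ⟨Hg, hlat⟩ := H.parab_of_support hle hlh hsupp
  have hoff := fun x hx hx' => H.lat_apply_eq_of_support hle hlh hsupp (x := x) hx hx'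
  set e := f.lat q (-p)
  set e' := g.lat q (-p)
  have hPm := H.attracting_inv.strictMonoOn_fatou hc
  have hP0 : fatou e⁻¹ c c = 0 := H.attracting_inv.fatou_self hc
  have hec : e c ∈ Set.Ioo x₀ (f.lat a b x₀) := H.attracting.apply_mem hc
  have hP1 : fatou e⁻¹ c (e c) = 1 := by
    have := H.fatou_inv_zpow hc hc 1
    rwa [zpow_one, Int.cast_one, hP0, zero_add] at this
  have hclo : c ≤ lo := (hPm.le_iff_le hc hlo).1 (by rw [hP0]; exact hPlo)
  have hhie : hi ≤ e c := (hPm.le_iff_le hhi hec).1 (by rw [hP1]; linarith)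
  have hlow (x : ℝ) (hx : x ∈ Set.Ioo x₀ (f.lat a b x₀) ∩ Set.Iic (e c)) :
      e⁻¹ x ∈ Set.Ioo x₀ (f.lat a b x₀) ∩ Set.Iic (e c) ∧ e'⁻¹ x = e⁻¹ x := by
    have m1 : e⁻¹ x ≤ c := by
      rw [← e.strictMono.le_iff_le, apply_inv_apply]; exact hx.2
    have m2 := H.attracting.inv_apply_mem hx.1
    refine ⟨⟨m2, m1.trans (H.lt_apply hc).le⟩, ?_⟩
    rw [← e'.injective.eq_iff, apply_inv_apply, hoff _ m2 fun h => ?_, apply_inv_apply]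
    linarith [h.1]
  have hhigh (x : ℝ) (hx : x ∈ Set.Ioo x₀ (f.lat a b x₀) ∩ Set.Ici (e c)) :
      e x ∈ Set.Ioo x₀ (f.lat a b x₀) ∩ Set.Ici (e c) ∧ e' x = e x :=
    ⟨⟨H.attracting.apply_mem hx.1, le_trans hx.2 (H.lt_apply hx.1).le⟩,
      hoff x hx.1 fun h => absurd h.2 (not_lt.2 (hhie.trans hx.2))⟩
  have hP {x : ℝ} (hx : x ∈ Set.Ioo x₀ (f.lat a b x₀)) (hxe : x ≤ e c) :
      fatou e'⁻¹ c x = fatou e⁻¹ c x :=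
    fatou_congr (fun n => pow_apply_eq_of_eqOn (fun x hx => (hlow x hx).1)
        (fun x hx => (hlow x hx).2) n ⟨hc, (H.lt_apply hc).le⟩)
      (fun n => pow_apply_eq_of_eqOn (fun x hx => (hlow x hx).1)
        (fun x hx => (hlow x hx).2) n ⟨hx, hxe⟩)
  have hQ {x : ℝ} (hx : x ∈ Set.Ioo x₀ (f.lat a b x₀)) (hxe : e c ≤ x) :
      fatou e' (e c) x = fatou e (e c) x :=
    fatou_congr (fun n => pow_apply_eq_of_eqOn (fun x hx => (hhigh x hx).1)
        (fun x hx => (hhigh x hx).2) n ⟨hec, le_refl (e c)⟩)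
      (fun n => pow_apply_eq_of_eqOn (fun x hx => (hhigh x hx).1)
        (fun x hx => (hhigh x hx).2) n ⟨hx, hxe⟩)
  have hcell : g.lat a b x₀ = f.lat a b x₀ := hlat a b
  obtain ⟨r, hr1, hr2, hr⟩ := Hg.exists_rat_of_not_trivC1 hg (c := c) (c' := e c)
    (by rwa [hcell]) (by rwa [hcell])
  rw [hcell] at hr
  refine ⟨r, fun y hy hyr => ?_⟩
  have hbe : b₀ ≤ e c := (hPm.le_iff_le hb₀ hec).1 (by rw [hP1, hPb]; norm_num)
  have hcb : c ≤ b₀ := (hPm.le_iff_le hc hb₀).1 (by rw [hP0, hPb]; norm_num)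
  have hye : y ≤ e c := (hPm.le_iff_le hy hec).1 (by rw [hP1, hyr]; linarith)
  have hhy : hi ≤ y := (hPm.le_iff_le hhi hy).1 (by rw [hyr]; linarith)
  have hcy : c ≤ y := (hPm.le_iff_le hc hy).1 (by rw [hP0, hyr]; linarith)
  have key := hr b₀ hb₀ y hy (by rw [hP hy hye, hP hb₀ hbe, hPb, hyr])
  have hQs {x : ℝ} (hx : x ∈ Set.Ioo x₀ (f.lat a b x₀)) :
      fatou e' (e c) (e' x) = fatou e' (e c) x + 1 := by
    have := Hg.fatou_zpow (c := e c) (x := x) (by rwa [hcell]) (by rwa [hcell]) 1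
    simpa using this
  have hle' : ∀ x, e x ≤ e' x := lat_le_lat hle q (-p)
  have hb₀' : e' b₀ ∈ Set.Ioo x₀ (f.lat a b x₀) := by
    have := Hg.attracting.apply_mem (x := b₀) (by rwa [hcell])
    rwa [hcell] at this
  have k1 := hQs hb₀
  have k2 := hQs hy
  rw [hQ hb₀' ((e.monotone hcb).trans (hle' b₀))] at k1
  rw [hoff y hy fun h => absurd h.2 (not_lt.2 hhy), hQ (H.attracting.apply_mem hy)
    (e.monotone hcy)] at k2
  linarith

theorem exists_trivC1 (H : Parab f q p a b x₀) {V : Set SmoothLift} (hV : V ∈ 𝓝 f) :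
    ∃ g ∈ V, (∀ x, f x ≤ g x) ∧ Parab g q p a b x₀ ∧ TrivC1 g ∧
      ∀ i j : ℤ, g.lat i j x₀ = f.lat i j x₀ := by
  obtain ⟨c, hc⟩ : (Set.Ioo x₀ (f.lat a b x₀)).Nonempty := Set.nonempty_Ioo.2 H.base_lt
  have hsurj := H.attracting_inv.surjOn_fatou hc
  have hPm := H.attracting_inv.strictMonoOn_fatou hc
  have hQm := H.attracting.strictMonoOn_fatou (H.attracting.apply_mem hc)
  choose Y hY hPY using fun t => hsurj (Set.mem_univ t)
  have hYm : StrictMono Y := fun s t hst => by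
    rw [← hPm.lt_iff_lt (hY s) (hY t), hPY, hPY]; exact hst
  set b₀ := Y (1 / 6) with hb₀
  set lo := Y 0
  set hi := Y (1 / 3)
  have h1 : lo < b₀ := hYm (by norm_num)
  have h2 : b₀ < hi := hYm (by norm_num)
  set ε := min (1 / 2) (min (b₀ - lo) (hi - b₀)) with hε
  have hε0 : 0 < ε := by
    rw [hε]
    exact lt_min (by norm_num) (lt_min (by linarith) (by linarith))
  have hε1 : ε ≤ 1 / 2 := min_le_left _ _
  have hε2 : ε ≤ b₀ - lo := (min_le_right _ _).trans (min_le_left _ _)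
  have hε3 : ε ≤ hi - b₀ := (min_le_right _ _).trans (min_le_right _ _)
  obtain ⟨τ₀, hτ₀, hτ⟩ := f.exists_smul_perturbation hV
    (ψ := fun x => bump ε (x - b₀)) ((contDiff_bump ε).comp (contDiff_id.sub contDiff_const))
    (fun x => by
      have := periodic_bump ε (x - b₀)
      rwa [sub_add_eq_add_sub] at this)
  choose! G hGV hG using hτ
  have habs {τ : ℝ} (ht : τ ∈ Set.Ioo 0 τ₀) : |τ| ≤ τ₀ := by
    rw [abs_of_pos ht.1]; exact ht.2.le
  have hle {τ : ℝ} (ht : τ ∈ Set.Ioo 0 τ₀) (x : ℝ) : f x ≤ G τ x := by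
    rw [hG τ (habs ht)]
    linarith [mul_nonneg ht.1.le (bump_nonneg ε (x - b₀))]
  have hsupp {τ : ℝ} (ht : τ ∈ Set.Ioo 0 τ₀) (x : ℝ) (hne : G τ x ≠ f x) :
      ∃ k : ℤ, x - k ∈ Set.Ioo lo hi := by
    rw [hG τ (habs ht)] at hne
    obtain ⟨k, hk⟩ := exists_abs_sub_lt_of_bump_ne hε0 hε1 (u := x - b₀) fun h => hne (by
      rw [h, mul_zero, add_zero])
    rw [abs_lt] at hk
    exact ⟨k, by linarith [hk.1], by linarith [hk.2]⟩
  have hlh : Set.Ioo lo hi ⊆ Set.Ioo x₀ (f.lat a b x₀) :=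
    Set.Ioo_subset_Ioo (hY _).1.le (hY _).2.le
  obtain ⟨τ, ht, hT⟩ : ∃ τ ∈ Set.Ioo 0 τ₀, TrivC1 (G τ) := by
    by_contra! hcon
    have hex : ∀ τ ∈ Set.Ioo 0 τ₀, ∃ r : ℚ, _ := fun τ ht =>
      H.exists_fatou_eq_of_not_trivC1 (hle ht) (hY 0) (hY (1 / 3)) (hY (1 / 6)) (hsupp ht) hc
        (hPY 0).ge (hPY _) (hPY _).le (hcon τ ht)
    choose! r hr using hex
    have hinj : Set.InjOn r (Set.Ioo 0 τ₀) := by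
      intro s hs t ht hst
      have es := hr s hs (Y (1 / 6 + r s)) (hY _) (hPY _)
      have et := hr t ht (Y (1 / 6 + r t)) (hY _) (hPY _)
      rw [hst, ← et] at es
      have mem {τ : ℝ} (ht : τ ∈ Set.Ioo 0 τ₀) :
          (G τ).lat q (-p) b₀ ∈ Set.Ioo x₀ (f.lat a b x₀) := by
        obtain ⟨Hg, hlat⟩ := H.parab_of_support (hle ht) hlh (hsupp ht)
        have := Hg.attracting.apply_mem (x := b₀) (by rw [hlat]; exact hY _)
        rwa [hlat] at this
      have e1 := hQm.injOn (mem hs) (mem ht) es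
      rw [H.lat_apply_of_support (hle hs) hlh (hsupp hs) (hY _),
        H.lat_apply_of_support (hle ht) hlh (hsupp ht) (hY _), add_left_inj,
        (f ^ (q - 1)).injective.eq_iff, hG s (habs hs), hG t (habs ht), add_right_inj] at e1
      refine mul_right_cancel₀ (bump_zero_pos hε0 hε1).ne' ?_
      rwa [← hb₀, sub_self] at e1
    have hcount : (Set.Ioo 0 τ₀).Countable :=
      Set.MapsTo.countable_of_injOn (Set.mapsTo_univ r _) hinj Set.countable_univ
    exact absurd hτ₀ (not_lt.2 (Cardinal.Real.Ioo_countable_iff.1 hcount))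
  obtain ⟨Hg, hlat⟩ := H.parab_of_support (hle ht) hlh (hsupp ht)
  exact ⟨G τ, hGV τ (habs ht), hle ht, Hg, hT, hlat⟩

end Parab

end SmoothLift

/-! ### Second derivatives at fixed points -/

namespace SmoothLift

lemma exists_le_apply_of_continuous {Φ : ℝ → SmoothLift} (hΦ : Continuous Φ) {t₁ t₂ : ℝ}
    (h1 : ∃ x, Φ t₁ x ≤ x) (h2 : ∀ x, x < Φ t₂ x) :
    ∃ t ∈ Set.uIcc t₁ t₂, (∀ x, x ≤ Φ t x) ∧ ∃ x, Φ t x = x := by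
  let φ : ℝ → ℝ → ℝ := fun t x => Φ t x - x
  have hφ : Continuous ↿φ :=
    (continuous_eval.comp ((hΦ.comp continuous_fst).prodMk continuous_snd)).sub continuous_snd
  have hφt (t : ℝ) : Continuous (φ t) := (Φ t).continuous.sub continuous_id
  have hm := isCompact_Icc (a := (0 : ℝ)) (b := 1) |>.continuous_sInf hφ
  have hfr (t x : ℝ) : φ t (Int.fract x) = φ t x := by
    have := (Φ t).periodic_sub_id.sub_int_mul_eq ⌊x⌋ (x := x)
    rwa [mul_one] at this
  have hmem (x : ℝ) : Int.fract x ∈ Set.Icc (0 : ℝ) 1 :=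
    ⟨Int.fract_nonneg x, (Int.fract_lt_one x).le⟩
  have hne : (Set.Icc (0 : ℝ) 1).Nonempty := ⟨0, by simp⟩
  have hle (t x : ℝ) : sInf (φ t '' Set.Icc 0 1) ≤ φ t x := by
    rw [← hfr]
    exact csInf_le (isCompact_Icc.image (hφt t)).bddBelow ⟨_, hmem x, rfl⟩
  have hat (t : ℝ) : ∃ x, φ t x = sInf (φ t '' Set.Icc 0 1) := by
    obtain ⟨x, -, hx⟩ := (isCompact_Icc.image (hφt t)).sInf_mem (hne.image _)
    exact ⟨x, hx⟩
  obtain ⟨t, ht, h0⟩ : (0 : ℝ) ∈ (fun t => sInf (φ t '' Set.Icc 0 1)) '' Set.uIcc t₁ t₂ := by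
    refine intermediate_value_uIcc hm.continuousOn (Set.mem_uIcc.2 (Or.inl ⟨?_, ?_⟩))
    · obtain ⟨x, hx⟩ := h1
      exact (hle t₁ x).trans (sub_nonpos.2 hx)
    · obtain ⟨x, hx⟩ := hat t₂
      rw [← hx]
      exact sub_nonneg.2 (h2 x).le
  refine ⟨t, ht, fun x => ?_, ?_⟩
  · have := hle t x
    simp only at h0
    rw [h0] at this
    exact sub_nonneg.1 this
  · obtain ⟨x, hx⟩ := hat t
    simp only at h0
    rw [h0] at hx
    exact ⟨x, sub_eq_zero.1 hx⟩

lemma hasDerivAt_deriv (f : SmoothLift) (x : ℝ) :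
    HasDerivAt (deriv f) (iteratedDeriv 2 f x) x := by
  have := hasDerivAt_iteratedDeriv f 1 x
  rwa [iteratedDeriv_one] at this

lemma iteratedDeriv_two_mul (g h : SmoothLift) (x : ℝ) :
    iteratedDeriv 2 (g * h : SmoothLift) x =
      iteratedDeriv 2 g (h x) * deriv h x ^ 2 + deriv g (h x) * iteratedDeriv 2 h x := by
  have h1 : deriv (g * h : SmoothLift) = fun x => deriv g (h x) * deriv h x :=
    funext fun x => deriv_mul g h x
  have h2 := ((g.hasDerivAt_deriv (h x)).comp x (h.hasDerivAt x)).mul (h.hasDerivAt_deriv x)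
  have h3 := (g * h).hasDerivAt_deriv x
  rw [h1] at h3
  rw [h3.unique h2, Function.comp_apply]
  ring

lemma iteratedDeriv_two_one (x : ℝ) : iteratedDeriv 2 (1 : SmoothLift) x = 0 := by
  have h1 : deriv (1 : SmoothLift) = fun _ => 1 := funext deriv_one
  have h3 := (1 : SmoothLift).hasDerivAt_deriv x
  rw [h1] at h3
  exact h3.unique (hasDerivAt_const x 1)

lemma iteratedDeriv_two_zpow {h : SmoothLift} {x : ℝ} (hx : h x = x) (hd : deriv h x = 1)
    (n : ℤ) : iteratedDeriv 2 (h ^ n : SmoothLift) x = n * iteratedDeriv 2 h x := by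
  have hi : h⁻¹ x = x := Parab.inv_fix hx
  have hdi : deriv (h⁻¹ : SmoothLift) x = 1 := by rw [deriv_inv, hi, hd, inv_one]
  have h2 : iteratedDeriv 2 (h⁻¹ : SmoothLift) x = -iteratedDeriv 2 h x := by
    have := iteratedDeriv_two_mul h⁻¹ h x
    rw [inv_mul_cancel, iteratedDeriv_two_one, hx, hd, hdi] at this
    linarith
  have hone (k : SmoothLift) (hk : k x = x) (hkd : deriv k x = 1) (n : ℤ) :
      deriv (h ^ n * k : SmoothLift) x = deriv (h ^ n : SmoothLift) x := by
    rw [deriv_mul, hk, hkd, mul_one]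
  have hdn (n : ℤ) : deriv (h ^ n : SmoothLift) x = 1 := by
    induction n with
    | zero => rw [zpow_zero, deriv_one]
    | succ n ih => rw [zpow_add_one, hone h hx hd, ih]
    | pred n ih => rw [zpow_sub_one, hone h⁻¹ hi hdi, ih]
  induction n with
  | zero => simp [iteratedDeriv_two_one]
  | succ n ih =>
    rw [zpow_add_one, iteratedDeriv_two_mul, hx, hd, hdn, ih]
    push_cast
    ring
  | pred n ih =>
    rw [zpow_sub_one, iteratedDeriv_two_mul, hi, hdi, hdn, ih, h2]
    push_cast
    ring

lemma iteratedDeriv_two_of_commute {h k : SmoothLift} (hc : Commute k h) {x y : ℝ} (hy : k y = x)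
    (hx : h x = x) (hdy : deriv h y = 1) (hdx : deriv h x = 1) :
    iteratedDeriv 2 h y = deriv k y * iteratedDeriv 2 h x := by
  have hfy : h y = y := by
    rw [← k.injective.eq_iff, ← mul_apply, hc.eq, mul_apply, hy, hx]
  have h1 := iteratedDeriv_two_mul k h y
  have h2 := iteratedDeriv_two_mul h k y
  rw [← hc.eq, h1, hfy, hdy, hy, hdx] at h2
  refine mul_left_cancel₀ (k.deriv_pos y).ne' ?_
  linarith

lemma le_iteratedDeriv_two (h : SmoothLift) {x₁ m : ℝ} (hx : h x₁ = x₁)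
    (hm : ∀ᶠ x in 𝓝 x₁, x + m * (x - x₁) ^ 2 ≤ h x) : 2 * m ≤ iteratedDeriv 2 h x₁ := by
  let φ : ℝ → ℝ := fun x => h x - x - m * (x - x₁) ^ 2
  have hφ' (x : ℝ) : HasDerivAt φ (deriv h x - 1 - m * (2 * (x - x₁))) x := by
    have : HasDerivAt φ _ x := ((h.hasDerivAt x).sub (hasDerivAt_id x)).sub
      ((((hasDerivAt_id x).sub_const x₁).pow 2).const_mul m)
    exact this.congr_deriv (by norm_num)
  have hd : deriv φ = fun x => deriv h x - 1 - m * (2 * (x - x₁)) :=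
    funext fun x => (hφ' x).deriv
  have hφ'' : deriv (deriv φ) x₁ = iteratedDeriv 2 h x₁ - 2 * m := by
    rw [hd]
    have := ((h.hasDerivAt_deriv x₁).sub_const 1).sub
      ((((hasDerivAt_id x₁).sub_const x₁).const_mul 2).const_mul m)
    rw [(show HasDerivAt (fun x => deriv h x - 1 - m * (2 * (x - x₁))) _ x₁ from this).deriv]
    ring
  have h0 : φ x₁ = 0 := by simp [φ, hx]
  have hmin : IsLocalMin φ x₁ := by
    filter_upwards [hm] with x hx'
    rw [h0]
    change 0 ≤ h x - x - m * (x - x₁) ^ 2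
    linarith
  by_contra! hlt
  have hneg : deriv (deriv φ) x₁ < 0 := by rw [hφ'']; linarith
  have hmax := isLocalMax_of_deriv_deriv_neg hneg hmin.deriv_eq_zero (hφ' x₁).continuousAt
  have hconst : φ =ᶠ[𝓝 x₁] fun _ => 0 := by
    filter_upwards [hmin, hmax] with x h1 h2
    linarith
  have : deriv (deriv φ) x₁ = 0 := by
    have h1 : deriv φ =ᶠ[𝓝 x₁] deriv fun _ => (0 : ℝ) := hconst.deriv
    rw [h1.deriv_eq]
    simp
  linarith

lemma le_iteratedDeriv_two_lat {f g : SmoothLift} {q : ℕ} {p : ℤ} (hq : 0 < q) {x₁ m M : ℝ}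
    (hF : ∀ x, x ≤ f.lat q (-p) x) (hx : f.lat q (-p) x₁ = x₁) (hgx : g.lat q (-p) x₁ = x₁)
    (hM : deriv f x₁ < M) (hm : 0 ≤ m) (hle : ∀ x, f x ≤ g x)
    (hq' : ∀ᶠ x in 𝓝 x₁, f x + m * (x - x₁) ^ 2 ≤ g x) :
    2 * (m / M) ≤ iteratedDeriv 2 (g.lat q (-p)) x₁ := by
  have hM0 : 0 < M := (f.deriv_pos x₁).trans hM
  obtain ⟨k, rfl⟩ := Nat.exists_eq_succ_of_ne_zero hq.ne'
  have hG (f : SmoothLift) : f.lat (k + 1 : ℕ) (-p) = f.lat k (-p) * f := by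
    have := f.lat_add k (-p) 1 0
    rw [lat_one_zero, add_zero] at this
    rw [← this]
    push_cast
    rfl
  set G := f.lat k (-p)
  have hdG : M⁻¹ < deriv G (f x₁) := by
    have h1 := deriv_eq_one_of_le hF hx
    rw [hG, deriv_mul] at h1
    rw [eq_inv_of_mul_eq_one_left h1]
    exact (inv_lt_inv₀ hM0 (f.deriv_pos x₁)).2 hM
  obtain ⟨ρ, hρ, hball⟩ := Metric.eventually_nhds_iff.1
    (continuousAt_const.eventually_lt G.continuous_deriv_apply.continuousAt hdG)
  refine le_iteratedDeriv_two _ hgx ?_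
  have hnear : ∀ᶠ x in 𝓝 x₁, |f x - f x₁| + m * (x - x₁) ^ 2 < ρ := by
    have hc : Continuous fun x => |f x - f x₁| + m * (x - x₁) ^ 2 :=
      (f.continuous.sub continuous_const).abs.add
        (continuous_const.mul ((continuous_id.sub continuous_const).pow 2))
    refine hc.continuousAt.eventually_lt continuousAt_const ?_
    simpa using hρ
  filter_upwards [hq', hnear] with x h1 h2
  have hsq : 0 ≤ m * (x - x₁) ^ 2 := by positivity
  obtain ⟨ξ, hξ, e⟩ := Attracting.exists_mul_sub G
    (x := f x + m * (x - x₁) ^ 2) (y := f x) (by linarith)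
  have hGξ : M⁻¹ < deriv G ξ := hball (by
    rw [Real.dist_eq, abs_lt]
    have := abs_le.1 (le_refl |f x - f x₁|)
    constructor <;> linarith [hξ.1, hξ.2])
  have h3 : x ≤ G (f x) := by
    have := hF x
    rwa [hG, mul_apply] at this
  have h4 : G (f x + m * (x - x₁) ^ 2) ≤ G (g x) := G.monotone h1
  have h5 : G (g x) ≤ g.lat k (-p) (g x) := lat_le_lat hle k (-p) (g x)
  rw [hG g, mul_apply]
  have h6 : m / M * (x - x₁) ^ 2 ≤ deriv G ξ * (f x + m * (x - x₁) ^ 2 - f x) := by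
    rw [add_sub_cancel_left, div_eq_inv_mul, mul_assoc]
    exact mul_le_mul_of_nonneg_right hGξ.le hsq
  linarith

lemma Parab.exists_eq_zpow_of_close {f : SmoothLift} {q : ℕ} {p a b : ℤ} {x₀ : ℝ}
    (H : Parab f q p a b x₀) {i j : ℤ} (hi : i ≠ 0) {ε : ℝ} (h : |f.lat i j x₀ - x₀| < ε)
    (h1 : ε ≤ f.lat a b x₀ - x₀) (h2 : ε ≤ x₀ - (f.lat a b)⁻¹ x₀) :
    ∃ u : ℤ, u ≠ 0 ∧ f.lat i j = f.lat q (-p) ^ u := by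
  have e1 := lat_apply_of_fixed H.bezout H.fix_base i j
  rw [e1, abs_lt] at h
  have hw1 : i * p + j * q < 1 := H.strictMono.lt_iff_lt.1 (by
    simp only [zpow_one]; linarith [h.2])
  have hw2 : -1 < i * p + j * q := H.strictMono.lt_iff_lt.1 (by
    simp only [zpow_neg_one]; linarith [h.1])
  have hw : i * p + j * q = 0 := by omega
  have e2 := f.lat_eq_zpow_mul_zpow H.bezout i j
  rw [hw, zpow_zero, mul_one] at e2
  refine ⟨_, fun hu => hi ?_, e2⟩
  linear_combination (-i) * H.bezout + q * hu + a * hw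

/-- A periodic nonnegative bump function vanishing quadratically at `0`. -/
noncomputable def quadBump (ε u : ℝ) : ℝ := Real.sin (Real.pi * u) ^ 2 * bump ε u

lemma contDiff_quadBump (ε : ℝ) : ContDiff ℝ (⊤ : ℕ∞) (quadBump ε) :=
  ((Real.contDiff_sin.comp (contDiff_const.mul contDiff_id)).pow 2).mul (contDiff_bump ε)

lemma periodic_quadBump (ε : ℝ) : Function.Periodic (quadBump ε) 1 := fun u => by
  rw [quadBump, periodic_bump ε u, mul_add, mul_one, Real.sin_add_pi, neg_sq, quadBump]

lemma quadBump_nonneg (ε u : ℝ) : 0 ≤ quadBump ε u := mul_nonneg (sq_nonneg _) (bump_nonneg ε u)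

lemma exists_quadBump_ge {ε : ℝ} (h0 : 0 < ε) (h1 : ε ≤ 1 / 2) :
    ∃ m, 0 < m ∧ ∀ᶠ u in 𝓝 (0 : ℝ), m * u ^ 2 ≤ quadBump ε u := by
  have hb := bump_zero_pos h0 h1
  refine ⟨bump ε 0 / 2, by positivity, ?_⟩
  have e1 : ∀ᶠ u in 𝓝 (0 : ℝ), bump ε 0 / 2 < bump ε u :=
    continuousAt_const.eventually_lt (contDiff_bump ε).continuous.continuousAt (by linarith)
  have e2 : ∀ᶠ u in 𝓝 (0 : ℝ), |u| < 1 / 2 :=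
    continuous_abs.continuousAt.eventually_lt continuousAt_const (by simp)
  filter_upwards [e1, e2] with u h3 h4
  have hpi := Real.pi_pos
  have h5 := Real.mul_abs_le_abs_sin (x := Real.pi * u) (by
    rw [abs_mul, abs_of_pos hpi]; nlinarith)
  rw [abs_mul, abs_of_pos hpi] at h5
  have h6 : |u| ≤ |Real.sin (Real.pi * u)| := by
    refine le_trans ?_ h5
    field_simp
    linarith [abs_nonneg u]
  have h7 : u ^ 2 ≤ Real.sin (Real.pi * u) ^ 2 := sq_le_sq.2 h6
  rw [quadBump, mul_comm]
  exact mul_le_mul h7 h3.le (by positivity) (by positivity)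

lemma quadBump_eq_zero {ε u : ℝ} (h0 : 0 < ε) (h1 : ε ≤ 1 / 2)
    (h : ∀ k : ℤ, |u - k| < ε → u = k) : quadBump ε u = 0 := by
  by_contra hne
  obtain ⟨k, hk⟩ := exists_abs_sub_lt_of_bump_ne h0 h1 (right_ne_zero_of_mul hne)
  refine left_ne_zero_of_mul hne ?_
  rw [h k hk, mul_comm, Real.sin_int_mul_pi, zero_pow two_ne_zero]

theorem exists_parab_trivC1 {f f₂ : SmoothLift} {q : ℕ} {p a b : ℤ} {x₁ : ℝ} (hq : 0 < q)
    (hb : a * p + b * q = 1) (hF : ∀ x, x ≤ f.lat q (-p) x) (hx : f.lat q (-p) x₁ = x₁)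
    (hle : ∀ x, f x ≤ f₂ x) (heq : ∀ w : ℤ, f₂ ((f.lat a b ^ w) x₁) = f ((f.lat a b ^ w) x₁))
    {V : Set SmoothLift} (hV : V ∈ 𝓝 f₂) :
    ∃ g ∈ V, (∀ x, f₂ x ≤ g x) ∧ Parab g q p a b x₁ ∧ TrivC1 g ∧
      ∀ i j : ℤ, g.lat i j x₁ = f.lat i j x₁ := by
  let ψ : ℝ → ℝ := fun x => ∏ i ∈ Finset.range q, (1 - Real.cos (2 * Real.pi * (x - (f ^ i) x₁)))
  have hψ0 (x : ℝ) : 0 ≤ ψ x := Finset.prod_nonneg fun i _ => by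
    linarith [Real.cos_le_one (2 * Real.pi * (x - (f ^ i) x₁))]
  have hcos (x y : ℝ) : 1 - Real.cos (2 * Real.pi * (x - y)) = 0 ↔ ∃ k : ℤ, x = y + k := by
    rw [sub_eq_zero, eq_comm, Real.cos_eq_one_iff]
    refine exists_congr fun k => ?_
    have := Real.pi_pos
    constructor
    · intro h
      have : (k : ℝ) = x - y := by
        apply mul_right_cancel₀ (b := 2 * Real.pi) (by positivity)
        linarith
      linarith
    · rintro rfl
      ring
  have hlat (i : ℕ) (k : ℤ) : (f ^ i) x₁ + k = (f.lat a b ^ (i * p + k * q : ℤ)) x₁ := by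
    rw [← lat_apply_of_fixed hb hx, lat_apply_nat]
  have hψz (x : ℝ) : ψ x = 0 ↔ ∃ w : ℤ, x = (f.lat a b ^ w) x₁ := by
    rw [Finset.prod_eq_zero_iff]
    constructor
    · rintro ⟨i, -, hi⟩
      obtain ⟨k, rfl⟩ := (hcos _ _).1 hi
      exact ⟨_, hlat i k⟩
    · rintro ⟨w, rfl⟩
      have hq' : (0 : ℤ) < q := by exact_mod_cast hq
      have hn := Int.emod_nonneg (w * a) hq'.ne'
      have hl := Int.emod_lt_of_pos (w * a) hq'
      refine ⟨(w * a % q).toNat, Finset.mem_range.2 (by omega),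
        (hcos _ _).2 ⟨w * b + w * a / q * p, ?_⟩⟩
      rw [hlat, Int.toNat_of_nonneg hn]
      congr 2
      linear_combination (-w) * hb - p * Int.emod_add_mul_ediv (w * a) q
  have hψc : ContDiff ℝ (⊤ : ℕ∞) ψ := contDiff_prod fun i _ =>
    contDiff_const.sub (Real.contDiff_cos.comp
      (contDiff_const.mul (contDiff_id.sub contDiff_const)))
  have hψp : Function.Periodic ψ 1 := fun x => Finset.prod_congr rfl fun i _ => by
    rw [← sub_add_eq_add_sub, mul_add, mul_one, Real.cos_add_two_pi]
  obtain ⟨τ₀, hτ₀, hτ⟩ := f₂.exists_smul_perturbation (interior_mem_nhds.2 hV) hψc hψp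
  obtain ⟨f₃, hf₃V, hf₃⟩ := hτ τ₀ (abs_of_pos hτ₀).le
  have hle₂ (x : ℝ) : f₂ x ≤ f₃ x := by
    rw [hf₃]
    linarith [mul_nonneg hτ₀.le (hψ0 x)]
  obtain ⟨H, hl⟩ := parab_of_le (g := f₃) hq hb hF hx (fun x => (hle x).trans (hle₂ x))
    (fun w => by rw [hf₃, (hψz _).2 ⟨w, rfl⟩, mul_zero, add_zero, heq]) (fun x _ h2 => by
      refine (hψz x).1 (le_antisymm (nonpos_of_mul_nonpos_right (a := τ₀) ?_ hτ₀) (hψ0 x))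
      rw [hf₃] at h2
      linarith [hle x])
  obtain ⟨g, hgV, hg1, hg2, hg3, hg4⟩ := H.exists_trivC1 (mem_interior_iff_mem_nhds.1 hf₃V)
  exact ⟨g, hgV, fun x => (hle₂ x).trans (hg1 x), hg2, hg3, fun i j => (hg4 i j).trans (hl i j)⟩

end SmoothLift

/-! ### Perturbation to parabolic lifts -/

namespace SmoothLift

lemma eq_zero_of_abs_zpow_sub_lt {f : SmoothLift} {q : ℕ} {p a b : ℤ} {x₁ ε : ℝ}
    (hb : a * p + b * q = 1) (hx : f.lat q (-p) x₁ = x₁)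
    (h1 : ε ≤ f.lat a b x₁ - x₁) (h2 : ε ≤ x₁ - (f.lat a b)⁻¹ x₁) {w : ℤ}
    (h : |(f.lat a b ^ w) x₁ - x₁| < ε) : w = 0 := by
  have hm := strictMono_zpow_apply hb hx
  rw [abs_lt] at h
  have hw1 : w < 1 := hm.lt_iff_lt.1 (by simp only [zpow_one]; linarith [h.2])
  have hw2 : -1 < w := hm.lt_iff_lt.1 (by simp only [zpow_neg_one]; linarith [h.1])
  omega

lemma quadBump_orbit_eq_zero {f : SmoothLift} {q : ℕ} {p a b : ℤ} {x₁ ε : ℝ}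
    (hb : a * p + b * q = 1) (hx : f.lat q (-p) x₁ = x₁) (h0 : 0 < ε) (hε : ε ≤ 1 / 2)
    (h1 : ε ≤ f.lat a b x₁ - x₁) (h2 : ε ≤ x₁ - (f.lat a b)⁻¹ x₁) (w : ℤ) :
    quadBump ε ((f.lat a b ^ w) x₁ - x₁) = 0 := by
  refine quadBump_eq_zero h0 hε fun k hk => ?_
  have e : (f.lat a b ^ (w + q * (-k))) x₁ = (f.lat a b ^ w) x₁ - k := by
    rw [zpow_add, mul_apply, zpow_mul_apply_fixed hb hx, map_add_int]
    push_cast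
    ring
  have hw := eq_zero_of_abs_zpow_sub_lt (w := w + q * (-k)) hb hx h1 h2 (by
    rwa [e, sub_right_comm])
  rw [hw, zpow_zero, one_apply] at e
  linarith

lemma exists_parab_quadBump {f f₂ : SmoothLift} {q : ℕ} {p a b : ℤ} {x₁ ε κ m M : ℝ} (hq : 0 < q)
    (hb : a * p + b * q = 1) (hF : ∀ x, x ≤ f.lat q (-p) x) (hx : f.lat q (-p) x₁ = x₁)
    (h0 : 0 < ε) (hε : ε ≤ 1 / 2) (h1 : ε ≤ f.lat a b x₁ - x₁) (h2 : ε ≤ x₁ - (f.lat a b)⁻¹ x₁)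
    (hκ : 0 < κ) (hm : 0 < m) (hmu : ∀ᶠ u in 𝓝 (0 : ℝ), m * u ^ 2 ≤ quadBump ε u)
    (hM : deriv f x₁ < M) (hf₂ : ∀ x, f₂ x = f x + κ * quadBump ε (x - x₁))
    {V : Set SmoothLift} (hV : V ∈ 𝓝 f₂) :
    ∃ g ∈ V, (∀ x, f x ≤ g x) ∧ Parab g q p a b x₁ ∧ TrivC1 g ∧
      (∀ i j : ℤ, g.lat i j x₁ = f.lat i j x₁) ∧
      2 * (κ * m / M) ≤ iteratedDeriv 2 (g.lat q (-p)) x₁ := by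
  have hle (x : ℝ) : f x ≤ f₂ x := by
    rw [hf₂]
    linarith [mul_nonneg hκ.le (quadBump_nonneg ε (x - x₁))]
  obtain ⟨g, hgV, hg, H, hT, hl⟩ := exists_parab_trivC1 hq hb hF hx hle (fun w => by
    rw [hf₂, quadBump_orbit_eq_zero hb hx h0 hε h1 h2, mul_zero, add_zero]) hV
  have hfg (x : ℝ) : f x ≤ g x := (hle x).trans (hg x)
  refine ⟨g, hgV, hfg, H, hT, hl, le_iteratedDeriv_two_lat hq hF hx H.fix_base hM
    (by positivity) hfg ?_⟩
  have ht : Tendsto (fun x : ℝ => x - x₁) (𝓝 x₁) (𝓝 0) := by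
    have : Continuous fun x : ℝ => x - x₁ := continuous_id.sub continuous_const
    simpa using this.tendsto x₁
  filter_upwards [ht.eventually hmu] with x hxm
  refine le_trans ?_ (hg x)
  rw [hf₂, mul_assoc]
  linarith [mul_le_mul_of_nonneg_left hxm hκ.le]

/-- Small-scale returns of a lift without periodic points. -/
lemma exists_small_return {f : SmoothLift} (hf : ∀ (q : ℕ) (p : ℤ), 0 < q → ∀ x, f.lat q (-p) x ≠ x)
    {t : ℝ} (ht : 0 < t) (ht1 : t ≤ 1) :
    ∃ (q : ℕ) (p : ℤ) (x : ℝ), 0 < q ∧ x < f.lat q (-p) x ∧ f.lat q (-p) x < x + t := by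
  obtain ⟨n, m, hnm, k, hk⟩ : ∃ n m : ℕ, n < m ∧ ∃ k : ℤ,
      |(f ^ m) 0 - k - (f ^ n) 0| < t := by
    obtain ⟨N, hN⟩ := exists_nat_gt (1 / t)
    have hN0 : (0 : ℝ) < N := (by positivity : 0 < 1 / t).trans hN
    let φ : ℕ → ℤ := fun n => ⌊Int.fract ((f ^ n) 0) * N⌋
    have hmap : ∀ n ∈ Finset.range (N + 1), φ n ∈ Finset.Ico (0 : ℤ) N := fun n _ => by
      rw [Finset.mem_Ico]
      constructor
      · exact Int.floor_nonneg.2 (mul_nonneg (Int.fract_nonneg _) hN0.le)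
      · refine Int.floor_lt.2 ?_
        push_cast
        nlinarith [Int.fract_lt_one ((f ^ n) 0)]
    obtain ⟨n, -, m, -, hne, he⟩ :=
      Finset.exists_ne_map_eq_of_card_lt_of_maps_to (by simp) hmap
    have hd (n m : ℕ) (he : φ n = φ m) :
        |(f ^ m) 0 - (⌊(f ^ m) 0⌋ - ⌊(f ^ n) 0⌋ : ℤ) - (f ^ n) 0| < t := by
      have h3 := Int.abs_sub_lt_one_of_floor_eq_floor he
      rw [← sub_mul, abs_mul, abs_of_pos hN0] at h3
      have h4 : (f ^ m) 0 - (⌊(f ^ m) 0⌋ - ⌊(f ^ n) 0⌋ : ℤ) - (f ^ n) 0 =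
          -(Int.fract ((f ^ n) 0) - Int.fract ((f ^ m) 0)) := by
        rw [Int.fract, Int.fract]
        push_cast
        ring
      rw [h4, abs_neg]
      rw [div_lt_iff₀ ht] at hN
      by_contra! hcon
      nlinarith
    rcases hne.lt_or_gt with h | h
    · exact ⟨n, m, h, _, hd n m he⟩
    · exact ⟨m, n, h, _, hd m n he.symm⟩
  set y := (f ^ n) 0
  obtain ⟨d, rfl⟩ := Nat.exists_eq_add_of_lt hnm
  have hy (i : ℕ) : f.lat i (-k) y = (f ^ (n + i)) 0 - k := by
    rw [lat_apply_nat, add_comm n, pow_add, mul_apply]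
    push_cast
    ring
  rw [add_assoc, ← hy, abs_lt] at hk
  have hne := hf (d + 1) k (Nat.succ_pos d) y
  rcases hne.lt_or_gt with hlt | hgt
  swap
  · exact ⟨d + 1, k, y, Nat.succ_pos d, hgt, by linarith [hk.2]⟩
  set h := f.lat (d + 1 : ℕ) (-k) with hh
  have hlt' (x : ℝ) : h x < x := by
    by_contra! hcon
    have hc : Continuous fun x => h x - x := h.continuous.sub continuous_id
    obtain ⟨z, hz⟩ := mem_range_of_exists_le_of_exists_ge hc
      ⟨y, (sub_neg.2 hlt).le⟩ ⟨x, sub_nonneg.2 hcon⟩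
    exact hf (d + 1) k (Nat.succ_pos d) z (sub_eq_zero.1 hz)
  obtain ⟨C, hC, hCb⟩ : ∃ C, 0 < C ∧ ∀ x, h x ≤ x - C := by
    have hc : Continuous fun x => h x - x := h.continuous.sub continuous_id
    obtain ⟨z, -, hz⟩ := isCompact_Icc.exists_isMaxOn (s := Set.Icc (0 : ℝ) 1) ⟨0, by simp⟩
      hc.continuousOn
    refine ⟨z - h z, sub_pos.2 (hlt' z), fun x => ?_⟩
    have h1 := isMaxOn_iff.1 hz (Int.fract x) ⟨Int.fract_nonneg x, (Int.fract_lt_one x).le⟩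
    have h2 := h.periodic_sub_id.sub_int_mul_eq ⌊x⌋ (x := x)
    rw [mul_one] at h2
    change h (Int.fract x) - Int.fract x = h x - x at h2
    linarith
  have hpow (N : ℕ) : (h ^ N) y ≤ y - N * C := by
    induction N with
    | zero => simp
    | succ N ih =>
      rw [pow_succ', mul_apply]
      push_cast
      linarith [hCb ((h ^ N) y)]
  have hex : ∃ N : ℕ, (h ^ N) y ≤ y - 1 := by
    obtain ⟨N, hN⟩ := exists_nat_gt (1 / C)
    rw [div_lt_iff₀ hC] at hN
    exact ⟨N, by linarith [hpow N]⟩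
  classical
  obtain ⟨N, hfind, hmin⟩ : ∃ N : ℕ, (h ^ N) y ≤ y - 1 ∧ ∀ m < N, ¬ (h ^ m) y ≤ y - 1 :=
    ⟨Nat.find hex, Nat.find_spec hex, fun _ => Nat.find_min hex⟩
  obtain ⟨N, rfl⟩ : ∃ M, N = M + 2 := by
    rcases N with _ | _ | N
    · norm_num at hfind
    · rw [zero_add, pow_one] at hfind
      linarith [hk.1]
    · exact ⟨N, rfl⟩
  have hl := hmin (N + 1) (by omega)
  push Not at hl
  have e : f.lat ((N + 1) * (d + 1) : ℕ) (-((N + 1) * k - 1)) (h y) = (h ^ (N + 2)) y + 1 := by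
    have h3 : h ^ (N + 1) = f.lat (((N + 1 : ℕ) : ℤ) * (d + 1 : ℕ)) ((N + 1 : ℕ) * (-k)) := by
      rw [hh, ← lat_zpow, zpow_natCast]
    rw [pow_succ, mul_apply, h3]
    generalize h y = z
    rw [← Nat.cast_mul, lat_apply_nat, lat_apply_nat]
    push_cast
    ring
  have hs : (h ^ (N + 2)) y = h ((h ^ (N + 1)) y) := by rw [pow_succ' h (N + 1), mul_apply]
  have hm : h y - 1 < h ((h ^ (N + 1)) y) := by
    have h4 := h.strictMono hl
    have h5 := h.map_add_one (y - 1)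
    rw [sub_add_cancel] at h5
    linarith
  refine ⟨(N + 1) * (d + 1), (N + 1) * k - 1, h y, by positivity, ?_, ?_⟩
  · rw [e, hs]; linarith
  · rw [e]; linarith [hk.1]

lemma lt_pow_apply {h : SmoothLift} (hle : ∀ x, x ≤ h x) {x : ℝ} (hx : x < h x) {n : ℕ}
    (hn : 0 < n) : x < (h ^ n) x := by
  obtain ⟨k, rfl⟩ := Nat.exists_eq_succ_of_ne_zero hn.ne'
  have h1 := pow_le_pow (f := 1) (g := h) (by simpa using hle) k (h x)
  rw [one_pow, one_apply] at h1
  rw [pow_succ, mul_apply]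
  exact hx.trans_le h1

lemma pow_apply_lt {h : SmoothLift} {x : ℝ} (hx : h x < x) {n : ℕ} (hn : 0 < n) :
    (h ^ n) x < x := by
  obtain ⟨k, rfl⟩ := Nat.exists_eq_succ_of_ne_zero hn.ne'
  rw [pow_succ, mul_apply]
  exact ((h ^ k).strictMono hx).trans_le (pow_apply_le hx.le k)

lemma exists_coprime_of_le_apply {f : SmoothLift} {q : ℕ} {p : ℤ} {x₁ : ℝ} (hq : 0 < q)
    (hF : ∀ x, x ≤ f.lat q (-p) x) (hx : f.lat q (-p) x₁ = x₁) :
    ∃ (q' : ℕ) (p' a b : ℤ), 0 < q' ∧ a * p' + b * q' = 1 ∧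
      (∀ x, x ≤ f.lat q' (-p') x) ∧ f.lat q' (-p') x₁ = x₁ := by
  have hq' : (q : ℤ) ≠ 0 := by exact_mod_cast hq.ne'
  obtain ⟨d, p', q', hd, hc, e1, e2⟩ := Int.exists_gcd_one'
    (Int.gcd_pos_of_ne_zero_right p hq')
  have hd' : (0 : ℤ) < d := by exact_mod_cast hd
  lift q' to ℕ using by
    refine nonneg_of_mul_nonneg_left (b := (d : ℤ)) ?_ hd'
    rw [← e2]; positivity
  obtain ⟨a, b, hab⟩ := Int.isCoprime_iff_gcd_eq_one.2 hc
  have he : f.lat q (-p) = f.lat q' (-p') ^ d := by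
    rw [← zpow_natCast, lat_zpow, e1, e2]
    congr 1 <;> ring
  rw [he] at hF hx
  have hle (x : ℝ) : x ≤ f.lat q' (-p') x := by
    by_contra! h
    exact (hF x).not_gt (pow_apply_lt h hd)
  refine ⟨q', p', a, b, Nat.pos_of_ne_zero ?_, hab, hle, ?_⟩
  · rintro rfl
    simp at e2
    omega
  · by_contra hne
    exact (lt_pow_apply hle ((hle x₁).lt_of_ne' hne) hd).ne' hx

lemma tr_mul_lat_le (f : SmoothLift) {t : ℝ} (ht : 0 ≤ t) {q : ℕ} (hq : 0 < q) (j : ℤ) (x : ℝ) :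
    (tr (-t) * f).lat q j x ≤ f.lat q j x - t := by
  obtain ⟨k, rfl⟩ := Nat.exists_eq_succ_of_ne_zero hq.ne'
  have hle : ∀ x, (tr (-t) * f) x ≤ f x := fun x => by rw [mul_apply, tr_apply]; linarith
  have := f.monotone (pow_le_pow hle k x)
  rw [lat_apply_nat, lat_apply_nat, pow_succ', pow_succ', mul_apply, mul_apply, mul_apply,
    tr_apply]
  linarith

lemma exists_goodParab {f : SmoothLift}
    (hf : ∀ (q : ℕ) (p : ℤ), 0 < q → ∀ x, f.lat q (-p) x ≠ x) {V : Set SmoothLift} (hV : V ∈ 𝓝 f) :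
    ∃ η ε₀ : ℝ, 0 < η ∧ η ≤ 1 / 2 ∧ 0 < ε₀ ∧ ε₀ < 1 ∧ (goodParab η ε₀ ∩ V).Nonempty := by
  have hc : Continuous fun t : ℝ => tr (-t) * f :=
    (continuous_tr.comp continuous_neg).mul continuous_const
  have hev : ∀ᶠ t in 𝓝 (0 : ℝ), V ∈ 𝓝 (tr (-t) * f) := by
    refine hc.continuousAt.eventually (eventually_mem_nhds_iff.2 ?_)
    simpa [tr_zero] using hV
  obtain ⟨ρ, hρ, hball⟩ := Metric.eventually_nhds_iff.1 hev
  have ht0 : 0 < min (ρ / 2) 1 := lt_min (by positivity) one_pos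
  set t₀ := min (ρ / 2) 1
  obtain ⟨q, p, x, hq, hx1, hx2⟩ := exists_small_return hf ht0 (min_le_right _ _)
  obtain ⟨t, ht, hF, x₁, hx₁⟩ := exists_le_apply_of_continuous
    (Φ := fun t => (tr (-t) * f).lat q (-p)) (t₁ := t₀) (t₂ := 0)
    ((continuous_lat q (-p)).comp hc)
    ⟨x, by linarith [f.tr_mul_lat_le ht0.le hq (-p) x]⟩ (fun y => by
      rw [neg_zero, tr_zero, one_mul]
      by_contra! hcon
      have hc : Continuous fun x => f.lat q (-p) x - x :=
        (f.lat q (-p)).continuous.sub continuous_id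
      obtain ⟨z, hz⟩ := mem_range_of_exists_le_of_exists_ge hc
        ⟨y, sub_nonpos.2 hcon⟩ ⟨x, sub_nonneg.2 hx1.le⟩
      exact hf q p hq z (sub_eq_zero.1 hz))
  have hVt : V ∈ 𝓝 (tr (-t) * f) := hball (by
    rw [Set.uIcc_of_ge ht0.le] at ht
    rw [Real.dist_eq, sub_zero, abs_of_nonneg ht.1]
    have := ht.2.trans (min_le_left _ _)
    linarith)
  generalize tr (-t) * f = h at hF hx₁ hVt
  obtain ⟨q, p, a, b, hq, hb, hF, hx₁⟩ := exists_coprime_of_le_apply hq hF hx₁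
  have hs := lt_apply_of_fixed hb hx₁
  have hs' : (h.lat a b)⁻¹ x₁ < x₁ := by
    rwa [← (h.lat a b).strictMono.lt_iff_lt, apply_inv_apply]
  obtain ⟨ε, h0, hε1, hε2, hε⟩ : ∃ ε : ℝ, 0 < ε ∧ ε ≤ h.lat a b x₁ - x₁ ∧
      ε ≤ x₁ - (h.lat a b)⁻¹ x₁ ∧ ε ≤ 1 / 2 :=
    ⟨min (min (h.lat a b x₁ - x₁) (x₁ - (h.lat a b)⁻¹ x₁)) (1 / 2),
      lt_min (lt_min (sub_pos.2 hs) (sub_pos.2 hs')) (by norm_num),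
      (min_le_left _ _).trans (min_le_left _ _), (min_le_left _ _).trans (min_le_right _ _),
      min_le_right _ _⟩
  obtain ⟨m, hm, hmu⟩ := exists_quadBump_ge h0 hε
  obtain ⟨κ, hκ, hκV⟩ := h.exists_smul_perturbation (interior_mem_nhds.2 hVt)
    (ψ := fun x => quadBump ε (x - x₁))
    ((contDiff_quadBump ε).comp (contDiff_id.sub contDiff_const)) (fun x => by
      change quadBump ε (x + 1 - x₁) = quadBump ε (x - x₁)
      rw [add_sub_right_comm, periodic_quadBump ε])
  obtain ⟨f₂, hf₂V, hf₂⟩ := hκV κ (abs_of_pos hκ).le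
  have hM0 : 0 < deriv h x₁ + 1 := by linarith [h.deriv_pos x₁]
  obtain ⟨g, hgV, -, H, hT, hl, hD⟩ := exists_parab_quadBump (M := deriv h x₁ + 1) hq hb hF hx₁ h0
    hε hε1 hε2 hκ hm hmu (lt_add_one _) hf₂ (mem_interior_iff_mem_nhds.1 hf₂V)
  have hD0 : 0 < iteratedDeriv 2 (g.lat q (-p)) x₁ := lt_of_lt_of_le (by positivity) hD
  set D := iteratedDeriv 2 (g.lat q (-p)) x₁ with hDdef
  refine ⟨min (1 / 2) (D / 2), ε / 2, lt_min (by norm_num) (by positivity), min_le_left _ _,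
    by positivity, by linarith, g, ⟨⟨q, p, a, b, x₁, H⟩, hT, ?_⟩, hgV⟩
  rintro i j hi ⟨h2, h1⟩
  obtain ⟨u, hu, e⟩ := H.exists_eq_zpow_of_close hi (ε := ε)
    ((h1 x₁).trans_lt (by linarith)) (by rwa [hl]) (by rwa [lat_inv, hl, ← lat_inv])
  have h3 := h2 x₁
  rw [e, iteratedDeriv_two_zpow H.fix_base (deriv_eq_one_of_le H.le_apply H.fix_base), abs_mul,
    ← hDdef, abs_of_pos hD0] at h3
  have h4 : (1 : ℝ) ≤ |(u : ℝ)| := by exact_mod_cast Int.one_le_abs hu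
  have h5 := min_le_right (1 / 2) (D / 2)
  nlinarith

lemma exists_shift_add_quadBump (f : SmoothLift) {V : Set SmoothLift} (hV : V ∈ 𝓝 f) (ε : ℝ) :
    ∃ τ κ : ℝ, 0 < τ ∧ 0 < κ ∧ ∀ t, |t| ≤ τ → ∀ x₁, ∃ f₂ ∈ V, ∀ x,
      f₂ x = (tr t * f) x + κ * quadBump ε (x - x₁) := by
  obtain ⟨r, δ, hδ, h⟩ := f.exists_perturbation_bound hV
  obtain ⟨κ, hκ, hb⟩ := exists_scale (contDiff_quadBump ε) (periodic_quadBump ε) r (half_pos hδ)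
  refine ⟨δ / 2, κ, half_pos hδ, hκ, fun t ht x₁ => ?_⟩
  have hs (k : ℕ) (x : ℝ) : iteratedDeriv k (fun x => κ * quadBump ε (x - x₁)) x =
      iteratedDeriv k (fun x => κ * quadBump ε x) (x - x₁) :=
    congrFun (iteratedDeriv_comp_sub_const k (fun x => κ * quadBump ε x) x₁) x
  obtain ⟨g, hgV, hg⟩ := h (fun x => t + κ * quadBump ε (x - x₁))
    (contDiff_const.add (contDiff_const.mul
      ((contDiff_quadBump ε).comp (contDiff_id.sub contDiff_const))))
    (fun x => by
      change t + κ * quadBump ε (x + 1 - x₁) = t + κ * quadBump ε (x - x₁)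
      rw [add_sub_right_comm, periodic_quadBump ε])
    (fun k hk x => by
      have h1 := hb κ (abs_of_pos hκ).le k hk (x - x₁)
      rw [← hs] at h1
      rcases k.eq_zero_or_pos with rfl | hk0
      · rw [iteratedDeriv_zero] at h1 ⊢
        exact (abs_add_le _ _).trans (by linarith)
      · rw [iteratedDeriv_const_add hk0]
        linarith)
  refine ⟨g, hgV, fun x => ?_⟩
  rw [hg, mul_apply, tr_apply]
  ring

lemma lat_add_le_tr_mul_lat (f : SmoothLift) {t : ℝ} (ht : 0 ≤ t) {q : ℕ} (hq : 0 < q) (j : ℤ)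
    (x : ℝ) : f.lat q j x + t ≤ (tr t * f).lat q j x := by
  have := (tr t * f).tr_mul_lat_le ht hq j x
  rw [← mul_assoc, ← tr_add, neg_add_cancel, tr_zero, one_mul] at this
  linarith

lemma continuous_tr_mul (f : SmoothLift) : Continuous fun t : ℝ => tr t * f :=
  continuous_tr.mul continuous_const

lemma Parab.exists_bifurcation {f : SmoothLift} {q : ℕ} {p a b : ℤ} {x₀ : ℝ}
    (H : Parab f q p a b x₀) {t₀ : ℝ} (ht₀ : 0 < t₀) :
    ∃ (q' : ℕ) (p' : ℤ), 0 < q' ∧ q * p' + -p * q' = 1 ∧ ∃ t ∈ Set.Icc 0 t₀,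
      (∀ x, x ≤ (tr t * f).lat q' (-p') x) ∧ ∃ x, (tr t * f).lat q' (-p') x = x := by
  set g := tr t₀ * f with hg
  obtain ⟨C, hC, hCb⟩ := exists_forall_abs_le_of_periodic
    (φ := fun x => (g.lat a b)⁻¹ x - x)
    ((g.lat a b)⁻¹.continuous.sub continuous_id) (g.lat a b)⁻¹.periodic_sub_id
  obtain ⟨N₁, hN₁⟩ := exists_nat_gt (C / t₀)
  obtain ⟨N, hN1, hNa⟩ : ∃ N : ℕ, N₁ ≤ N ∧ a < N := ⟨max N₁ (a.toNat + 1), le_max_left _ _, by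
    have := le_max_right N₁ (a.toNat + 1)
    omega⟩
  have hN : C < N * t₀ := by
    rw [div_lt_iff₀ ht₀] at hN₁
    have : (N₁ : ℝ) ≤ N := by exact_mod_cast hN1
    nlinarith
  have hqZ : (1 : ℤ) ≤ q := by exact_mod_cast H.q_pos
  have hNq : (N : ℤ) ≤ N * q := le_mul_of_one_le_right (by positivity) hqZ
  obtain ⟨q', hq'⟩ : ∃ q' : ℕ, (q' : ℤ) = N * q - a :=
    ⟨(N * q - a).toNat, Int.toNat_of_nonneg (by linarith)⟩
  have hq'0 : 0 < q' := by
    have : (0 : ℤ) < q' := by rw [hq']; linarith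
    exact_mod_cast this
  have hF (h : SmoothLift) : h.lat q' (-(N * p + b)) = h.lat q (-p) ^ N * (h.lat a b)⁻¹ := by
    rw [← zpow_natCast, lat_zpow, lat_inv, ← lat_add, hq']
    congr 1
    ring
  have hlt : f.lat q' (-(N * p + b)) x₀ ≤ x₀ := by
    rw [hF, ((f.lat_commute _ _ _ _).pow_left N).inv_right.eq, mul_apply,
      ← zpow_natCast, zpow_apply_eq_self H.fix_base, ← (f.lat a b).strictMono.le_iff_le,
      apply_inv_apply]
    exact H.base_lt.le
  have hpow (n : ℕ) (x : ℝ) : x + n * t₀ ≤ (g.lat q (-p) ^ n) x := by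
    induction n with
    | zero => simp
    | succ n ih =>
      rw [pow_succ', mul_apply]
      have h1 := f.lat_add_le_tr_mul_lat ht₀.le H.q_pos (-p) ((g.lat q (-p) ^ n) x)
      have h2 := H.le_apply ((g.lat q (-p) ^ n) x)
      rw [← hg] at h1
      push_cast
      linarith
  obtain ⟨t, ht, h1, h2⟩ := exists_le_apply_of_continuous
    (Φ := fun t => (tr t * f).lat q' (-(N * p + b))) (t₁ := 0) (t₂ := t₀)
    ((continuous_lat _ _).comp f.continuous_tr_mul) ⟨x₀, by rwa [tr_zero, one_mul]⟩ (fun x => by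
      rw [← hg, hF, mul_apply]
      linarith [hpow N ((g.lat a b)⁻¹ x), (abs_le.1 (hCb x)).1])
  rw [Set.uIcc_of_le ht₀.le] at ht
  refine ⟨q', N * p + b, hq'0, ?_, t, ht, h1, h2⟩
  rw [hq']
  linear_combination H.bezout

lemma Parab.exists_displacement {f : SmoothLift} {q : ℕ} {p a b : ℤ} {x₀ : ℝ}
    (H : Parab f q p a b x₀) {c c' : ℝ} (hc : c ∈ Set.Ioo x₀ (f.lat a b x₀))
    (hc' : c' ∈ Set.Ioo x₀ (f.lat a b x₀)) (hcc : c ≤ c') :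
    ∃ ε, 0 < ε ∧ ε ≤ 1 / 2 ∧ ∀ x ∈ Set.Icc c c', ε < f.lat q (-p) x - x ∧
      ε < x - (f.lat q (-p))⁻¹ x := by
  have hcont : Continuous fun x => min (f.lat q (-p) x - x) (x - (f.lat q (-p))⁻¹ x) :=
    ((f.lat q (-p)).continuous.sub continuous_id).min
      (continuous_id.sub (f.lat q (-p))⁻¹.continuous)
  obtain ⟨z, hz, hmin⟩ := isCompact_Icc.exists_isMinOn (Set.nonempty_Icc.2 hcc) hcont.continuousOn
  have hz1 := H.lt_apply ⟨hc.1.trans_le hz.1, hz.2.trans_lt hc'.2⟩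
  have hz2 : (f.lat q (-p))⁻¹ z < z := by
    rwa [← (f.lat q (-p)).strictMono.lt_iff_lt, apply_inv_apply]
  have hpos : 0 < min (f.lat q (-p) z - z) (z - (f.lat q (-p))⁻¹ z) :=
    lt_min (sub_pos.2 hz1) (sub_pos.2 hz2)
  refine ⟨min (min (f.lat q (-p) z - z) (z - (f.lat q (-p))⁻¹ z) / 2) (1 / 2),
    lt_min (half_pos hpos) (by norm_num), min_le_right _ _, fun x hx => ?_⟩
  have h1 := (min_le_left (min (f.lat q (-p) z - z) (z - (f.lat q (-p))⁻¹ z) / 2)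
    (1 / 2)).trans_lt ((half_lt_self hpos).trans_le (isMinOn_iff.1 hmin x hx))
  exact lt_min_iff.1 h1

/-- A nondegenerate parabolic lift is rigid once backward orbits contract enough. -/
lemma Parab.rigid {f g : SmoothLift} {q q' : ℕ} {p p' : ℤ} {x₁ η ε₀ ε θ A : ℝ} {l : ℕ}
    (H : Parab g q' p' q (-p) x₁) (hle : ∀ x, f x ≤ g x)
    (hl : ∀ i j : ℤ, g.lat i j x₁ = f.lat i j x₁)
    (hε1 : ε ≤ f.lat q (-p) x₁ - x₁) (hε2 : ε ≤ x₁ - (f.lat q (-p))⁻¹ x₁)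
    (hθ : 0 < θ) (hd : deriv ((f.lat q (-p))⁻¹ ^ l : SmoothLift) x₁ < θ)
    (hA : 0 < A) (hD : A ≤ iteratedDeriv 2 (g.lat q' (-p')) x₁) (hη : η < θ⁻¹ * A)
    (hclose : ∀ k : SmoothLift, Commute k g → (∀ x, |iteratedDeriv 2 k x| ≤ η) →
      (∀ x, |k x - x| ≤ ε₀) → ∀ x, |k x - x| < ε) : Rigid η ε₀ g := by
  rintro i j hi ⟨h2, h1⟩
  obtain ⟨u, hu, e⟩ := H.exists_eq_zpow_of_close hi
    (hclose _ (g.lat_commute_self i j) h2 h1 x₁) (by rwa [hl]) (by rwa [lat_inv, hl, ← lat_inv])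
  have hpow (h : SmoothLift) : h.lat (l * q : ℕ) (l * -p) = h.lat q (-p) ^ l := by
    rw [← zpow_natCast, lat_zpow, Nat.cast_mul]
  set K := f.lat (l * q : ℕ) (l * -p) with hK
  set L := g.lat (l * q : ℕ) (l * -p) with hL
  have hy : L⁻¹ x₁ = K⁻¹ x₁ := by rw [hK, hL, lat_inv, lat_inv, hl]
  set y := K⁻¹ x₁ with hyd
  have hKy : K y = x₁ := apply_inv_apply _ _
  have hLy : L y = x₁ := by rw [← hy, apply_inv_apply]
  have hdL : deriv L y = deriv K y :=
    deriv_eq_of_le (lat_le_lat hle (l * q) (l * -p)) (hLy.trans hKy.symm)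
  rw [inv_pow, ← hpow, deriv_inv, ← hyd] at hd
  have hdK : θ⁻¹ < deriv K y := by
    rw [inv_lt_comm₀ (K.deriv_pos y) hθ] at hd
    exact hd
  have hc : Commute L (g.lat q' (-p')) := g.lat_commute _ _ _ _
  have hFy : g.lat q' (-p') y = y := by
    rw [← L.injective.eq_iff, ← mul_apply, hc.eq, mul_apply, hLy, H.fix_base]
  have hdy := deriv_eq_one_of_le H.le_apply hFy
  have hD2 := iteratedDeriv_two_of_commute hc hLy H.fix_base hdy
    (deriv_eq_one_of_le H.le_apply H.fix_base)
  have h3 := h2 y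
  rw [e, iteratedDeriv_two_zpow hFy hdy, hD2, abs_mul, hdL] at h3
  have h4 : (1 : ℝ) ≤ |(u : ℝ)| := by exact_mod_cast Int.one_le_abs hu
  have h5 : θ⁻¹ * A ≤ deriv K y * iteratedDeriv 2 (g.lat q' (-p')) x₁ :=
    mul_le_mul hdK.le hD hA.le (K.deriv_pos y).le
  have h6 : 0 < θ⁻¹ * A := by positivity
  rw [abs_of_pos (h6.trans_le h5)] at h3
  nlinarith

lemma Parab.exists_goodParab_near {f : SmoothLift} {q : ℕ} {p a b : ℤ} {x₀ : ℝ}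
    (H : Parab f q p a b x₀) (hT : TrivC1 f) {η ε₀ : ℝ} (hη : 0 < η) (hη' : η ≤ 1 / 2)
    (hε₀ : ε₀ < 1) (hR : Rigid η ε₀ f) {V : Set SmoothLift} (hV : V ∈ 𝓝 f) :
    ∃ g ∈ goodParab η ε₀, g ∈ V ∧ ∃ (q' : ℕ) (p' : ℤ), 0 < q' ∧ q * p' + -p * q' = 1 ∧
      ∃ x, g.lat q' (-p') x = x := by
  obtain ⟨c, hc⟩ := exists_between H.base_lt
  set e := f.lat q (-p) with he
  have hec : e c ∈ Set.Ioo x₀ (f.lat a b x₀) := H.attracting.apply_mem hc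
  have hc2 : e (e c) ∈ Set.Ioo x₀ (f.lat a b x₀) := H.attracting.apply_mem hec
  have hlt1 : c < e c := H.lt_apply hc
  have hlt2 : e c < e (e c) := H.lt_apply hec
  obtain ⟨ε, hε, hε1, hdisp⟩ := H.exists_displacement hc hc2 (hlt1.trans hlt2).le
  have hW := interior_mem_nhds.2 (inter_mem hV (hT.eventually_close hη' hε₀ hR hε))
  obtain ⟨τ, κ, hτ, hκ, hpert⟩ := f.exists_shift_add_quadBump hW ε
  obtain ⟨m, hm, hmu⟩ := exists_quadBump_ge hε hε1
  obtain ⟨M, hM, hMb⟩ := f.exists_deriv_upper_bound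
  have hA : 0 < κ * m / M := by positivity
  obtain ⟨l, hl⟩ := H.attracting_inv.exists_deriv_pow_lt hc hc2 (div_pos hA hη)
  have hcont : Continuous fun z : ℝ × ℝ => ((tr z.1 * f).lat q (-p), z.2) :=
    ((continuous_lat _ _).comp (f.continuous_tr_mul.comp continuous_fst)).prodMk continuous_snd
  have hconti (n : ℕ) :
      Continuous fun z : ℝ × ℝ => (((tr z.1 * f).lat q (-p))⁻¹ ^ n, z.2) :=
    (((continuous_lat _ _).comp (f.continuous_tr_mul.comp continuous_fst)).inv.pow n).prodMk
      continuous_snd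
  have h0 : tr 0 * f = f := by rw [tr_zero, one_mul]
  have hev : ∀ᶠ t in 𝓝 (0 : ℝ), ∀ x ∈ Set.Icc c (e (e c)),
      (ε < (tr t * f).lat q (-p) x - x ∧ ε < x - ((tr t * f).lat q (-p))⁻¹ x) ∧
      deriv (((tr t * f).lat q (-p))⁻¹ ^ l : SmoothLift) x < κ * m / M / η := by
    refine isCompact_Icc.eventually_forall_of_forall_eventually fun x hx => ?_
    refine (Eventually.and ?_ ?_).and ?_
    · refine continuousAt_const.eventually_lt
        ((continuous_eval.comp hcont).sub continuous_snd).continuousAt ?_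
      simp only [h0]
      exact (hdisp x hx).1
    · have := continuous_eval.comp (hconti 1)
      simp only [pow_one] at this
      refine continuousAt_const.eventually_lt (continuous_snd.sub this).continuousAt ?_
      simp only [h0]
      exact (hdisp x hx).2
    · refine (continuous_deriv.comp (hconti l)).continuousAt.eventually_lt continuousAt_const ?_
      simp only [Function.comp_apply, h0]
      exact hl x hx
  have hev' : ∀ᶠ t in 𝓝 (0 : ℝ), (tr t * f).lat q (-p) c < e (e c) := by
    refine (continuous_eval.comp (hcont.comp
      (continuous_id.prodMk continuous_const))).continuousAt.eventually_lt continuousAt_const ?_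
    simp only [Function.comp_apply, id, h0]
    exact hlt2
  obtain ⟨ρ, hρ, hball⟩ := Metric.eventually_nhds_iff.1 (hev.and hev')
  obtain ⟨q', p', hq', hb, t, ht, hF, y, hy⟩ :=
    H.exists_bifurcation (lt_min (half_pos hρ) hτ)
  obtain ⟨hJ, hJc⟩ := hball (y := t) (by
    rw [Real.dist_eq, sub_zero, abs_of_nonneg ht.1]
    exact (ht.2.trans (min_le_left _ _)).trans_lt (half_lt_self hρ))
  have hpt := hpert t (by rw [abs_of_nonneg ht.1]; exact ht.2.trans (min_le_right _ _))
  have hMt (x : ℝ) : deriv (tr t * f : SmoothLift) x < M := by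
    have h1 : (tr t * f : SmoothLift) = fun x => f x + t := funext fun x => by simp
    rw [h1, deriv_add_const]
    exact hMb x
  generalize tr t * f = h at hF hy hJ hJc hpt hMt
  obtain ⟨w, hw1, hw2⟩ := exists_zpow_mem_Ico hb hy c
  have hx₁ := zpow_apply_fixed (a := q) (b := -p) hy (w + 1)
  have hx₁J : (h.lat q (-p) ^ (w + 1)) y ∈ Set.Icc c (e (e c)) := by
    refine ⟨hw2.le, le_trans ?_ hJc.le⟩
    rw [add_comm, zpow_add, zpow_one, mul_apply]
    exact (h.lat q (-p)).monotone hw1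
  generalize (h.lat q (-p) ^ (w + 1)) y = x₁ at hx₁ hx₁J
  obtain ⟨⟨hd1, hd2⟩, hd3⟩ := hJ x₁ hx₁J
  obtain ⟨f₂, hf₂W, hf₂⟩ := hpt x₁
  obtain ⟨g, ⟨hgV, hgc⟩, hle, Hg, hTg, hlat, hD⟩ := exists_parab_quadBump hq' hb hF hx₁ hε hε1
    hd1.le hd2.le hκ hm hmu (hMt x₁) hf₂ (mem_interior_iff_mem_nhds.1 hf₂W)
  refine ⟨g, ⟨⟨q', p', q, -p, x₁, Hg⟩, hTg, Hg.rigid hle hlat hd1.le hd2.le (div_pos hA hη) hd3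
    (by positivity) hD ?_ hgc⟩, hgV, q', p', hq', hb, x₁, Hg.fix_base⟩
  rw [inv_div, div_mul_eq_mul_div, lt_div_iff₀ hA]
  nlinarith [mul_pos hη hA]

lemma exists_goodParab_lat_ne {η ε₀ : ℝ} (hη : 0 < η) (hη' : η ≤ 1 / 2) (hε₀ : ε₀ < 1)
    {f : SmoothLift} (hf : f ∈ goodParab η ε₀) {q : ℕ} (p : ℤ) (hq : 0 < q) {V : Set SmoothLift}
    (hV : V ∈ 𝓝 f) : ∃ g ∈ goodParab η ε₀, g ∈ V ∧ ∀ x, g.lat q (-p) x ≠ x := by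
  by_cases hper : ∀ x, f.lat q (-p) x ≠ x
  · exact ⟨f, hf, mem_of_mem_nhds hV, hper⟩
  push Not at hper
  obtain ⟨x, hx⟩ := hper
  obtain ⟨⟨q₀, p₀, a, b, x₀, H⟩, hT, hR⟩ := hf
  obtain ⟨g, hg, hgV, q', p', hq', hb, x', hx'⟩ :=
    H.exists_goodParab_near hT hη hη' hε₀ hR hV
  refine ⟨g, hg, hgV, fun z hz => ?_⟩
  have e1 := mul_eq_mul_of_periodic H.q_pos hq H.fix_base hx
  have e2 := mul_eq_mul_of_periodic hq' hq hx' hz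
  have : (q : ℤ) = 0 := by linear_combination (-q) * hb + q₀ * e2 - q' * e1
  omega

end SmoothLift

/-- **Yoccoz.** (i) For a generic `f ∈ F_I^∞` (in the `C^∞` topology) the centralizer
`Z^∞(f)` coincides with `Z₀^∞(f)`, the `C^∞`-closure of the group of iterates of `f`.
(ii) Moreover, for a dense set of `f ∈ F_I^∞` one has
`Z^∞(f) = Z₀^∞(f) = {fⁿ : n ∈ ℤ}`. -/
theorem yoccoz_centralizers :
    (∃ R : Set FIrrational, IsGδ R ∧ Dense R ∧
      ∀ F ∈ R, CentralizerLifts F.1.1 =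
        closure {G : SmoothLift | IsIterateLift F.1.1 G.1}) ∧
    (∃ D : Set FIrrational, Dense D ∧
      ∀ F ∈ D, CentralizerLifts F.1.1 = {G : SmoothLift | IsIterateLift F.1.1 G.1} ∧
        closure {G : SmoothLift | IsIterateLift F.1.1 G.1} =
          {G : SmoothLift | IsIterateLift F.1.1 G.1}) := by
  exact SmoothLift.centralizers_of_perturbations
    (fun _ hf _ hV => SmoothLift.exists_goodParab hf hV)
    (fun _ _ hη hη' _ hε₀ _ hf _ p hq _ hV =>
      SmoothLift.exists_goodParab_lat_ne hη hη' hε₀ hf p hq hV)
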